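/- arXiv:2401.12581 — 3 statements merged into one kernel-verified Lean document; each statement's English description precedes it below -/
import Mathlib

section
/- For every j ∈ ℕ, the function ΛQ_j : [1,∞) → ℝ defined by ΛQ_j(r) = (1/m)·Q_j(r) + r·Q_j'(r) satisfies (ΛQ_j)''(r) + (2/r)(ΛQ_j)'(r) + (2m+1)·Q_j(r)^{2m}·ΛQ_j(r) = 0 for all r > 1, and the set {r ∈ (1,∞) : ΛQ_j(r) = 0} is finite with exactly j + 1 elements. -/
open Set Filter MeasureTheory

/-- A differentiable function whose derivative is negative at each of its zeros has at most one
zero on an interval. -/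
lemma eq_of_zeros_of_deriv_neg {g g' : ℝ → ℝ} {a b : ℝ} (hab : a ≤ b)
    (hg : ∀ x ∈ Icc a b, HasDerivAt g (g' x) x)
    (hneg : ∀ x ∈ Icc a b, g x = 0 → g' x < 0) (ha : g a = 0) (hb : g b = 0) : a = b := by
  by_contra hne
  have hlt : a < b := lt_of_le_of_ne hab hne
  have hle : ∀ x ∈ Icc a b, g x ≤ 0 := by
    intro x hx
    exact image_le_of_deriv_right_lt_deriv_boundary' (f := g) (f' := g') (B := fun _ => (0 : ℝ))
      (B' := fun _ => (0 : ℝ)) (fun y hy => (hg y hy).continuousAt.continuousWithinAt)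
      (fun y hy => (hg y ⟨hy.1, hy.2.le⟩).hasDerivWithinAt) ha.le continuousOn_const
      (fun y _ => hasDerivWithinAt_const ..) (fun y hy h => hneg y ⟨hy.1, hy.2.le⟩ h) hx
  have hbm : b ∈ Icc a b := right_mem_Icc.2 hab
  have hslope : ∀ᶠ x in nhdsWithin b {b}ᶜ, slope g b x < 0 :=
    (hasDerivAt_iff_tendsto_slope.1 (hg b hbm)).eventually_lt_const (hneg b hbm hb)
  have hleft : ∀ᶠ x in nhdsWithin b (Iio b), slope g b x < 0 :=
    hslope.filter_mono (nhdsWithin_mono _ fun x hx => ne_of_lt hx)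
  obtain ⟨x, hx, hxab⟩ := (hleft.and (Ioo_mem_nhdsLT hlt)).exists
  have hgx := hle x ⟨hxab.1.le, hxab.2.le⟩
  rw [slope_def_field, hb, sub_zero] at hx
  exact absurd hx (not_lt.2 (div_nonneg_of_nonpos hgx (by linarith [hxab.2])))

/-- A solution of a damped oscillator in a double well that decays to the unstable equilibrium,
together with its velocity, has positive energy. -/
lemma energy_pos {m : ℕ} {a : ℝ} (ha : 0 < a) (ha' : a < 1 / 2) (hm : 0 < m) {v u : ℝ → ℝ}
    (hv : ∀ t, HasDerivAt v (u t) t)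
    (hu : ∀ t, HasDerivAt u (-(1 - 2 * a) * u t + a * (1 - a) * v t - v t ^ (2 * m + 1)) t)
    (hv0 : Tendsto v atTop (nhds 0)) (hu0 : Tendsto u atTop (nhds 0))
    {T : ℝ} (hT : ∀ t > T, v t ≠ 0) (t : ℝ) :
    0 < u t ^ 2 / 2 - a * (1 - a) * v t ^ 2 / 2 + v t ^ (2 * m + 2) / (2 * m + 2) := by
  set E : ℝ → ℝ := fun t =>
    u t ^ 2 / 2 - a * (1 - a) * v t ^ 2 / 2 + v t ^ (2 * m + 2) / (2 * m + 2) with hE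
  have hm0 : (2 * (m : ℝ) + 2) ≠ 0 := by positivity
  have hEd : ∀ t, HasDerivAt E (-(1 - 2 * a) * u t ^ 2) t := by
    intro t
    have h := ((((hu t).pow 2).div_const 2).sub
      ((((hv t).pow 2).const_mul (a * (1 - a))).div_const 2)).add
      (((hv t).pow (2 * m + 2)).div_const (2 * (m : ℝ) + 2))
    refine h.congr_deriv ?_
    have e : 2 * m + 2 - 1 = 2 * m + 1 := by omega
    rw [e]
    push_cast
    field_simp
    ring
  have hanti : Antitone E := by
    refine antitone_of_hasDerivAt_nonpos hEd fun x => ?_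
    have := mul_nonneg (by linarith : 0 ≤ 1 - 2 * a) (sq_nonneg (u x))
    simp only [Pi.zero_apply]
    linarith
  have hE0 : Tendsto E atTop (nhds 0) := by
    have h := (((hu0.pow 2).div_const 2).sub
      (((hv0.pow 2).const_mul (a * (1 - a))).div_const 2)).add
      ((hv0.pow (2 * m + 2)).div_const (2 * (m : ℝ) + 2))
    simpa using h
  have hnn : ∀ s, 0 ≤ E s := fun s => hanti.le_of_tendsto hE0 s
  change 0 < E t
  refine lt_of_le_of_ne (hnn t) fun h0 => ?_
  have hz : ∀ s ≥ t, E s = 0 := fun s hs => le_antisymm (h0 ▸ hanti hs) (hnn s)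
  have huz : ∀ s > t, u s = 0 := by
    intro s hs
    have h1 : HasDerivAt E 0 s := (hasDerivAt_const s (0 : ℝ)).congr_of_eventuallyEq
      ((lt_mem_nhds hs).mono fun x hx => hz x (le_of_lt hx))
    have h2 := (hEd s).unique h1
    have h3 : -(1 - 2 * a) ≠ 0 := by linarith
    exact pow_eq_zero_iff (two_ne_zero) |>.1 ((mul_eq_zero.1 h2).resolve_left h3)
  obtain ⟨s, hst, hsT⟩ : ∃ s, t < s ∧ T < s :=
    ⟨max t T + 1, by linarith [le_max_left t T], by linarith [le_max_right t T]⟩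
  have h1 : HasDerivAt u 0 s := (hasDerivAt_const s (0 : ℝ)).congr_of_eventuallyEq
    ((lt_mem_nhds hst).mono fun x hx => huz x hx)
  have h2 := (hu s).unique h1
  have h3 := hz s hst.le
  have hvs := hT s hsT
  simp only [hE, huz s hst] at h2 h3
  have h4 : v s * (a * (1 - a) - v s ^ (2 * m)) = 0 := by
    rw [← h2]; ring
  have h5 : v s ^ (2 * m) = a * (1 - a) := by
    rcases mul_eq_zero.1 h4 with h | h
    · exact absurd h hvs
    · linarith
  have h6 : v s ^ (2 * m + 2) = a * (1 - a) * v s ^ 2 := by rw [pow_add, h5]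
  rw [h6] at h3
  have hp : 0 < a * (1 - a) * v s ^ 2 := by
    have : 0 < 1 - a := by linarith
    positivity
  have hlt : a * (1 - a) * v s ^ 2 / (2 * (m : ℝ) + 2) < a * (1 - a) * v s ^ 2 / 2 := by
    apply div_lt_div_of_pos_left hp (by norm_num)
    have : (0 : ℝ) < m := by exact_mod_cast hm
    linarith
  linarith

/-- For a decaying solution of the damped double-well oscillator, the critical points beyond
the `j`-th zero from the right are exactly `j + 1` in number. -/
lemma ncard_critical_points {m : ℕ} {a : ℝ} (ha : 0 < a) (ha' : a < 1 / 2) (hm : 0 < m)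
    {v u : ℝ → ℝ} (hv : ∀ t, HasDerivAt v (u t) t)
    (hu : ∀ t, HasDerivAt u (-(1 - 2 * a) * u t + a * (1 - a) * v t - v t ^ (2 * m + 1)) t)
    (hv0 : Tendsto v atTop (nhds 0)) (hu0 : Tendsto u atTop (nhds 0))
    {τ : ℕ → ℝ} (hτ : StrictAnti τ) (hzero : {t | v t = 0} = range τ) (j : ℕ) :
    {t | τ j < t ∧ u t = 0}.Finite ∧ {t | τ j < t ∧ u t = 0}.ncard = j + 1 := by
  have hτz : ∀ i, v (τ i) = 0 := fun i => by
    have : τ i ∈ {t | v t = 0} := hzero ▸ mem_range_self i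
    exact this
  have hne0 : ∀ t > τ 0, v t ≠ 0 := by
    intro t ht h
    have h' : t ∈ range τ := hzero ▸ (h : t ∈ {t | v t = 0})
    obtain ⟨i, rfl⟩ := h'
    exact absurd ht (not_lt.2 (hτ.antitone (Nat.zero_le i)))
  have hne1 : ∀ i, ∀ t, τ (i + 1) < t → t < τ i → v t ≠ 0 := by
    intro i t h1 h2 h
    have h' : t ∈ range τ := hzero ▸ (h : t ∈ {t | v t = 0})
    obtain ⟨k, rfl⟩ := h'
    have := hτ.lt_iff_gt.1 h1
    have := hτ.lt_iff_gt.1 h2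
    omega
  have hpos := energy_pos ha ha' hm hv hu hv0 hu0 hne0
  have hτu : ∀ i, u (τ i) ≠ 0 := by
    intro i h
    have := hpos (τ i)
    simp [h, hτz i] at this
  have hconcave : ∀ t, u t = 0 → v t ≠ 0 →
      v t * (a * (1 - a) * v t - v t ^ (2 * m + 1)) < 0 := by
    intro t h hvt
    have hE := hpos t
    rw [h] at hE
    have hp : 0 < a * (1 - a) * v t ^ 2 := by
      have : 0 < 1 - a := by linarith
      positivity
    have hq : 0 ≤ v t ^ (2 * m + 2) := (even_two_mul (m + 1)).pow_nonneg (v t)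
    have hlt : v t ^ (2 * m + 2) / (2 * (m : ℝ) + 2) ≤ v t ^ (2 * m + 2) / 2 := by
      apply div_le_div_of_nonneg_left hq (by norm_num)
      have : (0 : ℝ) < m := by exact_mod_cast hm
      linarith
    have hr : v t * (a * (1 - a) * v t - v t ^ (2 * m + 1))
      = a * (1 - a) * v t ^ 2 - v t ^ (2 * m + 2) := by ring
    rw [hr]
    linarith
  have hg : ∀ t, HasDerivAt (fun t => v t * u t) (u t * u t +
      v t * (-(1 - 2 * a) * u t + a * (1 - a) * v t - v t ^ (2 * m + 1))) t :=
    fun t => (hv t).mul (hu t)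
  have huniq : ∀ x y, x ≤ y → (∀ t ∈ Icc x y, v t ≠ 0) → u x = 0 → u y = 0 → x = y := by
    intro x y hxy hne hx hy
    refine eq_of_zeros_of_deriv_neg hxy (fun t _ => hg t) ?_ (by simp [hx]) (by simp [hy])
    intro t ht h
    have hut : u t = 0 := (mul_eq_zero.1 h).resolve_left (hne t ht)
    have := hconcave t hut (hne t ht)
    simpa [hut] using this
  have hvc : Continuous v := continuous_iff_continuousAt.2 fun t => (hv t).continuousAt
  induction j with
  | zero =>
    obtain ⟨c, hc, huc⟩ : ∃ c > τ 0, u c = 0 := by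
      have hw : ∀ t, HasDerivAt (fun t => v t ^ 2) (2 * v t * u t) t := fun t =>
        ((hv t).pow 2).congr_deriv (by simp)
      have hwc : Continuous fun t => v t ^ 2 := hvc.pow 2
      have hw0 : Tendsto (fun t => v t ^ 2) atTop (nhds 0) := by simpa using hv0.pow 2
      have hw1 : 0 < v (τ 0 + 1) ^ 2 := by
        have := hne0 (τ 0 + 1) (by simp)
        positivity
      obtain ⟨S, hS, hS'⟩ :=
        ((hw0.eventually_lt_const hw1).and (eventually_gt_atTop (τ 0 + 1))).exists
      have hmem : v S ^ 2 ∈ Icc (v (τ 0) ^ 2) (v (τ 0 + 1) ^ 2) :=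
        ⟨by rw [hτz]; simpa using sq_nonneg (v S), hS.le⟩
      obtain ⟨x, hx, hxS⟩ := intermediate_value_Icc (f := fun t => v t ^ 2)
        (by simp : τ 0 ≤ τ 0 + 1) hwc.continuousOn hmem
      obtain ⟨c, hc, hc'⟩ := exists_hasDerivAt_eq_zero (f := fun t => v t ^ 2)
        (lt_of_le_of_lt hx.2 hS') hwc.continuousOn hxS (fun t _ => hw t)
      have hc0 : τ 0 < c := lt_of_le_of_lt hx.1 hc.1
      refine ⟨c, hc0, ?_⟩
      simpa [hne0 c hc0] using hc'
    have hset : {t | τ 0 < t ∧ u t = 0} = {c} := by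
      ext t
      simp only [mem_ofPred_eq, mem_singleton_iff]
      constructor
      · rintro ⟨h1, h2⟩
        rcases le_total t c with h | h
        · exact huniq t c h (fun s hs => hne0 s (lt_of_lt_of_le h1 hs.1)) h2 huc
        · exact (huniq c t h (fun s hs => hne0 s (lt_of_lt_of_le hc hs.1)) huc h2).symm
      · rintro rfl
        exact ⟨hc, huc⟩
    rw [hset]
    simp
  | succ i ih =>
    have hlt : τ (i + 1) < τ i := hτ (Nat.lt_succ_self i)
    obtain ⟨c, hc, huc⟩ := exists_hasDerivAt_eq_zero hlt hvc.continuousOn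
      ((hτz (i + 1)).trans (hτz i).symm) (fun t _ => hv t)
    have hset : {t | τ (i + 1) < t ∧ u t = 0} = insert c {t | τ i < t ∧ u t = 0} := by
      ext t
      simp only [mem_ofPred_eq, mem_insert_iff]
      constructor
      · rintro ⟨h1, h2⟩
        rcases lt_trichotomy t (τ i) with h3 | h3 | h3
        · left
          rcases le_total t c with h | h
          · exact huniq t c h (fun s hs => hne1 i s (lt_of_lt_of_le h1 hs.1)
              (lt_of_le_of_lt hs.2 hc.2)) h2 huc
          · exact (huniq c t h (fun s hs => hne1 i s (lt_of_lt_of_le hc.1 hs.1)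
              (lt_of_le_of_lt hs.2 h3)) huc h2).symm
        · exact absurd (h3 ▸ h2) (hτu i)
        · exact Or.inr ⟨h3, h2⟩
      · rintro (rfl | ⟨h1, h2⟩)
        · exact ⟨hc.1, huc⟩
        · exact ⟨hlt.trans h1, h2⟩
    have hnot : c ∉ {t | τ i < t ∧ u t = 0} := fun h => absurd h.1 (not_lt.2 hc.2.le)
    rw [hset]
    exact ⟨ih.1.insert c, by rw [ncard_insert_of_notMem hnot ih.1, ih.2]⟩

/-- The generator of scaling applied to a solution of `f'' + (2/r) f' + f ^ (2m+1) = 0` solves the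
linearized equation. -/
lemma linearized_scaling {m : ℕ} (hm : 0 < m) {f : ℝ → ℝ}
    (hf : ∀ r > 0, HasDerivAt f (deriv f r) r)
    (hf' : ∀ r > 0, HasDerivAt (deriv f) (-(2 / r) * deriv f r - f r ^ (2 * m + 1)) r)
    {r : ℝ} (hr : 0 < r) :
    deriv (deriv (fun s => (1 / (m : ℝ)) * f s + s * deriv f s)) r
      + (2 / r) * deriv (fun s => (1 / (m : ℝ)) * f s + s * deriv f s) r
      + (2 * m + 1) * f r ^ (2 * m) * ((1 / (m : ℝ)) * f r + r * deriv f r) = 0 := by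
  have hm0 : (m : ℝ) ≠ 0 := by positivity
  have h1 : ∀ s > 0, deriv (fun s => (1 / (m : ℝ)) * f s + s * deriv f s) s
      = (1 / (m : ℝ) - 1) * deriv f s - s * f s ^ (2 * m + 1) := by
    intro s hs
    have h := ((hf s hs).const_mul (1 / (m : ℝ))).add ((hasDerivAt_id s).mul (hf' s hs))
    refine (h.congr_deriv ?_).deriv
    simp only [id]
    field_simp
    ring
  have h2 : deriv (deriv (fun s => (1 / (m : ℝ)) * f s + s * deriv f s)) r
      = (1 / (m : ℝ) - 1) * (-(2 / r) * deriv f r - f r ^ (2 * m + 1))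
        - (f r ^ (2 * m + 1) + r * ((2 * m + 1) * f r ^ (2 * m) * deriv f r)) := by
    have h := ((hf' r hr).const_mul (1 / (m : ℝ) - 1)).sub
      ((hasDerivAt_id r).mul ((hf r hr).pow (2 * m + 1)))
    have he : deriv (fun s => (1 / (m : ℝ)) * f s + s * deriv f s) =ᶠ[nhds r]
        fun s => (1 / (m : ℝ) - 1) * deriv f s - s * f s ^ (2 * m + 1) :=
      (lt_mem_nhds hr).mono h1
    rw [he.deriv_eq]
    refine (h.congr_deriv ?_).deriv
    simp
  rw [h2, h1 r hr]
  field_simp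
  ring

/-- Passing to `v t = exp (a t) Z (exp t)`, with `a = 1 / m`, turns the radial equation
`Z'' + (2/r) Z' + Z ^ (2m+1) = 0` into an autonomous one. -/
lemma emden_fowler {m : ℕ} (hm : 0 < m) {Z : ℝ → ℝ}
    (hZ : ∀ r > 0, HasDerivAt Z (deriv Z r) r)
    (hZ' : ∀ r > 0, HasDerivAt (deriv Z) (-(2 / r) * deriv Z r - Z r ^ (2 * m + 1)) r)
    {a : ℝ} (ha : a = 1 / m) {v u : ℝ → ℝ}
    (hv : ∀ t, v t = Real.exp (a * t) * Z (Real.exp t))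
    (hu : ∀ t, u t = Real.exp (a * t) * (a * Z (Real.exp t) + Real.exp t * deriv Z (Real.exp t)))
    (t : ℝ) :
    HasDerivAt v (u t) t ∧
      HasDerivAt u (-(1 - 2 * a) * u t + a * (1 - a) * v t - v t ^ (2 * m + 1)) t := by
  have hexp : HasDerivAt Real.exp (Real.exp t) t := Real.hasDerivAt_exp t
  have hexpa : HasDerivAt (fun t => Real.exp (a * t)) (Real.exp (a * t) * a) t := by
    simpa using ((hasDerivAt_id t).const_mul a).exp
  have hp : 0 < Real.exp t := Real.exp_pos t
  have hz : HasDerivAt (fun t => Z (Real.exp t)) (deriv Z (Real.exp t) * Real.exp t) t :=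
    (hZ _ hp).comp t hexp
  have hz' := (hZ' _ hp).comp t hexp
  have hvf : v = fun t => Real.exp (a * t) * Z (Real.exp t) := funext hv
  have huf : u = fun t => Real.exp (a * t) *
    (a * Z (Real.exp t) + Real.exp t * deriv Z (Real.exp t)) := funext hu
  constructor
  · rw [hvf, hu]
    refine (hexpa.mul hz).congr_deriv ?_
    ring
  · have hpow : Real.exp (a * t) ^ (2 * m + 1) = Real.exp (a * t) * Real.exp t ^ 2 := by
      rw [pow_succ, mul_comm, ← Real.exp_nat_mul, ← Real.exp_nat_mul, ha]
      have : (m : ℝ) ≠ 0 := by positivity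
      congr 2
      push_cast
      field_simp
    rw [hu, hv, huf, mul_pow, hpow]
    refine (hexpa.mul ((hz.const_mul a).add (hexp.mul hz'))).congr_deriv ?_
    simp only [Function.comp, Pi.add_apply, Pi.mul_apply]
    field_simp
    ring

/-- If `r Z → 1` and `r ^ 2 Z' → -1` at infinity, the Emden–Fowler variables decay. -/
lemma emden_fowler_tendsto_zero {a : ℝ} (ha : a < 1) {Z Z' : ℝ → ℝ}
    (hZ : Tendsto (fun r => r * Z r) atTop (nhds 1))
    (hZ' : Tendsto (fun r => r ^ 2 * Z' r) atTop (nhds (-1))) :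
    Tendsto (fun t => Real.exp (a * t) * Z (Real.exp t)) atTop (nhds 0) ∧
      Tendsto (fun t => Real.exp (a * t) * (a * Z (Real.exp t) + Real.exp t * Z' (Real.exp t)))
        atTop (nhds 0) := by
  have he : Tendsto (fun t => Real.exp ((a - 1) * t)) atTop (nhds 0) :=
    Real.tendsto_exp_atBot.comp (tendsto_id.const_mul_atTop_of_neg (by linarith))
  have hm : ∀ t, Real.exp (a * t) = Real.exp ((a - 1) * t) * Real.exp t := fun t => by
    rw [← Real.exp_add]; ring_nf
  have h1 := he.mul (hZ.comp Real.tendsto_exp_atTop)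
  have h2 := he.mul (hZ'.comp Real.tendsto_exp_atTop)
  constructor
  · rw [zero_mul] at h1
    refine h1.congr fun t => ?_
    simp only [Function.comp, hm]
    ring
  · have h3 := (h1.const_mul a).add h2
    rw [zero_mul, zero_mul, mul_zero, add_zero] at h3
    refine h3.congr fun t => ?_
    simp only [Function.comp, hm]
    ring

/-- $ΛQ_j = \frac1m Q_j + r Q_j'$ solves the linearized equation and
has exactly $j+1$ zeros in $(1,∞)$. -/
theorem stmt_5
    (m : ℕ) (hm : 2 < m)
    (Z : ℝ → ℝ) (rs : ℕ → ℝ)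
    (hZreg : ContDiffOn ℝ 2 Z (Set.Ioi 0))
    (hZode : ∀ r > (0:ℝ), deriv (deriv Z) r + (2 / r) * deriv Z r + Z r ^ (2 * m + 1) = 0)
    (hZdecay : ∃ C > (0:ℝ), ∀ r ≥ (1:ℝ), |r * Z r - 1| ≤ C / r ^ 2)
    (hZderiv : Filter.Tendsto (fun r => r ^ 2 * deriv Z r) Filter.atTop (nhds (-1)))
    (hrs_pos : ∀ j, 0 < rs j)
    (hrs_anti : StrictAnti rs)
    (hrs_lim : Filter.Tendsto rs Filter.atTop (nhds 0))
    (hrs_zeros : {r : ℝ | 0 < r ∧ Z r = 0} = Set.range rs)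
    (Q : ℕ → ℝ → ℝ)
    (hQ : ∀ j r, Q j r = rs j ^ ((1:ℝ) / (m:ℝ)) * Z (rs j * r))
    (j : ℕ) :
    (∀ r > (1:ℝ),
        deriv (deriv (fun s => (1 / (m:ℝ)) * Q j s + s * deriv (Q j) s)) r
          + (2 / r) * deriv (fun s => (1 / (m:ℝ)) * Q j s + s * deriv (Q j) s) r
          + (2 * m + 1) * Q j r ^ (2 * m) * ((1 / (m:ℝ)) * Q j r + r * deriv (Q j) r) = 0)
    ∧ {r : ℝ | 1 < r ∧ (1 / (m:ℝ)) * Q j r + r * deriv (Q j) r = 0}.Finite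
    ∧ {r : ℝ | 1 < r ∧ (1 / (m:ℝ)) * Q j r + r * deriv (Q j) r = 0}.ncard = j + 1 := by
  have hm0 : 0 < m := by omega
  have hmR : (2 : ℝ) < m := by exact_mod_cast hm
  have hZd : ∀ r > 0, HasDerivAt Z (deriv Z r) r := fun r hr =>
    ((hZreg.differentiableOn (by norm_num)).differentiableAt (Ioi_mem_nhds hr)).hasDerivAt
  have hZd' : ∀ r > 0, HasDerivAt (deriv Z) (-(2 / r) * deriv Z r - Z r ^ (2 * m + 1)) r := by
    intro r hr
    have h1 : ContDiffOn ℝ 1 (deriv Z) (Ioi 0) :=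
      hZreg.deriv_of_isOpen isOpen_Ioi (by norm_num)
    have h2 := ((h1.differentiableOn (by norm_num)).differentiableAt
      (Ioi_mem_nhds hr)).hasDerivAt
    exact h2.congr_deriv (by linarith [hZode r hr])
  set ρ := rs j with hρ
  have hρ0 : 0 < ρ := hrs_pos j
  set c := ρ ^ ((1 : ℝ) / (m : ℝ)) with hc
  have hc0 : 0 < c := Real.rpow_pos_of_pos hρ0 _
  have hcpow : c ^ (2 * m + 1) = c * ρ ^ 2 := by
    have hcm : c ^ m = ρ := by
      rw [hc, one_div, Real.rpow_inv_natCast_pow hρ0.le hm0.ne']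
    rw [pow_succ, mul_comm 2 m, pow_mul, hcm]
    ring
  have hQf : Q j = fun r => c * Z (ρ * r) := funext fun r => hQ j r
  have hscale : ∀ r, HasDerivAt (fun r => ρ * r) ρ r := fun r => by
    simpa using (hasDerivAt_id r).const_mul ρ
  have hQ1 : ∀ r > 0, HasDerivAt (Q j) (c * (deriv Z (ρ * r) * ρ)) r := by
    intro r hr
    rw [hQf]
    exact ((hZd _ (mul_pos hρ0 hr)).comp r (hscale r)).const_mul c
  have hQ2 : ∀ r > 0,
      HasDerivAt (deriv (Q j)) (-(2 / r) * deriv (Q j) r - Q j r ^ (2 * m + 1)) r := by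
    intro r hr
    have h := (((hZd' _ (mul_pos hρ0 hr)).comp r (hscale r)).mul_const ρ).const_mul c
    have h' := h.congr_of_eventuallyEq
      ((lt_mem_nhds hr).mono fun s hs => (hQ1 s hs).deriv : deriv (Q j) =ᶠ[nhds r] _)
    refine h'.congr_deriv ?_
    rw [(hQ1 r hr).deriv, hQf, mul_pow, hcpow]
    field_simp
  refine ⟨fun r hr => linearized_scaling hm0
    (fun s hs => (hQ1 s hs).differentiableAt.hasDerivAt) hQ2 (by linarith), ?_⟩
  set a : ℝ := 1 / m with ha
  have ha0 : 0 < a := by positivity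
  have ha2 : a < 1 / 2 := one_div_lt_one_div_of_lt (by norm_num) hmR
  have hrZ : Tendsto (fun r => r * Z r) atTop (nhds 1) := by
    obtain ⟨C, _, hC⟩ := hZdecay
    rw [tendsto_iff_norm_sub_tendsto_zero]
    have hlim : Tendsto (fun r : ℝ => C / r ^ 2) atTop (nhds 0) :=
      tendsto_const_nhds.div_atTop (tendsto_pow_atTop (by norm_num))
    exact squeeze_zero' (Eventually.of_forall fun _ => norm_nonneg _)
      ((eventually_ge_atTop 1).mono fun r hr => hC r hr) hlim
  obtain ⟨hv0, hu0⟩ := emden_fowler_tendsto_zero (a := a) (by linarith) hrZ hZderiv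
  have hode := emden_fowler hm0 hZd hZd' ha (fun _ => rfl) (fun _ => rfl)
  have hτ : StrictAnti fun i => Real.log (rs i) := fun i k hik =>
    Real.log_lt_log (hrs_pos k) (hrs_anti hik)
  have hzero : {t | Real.exp (a * t) * Z (Real.exp t) = 0} = range fun i => Real.log (rs i) := by
    ext t
    have h : (0 < Real.exp t ∧ Z (Real.exp t) = 0) ↔ Real.exp t ∈ range rs :=
      Set.ext_iff.1 hrs_zeros (Real.exp t)
    simp only [mem_ofPred_eq, mul_eq_zero, Real.exp_ne_zero, false_or]
    rw [← and_iff_right (a := 0 < Real.exp t) (b := Z (Real.exp t) = 0) (Real.exp_pos t), h]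
    refine exists_congr fun i => ⟨fun hi => ?_, fun hi => ?_⟩
    · simp [hi]
    · rw [← hi, Real.exp_log (hrs_pos i)]
  obtain ⟨hfin, hcard⟩ := ncard_critical_points ha0 ha2 hm0 (fun t => (hode t).1)
    (fun t => (hode t).2) hv0 hu0 hτ hzero j
  have himage : {r : ℝ | 1 < r ∧ a * Q j r + r * deriv (Q j) r = 0} =
      (fun t => Real.exp t / ρ) '' {t | Real.log (rs j) < t ∧
        Real.exp (a * t) * (a * Z (Real.exp t) + Real.exp t * deriv Z (Real.exp t)) = 0} := by
    have key : ∀ r > 0, a * Q j r + r * deriv (Q j) r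
        = c * (a * Z (ρ * r) + ρ * r * deriv Z (ρ * r)) := by
      intro r hr
      rw [(hQ1 r hr).deriv, hQf]
      ring
    ext r
    simp only [mem_ofPred_eq, mem_image, mul_eq_zero, Real.exp_ne_zero, false_or]
    constructor
    · rintro ⟨h1, h2⟩
      have hr : 0 < r := by linarith
      have hp : 0 < ρ * r := mul_pos hρ0 hr
      rw [key r hr] at h2
      refine ⟨Real.log (ρ * r), ⟨Real.log_lt_log hρ0 (by nlinarith), ?_⟩, ?_⟩
      · rw [Real.exp_log hp]
        exact (mul_eq_zero.1 h2).resolve_left hc0.ne'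
      · rw [Real.exp_log hp]
        field_simp
    · rintro ⟨t, ⟨h1, h2⟩, rfl⟩
      have h3 : ρ < Real.exp t := (Real.log_lt_iff_lt_exp hρ0).1 h1
      have h4 : ρ * (Real.exp t / ρ) = Real.exp t := by field_simp
      refine ⟨(one_lt_div hρ0).2 h3, ?_⟩
      rw [key _ (by positivity), h4, h2, mul_zero]
  have hinj : Function.Injective fun t => Real.exp t / ρ := fun x y h =>
    Real.exp_injective ((div_left_inj' hρ0.ne').1 h)
  rw [himage]
  exact ⟨hfin.image _, by rw [ncard_image_of_injective _ hinj, hcard]⟩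
end

section
/- Fix j ∈ ℕ and set γ_{j,i} = r_{j−i}/r_j for i = 0, 1, …, j (so 1 = γ_{j,0} < γ_{j,1} < ⋯ < γ_{j,j} and Q_j(γ_{j,i}) = 0 for each i). Then: (a) for every i with 0 ≤ i ≤ j − 1, there is exactly one real number μ < 0 such that there exists a nonzero twice continuously differentiable function φ : [γ_{j,i}, γ_{j,i+1}] → ℝ with φ(γ_{j,i}) = φ(γ_{j,i+1}) = 0 and φ''(r) + (2/r)φ'(r) + (2m+1)·Q_j(r)^{2m}·φ(r) + μ·φ(r) = 0 on (γ_{j,i}, γ_{j,i+1}); and (b) there is exactly one real number μ < 0 such that there exists a nonzero twice continuously differentiable function φ : [γ_{j,j}, ∞) → ℝ with φ(γ_{j,j}) = 0, ∫_{γ_{j,j}}^∞ φ(r)²·r² dr < ∞, and φ''(r) + (2/r)φ'(r) + (2m+1)·Q_j(r)^{2m}·φ(r) + μ·φ(r) = 0 on (γ_{j,j}, ∞). -/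
open Set Filter MeasureTheory


open Topology

lemma hasDerivAt_volterra_primitive {K : ℝ} (hK : 0 < K) (T s : ℝ) :
    HasDerivAt (fun s => ((T - s) / K + 1 / K ^ 2) * Real.exp (-(K * (T - s))))
      ((T - s) * Real.exp (-(K * (T - s)))) s := by
  have h1 : HasDerivAt (fun s : ℝ => T - s) (-1) s := by
    simpa using (hasDerivAt_id s).const_sub T
  have h2 := ((h1.div_const K).add_const (1 / K ^ 2)).mul ((h1.const_mul K).neg.exp)
  refine h2.congr_deriv ?_
  have : K ≠ 0 := hK.ne'
  simp only [Pi.neg_apply]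
  field_simp
  ring

lemma abs_integral_volterra_le {K : ℝ} (hK : 0 < K) {a T C : ℝ} (haT : a ≤ T)
    {f : ℝ → ℝ} (hC : ∀ s, |f s| ≤ C) :
    |∫ s in a..T, (T - s) * Real.exp (-(K * (T - s))) * f s| ≤ C / K ^ 2 := by
  have hC0 : 0 ≤ C := (abs_nonneg _).trans (hC 0)
  have hint : ∫ s in a..T, (T - s) * Real.exp (-(K * (T - s))) =
      1 / K ^ 2 - ((T - a) / K + 1 / K ^ 2) * Real.exp (-(K * (T - a))) := by
    rw [intervalIntegral.integral_eq_sub_of_hasDerivAt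
      (fun s _ => hasDerivAt_volterra_primitive hK T s)
      (Continuous.intervalIntegrable (by fun_prop) _ _)]
    simp
  have h1 : |∫ s in a..T, (T - s) * Real.exp (-(K * (T - s))) * f s| ≤
      ∫ s in a..T, ((T - s) * Real.exp (-(K * (T - s)))) * C := by
    rw [← Real.norm_eq_abs]
    refine intervalIntegral.norm_integral_le_of_norm_le haT ?_
      (Continuous.intervalIntegrable (by fun_prop) _ _)
    refine Filter.Eventually.of_forall fun s hs => ?_
    have hs' : 0 ≤ (T - s) * Real.exp (-(K * (T - s))) :=
      mul_nonneg (by linarith [hs.2]) (Real.exp_pos _).le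
    rw [norm_mul, Real.norm_of_nonneg hs', Real.norm_eq_abs]
    exact mul_le_mul_of_nonneg_left (hC s) hs'
  refine h1.trans ?_
  rw [intervalIntegral.integral_mul_const, hint, div_eq_mul_one_div C, mul_comm C]
  refine mul_le_mul_of_nonneg_right ?_ hC0
  have : 0 ≤ ((T - a) / K + 1 / K ^ 2) * Real.exp (-(K * (T - a))) := by
    have : 0 ≤ T - a := by linarith
    positivity
  linarith

lemma mul_exp_neg_mul_le {K u : ℝ} (hK : 0 < K) :
    u * Real.exp (-(K * u)) ≤ 1 / K := by
  rw [Real.exp_neg, ← div_eq_mul_inv, div_le_div_iff₀ (Real.exp_pos _) hK]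
  have := Real.add_one_le_exp (K * u)
  linarith

/-- Linear second order equations with a bounded coefficient depending on a parameter have a
solution with initial data `(0, 1)` which depends continuously on the parameter. -/
theorem exists_linear_ivp_family {q : ℝ → ℝ → ℝ} (hq : Continuous (Function.uncurry q)) {M : ℝ}
    (hM : ∀ x t, |q x t| ≤ M) (a : ℝ) :
    ∃ ψ ψ₁ : ℝ → ℝ → ℝ, Continuous (Function.uncurry ψ) ∧ Continuous (Function.uncurry ψ₁) ∧
      ∀ x, ContDiff ℝ 2 (ψ x) ∧ ψ x a = 0 ∧ ψ₁ x a = 1 ∧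
        ∀ r, a ≤ r → HasDerivAt (ψ x) (ψ₁ x r) r ∧ HasDerivAt (ψ₁ x) (q x r * ψ x r) r := by
  have hM0 : 0 ≤ M := (abs_nonneg _).trans (hM 0 0)
  set K : ℝ := M + 1 with hKdef
  have hK : 0 < K := by positivity
  have hMK : M / K ^ 2 ≤ 1 / 2 := by
    rw [div_le_div_iff₀ (by positivity) (by norm_num)]
    nlinarith
  let τ : ℝ → ℝ := fun r => max r a
  have hτ : Continuous τ := continuous_id.max continuous_const
  have hτa : ∀ r, a ≤ τ r := fun r => le_max_right _ _
  let B : (ℝ × ℝ → ℝ) → ℝ × ℝ → ℝ := fun χ y =>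
    ∫ s in a..τ y.2, (τ y.2 - s) * Real.exp (-(K * (τ y.2 - s))) * (q y.1 s * χ (y.1, s))
  have hBcont : ∀ χ : ℝ × ℝ → ℝ, Continuous χ → Continuous (B χ) := by
    intro χ hχ
    refine intervalIntegral.continuous_parametric_intervalIntegral_of_continuous
      (f := fun (y : ℝ × ℝ) s =>
        (τ y.2 - s) * Real.exp (-(K * (τ y.2 - s))) * (q y.1 s * χ (y.1, s))) ?_
      (hτ.comp continuous_snd)
    have h1 : Continuous fun z : (ℝ × ℝ) × ℝ => q z.1.1 z.2 :=
      hq.comp (by fun_prop : Continuous fun z : (ℝ × ℝ) × ℝ => (z.1.1, z.2))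
    have h2 : Continuous fun z : (ℝ × ℝ) × ℝ => τ z.1.2 := by fun_prop
    show Continuous fun z : (ℝ × ℝ) × ℝ => (τ z.1.2 - z.2) *
      Real.exp (-(K * (τ z.1.2 - z.2))) * (q z.1.1 z.2 * χ (z.1.1, z.2))
    fun_prop
  have hBbound : ∀ χ : ℝ × ℝ → ℝ, Continuous χ → ∀ C, (∀ y, |χ y| ≤ C) →
      ∀ y, |B χ y| ≤ (1 / 2) * C := by
    intro χ hχ C hC y
    have hC0 : 0 ≤ C := (abs_nonneg _).trans (hC y)
    have := abs_integral_volterra_le hK (hτa y.2) (C := M * C)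
      (f := fun s => q y.1 s * χ (y.1, s))
      (fun s => by
        rw [abs_mul]
        exact mul_le_mul (hM _ _) (hC _) (abs_nonneg _) hM0)
    refine this.trans ?_
    rw [mul_div_right_comm]
    exact mul_le_mul_of_nonneg_right hMK hC0
  let k : ℝ × ℝ → ℝ := fun y => (τ y.2 - a) * Real.exp (-(K * (τ y.2 - a)))
  have hkcont : Continuous k := by fun_prop
  have hkbound : ∀ y, |k y| ≤ 1 / K := fun y => by
    rw [abs_of_nonneg (mul_nonneg (by linarith [hτa y.2]) (Real.exp_pos _).le)]
    exact mul_exp_neg_mul_le hK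
  let Φ : BoundedContinuousFunction (ℝ × ℝ) ℝ → BoundedContinuousFunction (ℝ × ℝ) ℝ := fun χ =>
    BoundedContinuousFunction.ofNormedAddCommGroup (fun y => k y + B χ y)
      (hkcont.add (hBcont χ χ.continuous)) (1 / K + (1 / 2) * ‖χ‖)
      (fun y => (norm_add_le _ _).trans (add_le_add (hkbound y)
        (hBbound χ χ.continuous _ (fun y => χ.norm_coe_le_norm y) y)))
  have hΦ : ContractingWith (1 / 2) Φ := by
    refine ⟨by rw [← NNReal.coe_lt_coe]; norm_num, LipschitzWith.of_dist_le_mul fun χ₁ χ₂ => ?_⟩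
    rw [BoundedContinuousFunction.dist_le (by positivity)]
    intro y
    have h1 : B χ₁ y - B χ₂ y = B (χ₁ - χ₂) y := by
      have hc : ∀ χ : BoundedContinuousFunction (ℝ × ℝ) ℝ, IntervalIntegrable
          (fun s => (τ y.2 - s) * Real.exp (-(K * (τ y.2 - s))) * (q y.1 s * χ (y.1, s)))
          volume a (τ y.2) := fun χ => by
        have := hq.comp (by fun_prop : Continuous fun s : ℝ => (y.1, s))
        have h2 : Continuous fun s : ℝ => q y.1 s := this
        exact Continuous.intervalIntegrable (by fun_prop) _ _
      show (∫ s in a..τ y.2, _) - (∫ s in a..τ y.2, _) = ∫ s in a..τ y.2, _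
      rw [← intervalIntegral.integral_sub (hc χ₁) (hc χ₂)]
      refine intervalIntegral.integral_congr fun s _ => ?_
      simp only [Pi.sub_apply]
      ring
    have h2 : dist (Φ χ₁ y) (Φ χ₂ y) = |B (χ₁ - χ₂) y| := by
      rw [Real.dist_eq, ← h1]
      congr 1
      show k y + B χ₁ y - (k y + B χ₂ y) = _
      ring
    rw [h2]
    refine (hBbound _ (χ₁.continuous.sub χ₂.continuous) (dist χ₁ χ₂) (fun z => ?_) y).trans ?_
    · have := BoundedContinuousFunction.dist_coe_le_dist (f := χ₁) (g := χ₂) z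
      rwa [Real.dist_eq] at this
    · norm_num
  obtain ⟨χ, hχ⟩ : ∃ χ, Φ χ = χ := ⟨_, hΦ.fixedPoint_isFixedPt⟩
  have hχ' : ∀ x r, χ (x, r) = (τ r - a) * Real.exp (-(K * (τ r - a))) +
      ∫ s in a..τ r, (τ r - s) * Real.exp (-(K * (τ r - s))) * (q x s * χ (x, s)) := by
    intro x r
    conv_lhs => rw [← hχ]
    rfl
  let θ : ℝ → ℝ → ℝ := fun x r => Real.exp (K * (r - a)) * χ (x, r)
  have hqθ : Continuous fun z : ℝ × ℝ => q z.1 z.2 * θ z.1 z.2 := by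
    have h1 : Continuous fun z : ℝ × ℝ => q z.1 z.2 := hq
    have h2 : Continuous fun z : ℝ × ℝ => θ z.1 z.2 := by
      show Continuous fun z : ℝ × ℝ => Real.exp (K * (z.2 - a)) * χ (z.1, z.2)
      fun_prop
    exact h1.mul h2
  have hqθx : ∀ x, Continuous fun s => q x s * θ x s := fun x =>
    hqθ.comp (by fun_prop : Continuous fun s : ℝ => (x, s))
  let ψ₁ : ℝ → ℝ → ℝ := fun x r => 1 + ∫ s in a..r, q x s * θ x s
  let ψ : ℝ → ℝ → ℝ := fun x r => ∫ s in a..r, ψ₁ x s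
  have hψ₁c : Continuous (Function.uncurry ψ₁) := by
    refine continuous_const.add ?_
    refine intervalIntegral.continuous_parametric_intervalIntegral_of_continuous
      (f := fun (y : ℝ × ℝ) s => q y.1 s * θ y.1 s) ?_ continuous_snd
    exact hqθ.comp (by fun_prop : Continuous fun z : (ℝ × ℝ) × ℝ => (z.1.1, z.2))
  have hψc : Continuous (Function.uncurry ψ) := by
    refine intervalIntegral.continuous_parametric_intervalIntegral_of_continuous
      (f := fun (y : ℝ × ℝ) s => ψ₁ y.1 s) ?_ continuous_snd
    exact hψ₁c.comp (by fun_prop : Continuous fun z : (ℝ × ℝ) × ℝ => (z.1.1, z.2))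
  have hd₁ : ∀ x r, HasDerivAt (ψ₁ x) (q x r * θ x r) r := fun x r =>
    ((hqθx x).integral_hasStrictDerivAt a r).hasDerivAt.const_add 1
  have hψ₁x : ∀ x, Continuous (ψ₁ x) := fun x =>
    hψ₁c.comp (by fun_prop : Continuous fun s : ℝ => (x, s))
  have hd : ∀ x r, HasDerivAt (ψ x) (ψ₁ x r) r := fun x r =>
    ((hψ₁x x).integral_hasStrictDerivAt a r).hasDerivAt
  have hθ : ∀ x r, a ≤ r → θ x r = ψ x r := by
    intro x r hr
    have hτr : τ r = r := max_eq_left hr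
    have hE : ∀ u : ℝ, Real.exp (K * u) * Real.exp (-(K * u)) = 1 := fun u => by
      rw [← Real.exp_add]; simp
    have e1 : θ x r = (r - a) + ∫ s in a..r, (r - s) * (q x s * θ x s) := by
      show Real.exp (K * (r - a)) * χ (x, r) = _
      rw [hχ', hτr, mul_add, ← intervalIntegral.integral_const_mul]
      congr 1
      · rw [mul_left_comm, hE, mul_one]
      · refine intervalIntegral.integral_congr fun s _ => ?_
        show _ = (r - s) * (q x s * (Real.exp (K * (s - a)) * χ (x, s)))
        have : Real.exp (K * (r - a)) * Real.exp (-(K * (r - s))) = Real.exp (K * (s - a)) := by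
          rw [← Real.exp_add]; congr 1; ring
        rw [← this]
        ring
    have e2 : ∀ t, HasDerivAt (fun t => (t - a) * 1 + (t * (∫ s in a..t, q x s * θ x s)
        - ∫ s in a..t, s * (q x s * θ x s))) (ψ₁ x t) t := by
      intro t
      have g1 := ((hqθx x).integral_hasStrictDerivAt a t).hasDerivAt
      have g2 := ((continuous_id.mul (hqθx x)).integral_hasStrictDerivAt a t).hasDerivAt
      have g3 := (((hasDerivAt_id t).sub_const a).mul_const 1).add
        (((hasDerivAt_id t).mul g1).sub g2)
      refine g3.congr_deriv ?_
      symm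
      show 1 + (∫ s in a..t, q x s * θ x s) = _
      simp only [Pi.mul_apply, id]
      ring
    have e3 : ψ x r = _ := intervalIntegral.integral_eq_sub_of_hasDerivAt (fun t _ => e2 t)
      ((hψ₁x x).intervalIntegrable a r)
    rw [e3, e1]
    simp only [intervalIntegral.integral_same, sub_self, mul_zero, sub_zero, mul_one, 
      add_zero]
    congr 1
    rw [← intervalIntegral.integral_const_mul, ← intervalIntegral.integral_sub]
    · refine intervalIntegral.integral_congr fun s _ => ?_
      ring
    · exact ((hqθx x).const_mul r).intervalIntegrable _ _
    · exact (continuous_id.mul (hqθx x)).intervalIntegrable _ _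
  refine ⟨ψ, ψ₁, hψc, hψ₁c, fun x => ⟨?_, by simp [ψ], by simp [ψ₁], fun r hr => ⟨hd x r, ?_⟩⟩⟩
  · have hdψ : deriv (ψ x) = ψ₁ x := funext fun r => (hd x r).deriv
    have hdψ₁ : deriv (ψ₁ x) = fun r => q x r * θ x r := funext fun r => (hd₁ x r).deriv
    have c1 : ContDiff ℝ 1 (ψ₁ x) := by
      rw [contDiff_one_iff_deriv, hdψ₁]
      exact ⟨fun r => (hd₁ x r).differentiableAt, hqθx x⟩
    have : ContDiff ℝ (1 + 1) (ψ x) := by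
      rw [contDiff_succ_iff_deriv, hdψ]
      exact ⟨fun r => (hd x r).differentiableAt, by simp, c1⟩
    simpa [one_add_one_eq_two] using this
  · rw [← hθ x r hr]
    exact hd₁ x r

/-- `ψ'' = q ψ` on `s`, with `ψ' = ψ₁`. -/
def SolvesOn (q ψ ψ₁ : ℝ → ℝ) (s : Set ℝ) : Prop :=
  ∀ r ∈ s, HasDerivAt ψ (ψ₁ r) r ∧ HasDerivAt ψ₁ (q r * ψ r) r

lemma SolvesOn.mono {q ψ ψ₁ : ℝ → ℝ} {s t : Set ℝ} (h : SolvesOn q ψ ψ₁ t) (hst : s ⊆ t) :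
    SolvesOn q ψ ψ₁ s := fun r hr => h r (hst hr)

lemma SolvesOn.continuousOn {q ψ ψ₁ : ℝ → ℝ} {s : Set ℝ} (h : SolvesOn q ψ ψ₁ s) :
    ContinuousOn ψ s := fun r hr => (h r hr).1.continuousAt.continuousWithinAt

lemma SolvesOn.continuousOn' {q ψ ψ₁ : ℝ → ℝ} {s : Set ℝ} (h : SolvesOn q ψ ψ₁ s) :
    ContinuousOn ψ₁ s := fun r hr => (h r hr).2.continuousAt.continuousWithinAt

lemma eventually_neg_left_of_deriv_pos {h : ℝ → ℝ} {h' x : ℝ} (hd : HasDerivAt h h' x)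
    (h0 : h x = 0) (hpos : 0 < h') : ∀ᶠ y in 𝓝[<] x, h y < 0 := by
  have := (hasDerivAt_iff_tendsto_slope.1 hd).eventually (lt_mem_nhds hpos)
  have h2 : ∀ᶠ y in 𝓝[<] x, 0 < slope h x y :=
    this.filter_mono (nhdsWithin_mono _ fun y hy => ne_of_lt hy)
  filter_upwards [h2, self_mem_nhdsWithin] with y hy hyx
  rw [slope_def_field, h0, sub_zero] at hy
  have hyx' : y - x < 0 := sub_neg.2 hyx
  by_contra! hcon
  exact absurd hy (not_lt.2 (div_nonpos_of_nonneg_of_nonpos hcon hyx'.le))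

lemma eventually_pos_right_of_deriv_pos {h : ℝ → ℝ} {h' x : ℝ} (hd : HasDerivAt h h' x)
    (h0 : h x = 0) (hpos : 0 < h') : ∀ᶠ y in 𝓝[>] x, 0 < h y := by
  have := (hasDerivAt_iff_tendsto_slope.1 hd).eventually (lt_mem_nhds hpos)
  have h2 : ∀ᶠ y in 𝓝[>] x, 0 < slope h x y :=
    this.filter_mono (nhdsWithin_mono _ fun y hy => ne_of_gt hy)
  filter_upwards [h2, self_mem_nhdsWithin] with y hy hyx
  rw [slope_def_field, h0, sub_zero] at hy
  have hyx' : 0 < y - x := sub_pos.2 hyx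
  exact (div_pos_iff_of_pos_right hyx').1 hy

lemma pos_of_deriv_pos_at_zeros {h h₁ : ℝ → ℝ} {a T : ℝ}
    (hd : ∀ x ∈ Icc a T, HasDerivAt h (h₁ x) x) (ha : 0 ≤ h a)
    (hz : ∀ x ∈ Icc a T, h x = 0 → 0 < h₁ x) : ∀ x ∈ Ioc a T, 0 < h x := by
  have hc : ContinuousOn h (Icc a T) := fun x hx => (hd x hx).continuousAt.continuousWithinAt
  have hnn : ∀ x ∈ Icc a T, 0 ≤ h x := by
    intro x hx
    refine image_le_of_deriv_right_lt_deriv_boundary' (f := fun _ => (0 : ℝ)) (f' := fun _ => 0)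
      continuousOn_const (fun y _ => hasDerivWithinAt_const _ _ _) ha hc
      (fun y hy => (hd y (Ico_subset_Icc_self hy)).hasDerivWithinAt)
      (fun y hy h0 => hz y (Ico_subset_Icc_self hy) h0.symm) hx
  intro x hx
  refine lt_of_le_of_ne (hnn x (Ioc_subset_Icc_self hx)) fun h0 => ?_
  have hxI := Ioc_subset_Icc_self hx
  have h1 := eventually_neg_left_of_deriv_pos (hd x hxI) h0.symm (hz x hxI h0.symm)
  have h2 : ∀ᶠ y in 𝓝[<] x, y ∈ Ioo a x := Ioo_mem_nhdsLT hx.1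
  obtain ⟨y, hy1, hy2⟩ := (h1.and h2).exists
  exact absurd hy1 (not_lt.2 (hnn y ⟨hy2.1.le, hy2.2.le.trans hx.2⟩))

lemma SolvesOn.eq_zero_iff {q ψ ψ₁ : ℝ → ℝ} {s t M : ℝ} (h : SolvesOn q ψ ψ₁ (Icc s t))
    (hM : ∀ r ∈ Icc s t, |q r| ≤ M) (hst : s ≤ t) :
    (ψ s = 0 ∧ ψ₁ s = 0) ↔ (ψ t = 0 ∧ ψ₁ t = 0) := by
  have key : ∀ r ∈ Icc s t, |2 * ψ r * ψ₁ r * (1 + q r)| ≤ (1 + M) * (ψ r ^ 2 + ψ₁ r ^ 2) := by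
    intro r hr
    have h1 : |1 + q r| ≤ 1 + M := (abs_add_le _ _).trans (by simpa using hM r hr)
    have h2 : |2 * ψ r * ψ₁ r| ≤ ψ r ^ 2 + ψ₁ r ^ 2 := by
      rw [abs_le]
      constructor <;> nlinarith [sq_nonneg (ψ r + ψ₁ r), sq_nonneg (ψ r - ψ₁ r)]
    rw [abs_mul, mul_comm]
    exact mul_le_mul h1 h2 (abs_nonneg _) ((abs_nonneg _).trans h1)
  have hder : ∀ K : ℝ, ∀ r ∈ Icc s t,
      HasDerivAt (fun r => Real.exp (K * r) * (ψ r ^ 2 + ψ₁ r ^ 2))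
        (Real.exp (K * r) * (K * (ψ r ^ 2 + ψ₁ r ^ 2) + 2 * ψ r * ψ₁ r * (1 + q r))) r := by
    intro K r hr
    obtain ⟨h1, h2⟩ := h r hr
    refine (((hasDerivAt_id r).const_mul K).exp.mul ((h1.pow 2).add (h2.pow 2))).congr_deriv ?_
    simp only [id, Pi.add_apply, Pi.pow_apply]
    ring
  have hcont : ∀ K : ℝ, ContinuousOn (fun r => Real.exp (K * r) * (ψ r ^ 2 + ψ₁ r ^ 2))
      (Icc s t) := fun K r hr => (hder K r hr).continuousAt.continuousWithinAt
  have hmono : MonotoneOn (fun r => Real.exp ((1 + M) * r) * (ψ r ^ 2 + ψ₁ r ^ 2)) (Icc s t) := by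
    refine monotoneOn_of_hasDerivWithinAt_nonneg (convex_Icc s t) (hcont _)
      (fun r hr => (hder _ r (interior_subset hr)).hasDerivWithinAt) fun r hr => ?_
    refine mul_nonneg (Real.exp_pos _).le ?_
    linarith [(abs_le.1 (key r (interior_subset hr))).1]
  have hanti : AntitoneOn (fun r => Real.exp (-(1 + M) * r) * (ψ r ^ 2 + ψ₁ r ^ 2))
      (Icc s t) := by
    refine antitoneOn_of_hasDerivWithinAt_nonpos (convex_Icc s t) (hcont _)
      (fun r hr => (hder _ r (interior_subset hr)).hasDerivWithinAt) fun r hr => ?_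
    refine mul_nonpos_of_nonneg_of_nonpos (Real.exp_pos _).le ?_
    linarith [(abs_le.1 (key r (interior_subset hr))).2]
  have hs : s ∈ Icc s t := left_mem_Icc.2 hst
  have ht : t ∈ Icc s t := right_mem_Icc.2 hst
  have aux : ∀ E x y : ℝ, 0 < E → E * (x ^ 2 + y ^ 2) ≤ 0 → x = 0 ∧ y = 0 := by
    intro E x y hE hle
    have h1 : x ^ 2 + y ^ 2 ≤ 0 := nonpos_of_mul_nonpos_right hle hE
    constructor
    · exact pow_eq_zero_iff two_ne_zero |>.1 (by nlinarith [sq_nonneg x, sq_nonneg y])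
    · exact pow_eq_zero_iff two_ne_zero |>.1 (by nlinarith [sq_nonneg x, sq_nonneg y])
  constructor
  · rintro ⟨h1, h2⟩
    have := hanti hs ht hst
    refine aux _ _ _ (Real.exp_pos (-(1 + M) * t)) (this.trans ?_)
    simp [h1, h2]
  · rintro ⟨h1, h2⟩
    have := hmono hs ht hst
    refine aux _ _ _ (Real.exp_pos ((1 + M) * s)) (this.trans ?_)
    simp [h1, h2]

lemma SolvesOn.growth {q ψ ψ₁ : ℝ → ℝ} {a T M : ℝ} (h : SolvesOn q ψ ψ₁ (Icc a T))
    (hM : ∀ r ∈ Icc a T, |q r| ≤ M) (hq : ∀ r ∈ Icc a T, 0 < q r)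
    (h0 : 0 ≤ ψ a) (h1 : 0 < ψ₁ a) : ∀ r ∈ Ioc a T, 0 < ψ r ∧ 0 < ψ₁ r := by
  have hder : ∀ r ∈ Icc a T, HasDerivAt (fun r => ψ r * ψ₁ r) (ψ₁ r ^ 2 + q r * ψ r ^ 2) r := by
    intro r hr
    refine ((h r hr).1.mul (h r hr).2).congr_deriv ?_
    ring
  have hmono : StrictMonoOn (fun r => ψ r * ψ₁ r) (Icc a T) := by
    refine strictMonoOn_of_deriv_pos (convex_Icc a T)
      (fun r hr => (hder r hr).continuousAt.continuousWithinAt) fun r hr => ?_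
    have hr := interior_subset hr
    rw [(hder r hr).deriv]
    have hq' := hq r hr
    rcases eq_or_ne (ψ₁ r) 0 with h2 | h2
    · have h3 : ψ r ≠ 0 := by
        intro h3
        exact h1.ne' (((h.mono (Icc_subset_Icc_right hr.2)).eq_zero_iff
          (fun y hy => hM y ⟨hy.1, hy.2.trans hr.2⟩) hr.1).2 ⟨h3, h2⟩).2
      positivity
    · positivity
  have hprod : ∀ r ∈ Ioc a T, 0 < ψ r * ψ₁ r := by
    intro r hr
    exact (mul_nonneg h0 h1.le).trans_lt
      (hmono (left_mem_Icc.2 (hr.1.le.trans hr.2)) (Ioc_subset_Icc_self hr) hr.1)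
  have hpos : ∀ r ∈ Ioc a T, 0 < ψ r := by
    refine pos_of_deriv_pos_at_zeros (fun r hr => (h r hr).1) h0 fun r hr hr0 => ?_
    rcases hr.1.eq_or_lt with rfl | hlt
    · exact h1
    · have := hprod r ⟨hlt, hr.2⟩
      simp [hr0] at this
  exact fun r hr => ⟨hpos r hr, (pos_iff_pos_of_mul_pos (hprod r hr)).1 (hpos r hr)⟩

lemma SolvesOn.pos_of_nonneg {q ψ ψ₁ : ℝ → ℝ} {a b M : ℝ} (h : SolvesOn q ψ ψ₁ (Ico a b))
    (hM : ∀ r ∈ Ico a b, |q r| ≤ M) (h1 : ψ₁ a ≠ 0) (hnn : ∀ r ∈ Ioo a b, 0 ≤ ψ r) :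
    ∀ r ∈ Ioo a b, 0 < ψ r := by
  intro r hr
  refine lt_of_le_of_ne (hnn r hr) fun h0 => ?_
  have hmin : IsLocalMin ψ r := by
    filter_upwards [Ioo_mem_nhds hr.1 hr.2] with y hy
    rw [← h0]
    exact hnn y hy
  have h2 : ψ₁ r = 0 := hmin.hasDerivAt_eq_zero (h r ⟨hr.1.le, hr.2⟩).1
  have hsub : Icc a r ⊆ Ico a b := fun y hy => ⟨hy.1, hy.2.trans_lt hr.2⟩
  exact h1 (((h.mono hsub).eq_zero_iff (fun y hy => hM y (hsub hy)) hr.1.le).2 ⟨h0.symm, h2⟩).2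

/-- A function that is monotone on `J` and tends to `0` at both ends of `J` vanishes on `J`. -/
lemma eq_zero_of_monotoneOn_of_tendsto {G : ℝ → ℝ} {J : Set ℝ} {la lb : Filter ℝ} [la.NeBot]
    [lb.NeBot] (hla : ∀ x ∈ J, ∀ᶠ y in la, y ∈ J ∧ y ≤ x) (hlb : ∀ x ∈ J, ∀ᶠ y in lb, y ∈ J ∧ x ≤ y)
    (hG : MonotoneOn G J) (ha : Tendsto G la (𝓝 0)) (hb : Tendsto G lb (𝓝 0)) :
    ∀ x ∈ J, G x = 0 := by
  intro x hx
  refine le_antisymm ?_ ?_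
  · refine ge_of_tendsto hb ?_
    filter_upwards [hlb x hx] with y hy using hG hx hy.1 hy.2
  · refine le_of_tendsto ha ?_
    filter_upwards [hla x hx] with y hy using hG hy.1 hx hy.2

lemma monotoneOn_of_hasDerivAt_nonneg_off_point {G G' : ℝ → ℝ} {J : Set ℝ} (hJc : Convex ℝ J)
    (hJo : IsOpen J) {c : ℝ} (hc : c ∈ J) (hcont : ContinuousAt G c)
    (hd : ∀ x ∈ J, x ≠ c → HasDerivAt G (G' x) x) (hnn : ∀ x ∈ J, x ≠ c → 0 ≤ G' x) :
    MonotoneOn G J := by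
  have hGc : ContinuousOn G J := by
    intro x hx
    rcases eq_or_ne x c with rfl | hne
    · exact hcont.continuousWithinAt
    · exact (hd x hx hne).continuousAt.continuousWithinAt
  have h1 : MonotoneOn G (J ∩ Iic c) := by
    refine monotoneOn_of_hasDerivWithinAt_nonneg (f' := G') (hJc.inter (convex_Iic c))
      (hGc.mono inter_subset_left) ?_ ?_
    all_goals
      intro x hx
      rw [interior_inter, hJo.interior_eq, interior_Iic] at hx
    · exact (hd x hx.1 (ne_of_lt hx.2)).hasDerivWithinAt
    · exact hnn x hx.1 (ne_of_lt hx.2)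
  have h2 : MonotoneOn G (J ∩ Ici c) := by
    refine monotoneOn_of_hasDerivWithinAt_nonneg (f' := G') (hJc.inter (convex_Ici c))
      (hGc.mono inter_subset_left) ?_ ?_
    all_goals
      intro x hx
      rw [interior_inter, hJo.interior_eq, interior_Ici] at hx
    · exact (hd x hx.1 (ne_of_gt hx.2)).hasDerivWithinAt
    · exact hnn x hx.1 (ne_of_gt hx.2)
  have := h1.union_right h2 (c := c) ⟨⟨hc, self_mem_Iic⟩, fun x hx => hx.2⟩
    ⟨⟨hc, self_mem_Ici⟩, fun x hx => hx.2⟩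
  rwa [← inter_union_distrib_left, Iic_union_Ici, inter_univ] at this

/-- If `g'' = -V g` has a solution on `J` with exactly one zero, and this zero is simple, then
`ψ'' = -(V + μ) ψ` cannot have nontrivial solutions vanishing at both ends of `J` for two
different negative values of `μ`. -/
theorem false_of_two_negative_eigenvalues {V g g₁ ψ ψ' η η' : ℝ → ℝ} {μ ν c : ℝ} {J : Set ℝ}
    {la lb : Filter ℝ} [la.NeBot] [lb.NeBot] (hJc : Convex ℝ J) (hJo : IsOpen J)
    (hla : ∀ x ∈ J, ∀ᶠ y in la, y ∈ J ∧ y ≤ x) (hlb : ∀ x ∈ J, ∀ᶠ y in lb, y ∈ J ∧ x ≤ y)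
    (hg : SolvesOn (fun r => -V r) g g₁ J) (hc : c ∈ J) (hgc : g c = 0) (hg₁c : g₁ c ≠ 0)
    (hgne : ∀ x ∈ J, x ≠ c → g x ≠ 0)
    (hgb : ∀ l, l = la ∨ l = lb → IsBoundedUnder (· ≤ ·) l ((fun x => ‖x‖) ∘ fun r => g₁ r / g r))
    (hμ : μ < 0) (hν : ν < 0) (hμν : μ ≠ ν)
    (hψ : SolvesOn (fun r => -(V r + μ)) ψ ψ' J) (hη : SolvesOn (fun r => -(V r + ν)) η η' J)
    (hψ0 : ∀ l, l = la ∨ l = lb → Tendsto ψ l (𝓝 0)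
      ∧ IsBoundedUnder (· ≤ ·) l ((fun x => ‖x‖) ∘ ψ'))
    (hη0 : ∀ l, l = la ∨ l = lb → Tendsto η l (𝓝 0)
      ∧ IsBoundedUnder (· ≤ ·) l ((fun x => ‖x‖) ∘ η'))
    (hψne : ∃ x ∈ J, ψ x ≠ 0) (hηne : ∃ x ∈ J, η x ≠ 0) : False := by
  obtain ⟨k₁, k₂, hk, hkc⟩ : ∃ k₁ k₂ : ℝ, (k₁ ≠ 0 ∨ k₂ ≠ 0) ∧ k₁ * ψ c + k₂ * η c = 0 := by
    by_cases h : ψ c = 0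
    · exact ⟨1, 0, Or.inl one_ne_zero, by simp [h]⟩
    · exact ⟨-η c, ψ c, Or.inr h, by ring⟩
  set u : ℝ → ℝ := fun r => k₁ * ψ r + k₂ * η r with hu
  set u₁ : ℝ → ℝ := fun r => k₁ * ψ' r + k₂ * η' r with hu₁
  set A : ℝ := (μ + ν) * k₁ * k₂ / (ν - μ) with hA
  have hνμ : ν - μ ≠ 0 := sub_ne_zero.2 hμν.symm
  set G : ℝ → ℝ := fun r => u r * u₁ r - u r * (u r * (g₁ r / g r))
    + A * (ψ' r * η r - ψ r * η' r) with hG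
  have hud : ∀ x ∈ J, HasDerivAt u (u₁ x) x := fun x hx =>
    ((hψ x hx).1.const_mul k₁).add ((hη x hx).1.const_mul k₂)
  have hu₁d : ∀ x ∈ J, HasDerivAt u₁
      (k₁ * (-(V x + μ) * ψ x) + k₂ * (-(V x + ν) * η x)) x := fun x hx =>
    ((hψ x hx).2.const_mul k₁).add ((hη x hx).2.const_mul k₂)
  have hWd : ∀ x ∈ J, HasDerivAt (fun r => A * (ψ' r * η r - ψ r * η' r))
      (A * ((ν - μ) * (ψ x * η x))) x := fun x hx => by
    refine ((((hψ x hx).2.mul (hη x hx).1).sub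
      ((hψ x hx).1.mul (hη x hx).2)).const_mul A).congr_deriv ?_
    ring
  set G' : ℝ → ℝ := fun x => (u₁ x - u x * g₁ x / g x) ^ 2
    + (-μ) * (k₁ * ψ x) ^ 2 + (-ν) * (k₂ * η x) ^ 2 with hG'
  have hGd : ∀ x ∈ J, x ≠ c → HasDerivAt G (G' x) x := by
    intro x hx hxc
    have hgx := hgne x hx hxc
    refine ((((hud x hx).mul (hu₁d x hx)).sub ((hud x hx).mul ((hud x hx).mul
      ((hg x hx).2.div (hg x hx).1 hgx)))).add (hWd x hx)).congr_deriv ?_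
    have hA' : A * ((ν - μ) * (ψ x * η x)) = (μ + ν) * k₁ * k₂ * (ψ x * η x) := by
      rw [hA]; field_simp
    rw [hA', hG']
    simp only [hu, hu₁, Pi.mul_apply, Pi.div_apply]
    field_simp
    ring
  have hG'nn : ∀ x ∈ J, x ≠ c → 0 ≤ G' x := fun x _ _ => by
    have h1 := mul_nonneg (neg_nonneg.2 hμ.le) (sq_nonneg (k₁ * ψ x))
    have h2 := mul_nonneg (neg_nonneg.2 hν.le) (sq_nonneg (k₂ * η x))
    have h3 := sq_nonneg (u₁ x - u x * g₁ x / g x)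
    simp only [hG']
    linarith
  have hGc : ContinuousAt G c := by
    have huc : u c = 0 := hkc
    have h1 : Tendsto (fun r => u r * (u r * (g₁ r / g r))) (𝓝[≠] c) (𝓝 0) := by
      have s1 := hasDerivAt_iff_tendsto_slope.1 (hud c hc)
      have s2 := hasDerivAt_iff_tendsto_slope.1 (hg c hc).1
      have s3 := ((hud c hc).continuousAt.mono_left
        (nhdsWithin_le_nhds (s := {c}ᶜ)) : Tendsto u (𝓝[≠] c) (𝓝 (u c)))
      have s4 := ((hg c hc).2.continuousAt.mono_left
        (nhdsWithin_le_nhds (s := {c}ᶜ)) : Tendsto g₁ (𝓝[≠] c) (𝓝 (g₁ c)))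
      have s5 := s3.mul ((s1.div s2 hg₁c).mul s4)
      rw [huc, zero_mul] at s5
      refine s5.congr' ?_
      filter_upwards [self_mem_nhdsWithin] with y hy
      have hyc : y - c ≠ 0 := sub_ne_zero.2 hy
      simp only [slope_def_field, huc, hgc, sub_zero, Pi.div_apply]
      rw [div_div_div_cancel_right₀ hyc]
      ring
    have h2 : ContinuousAt (fun r => u r * (u r * (g₁ r / g r))) c := by
      rw [continuousAt_iff_punctured_nhds]
      simpa [huc] using h1
    exact (((hud c hc).continuousAt.mul (hu₁d c hc).continuousAt).sub h2).add
      (hWd c hc).continuousAt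
  have hmono := monotoneOn_of_hasDerivAt_nonneg_off_point hJc hJo hc hGc hGd hG'nn
  have hlim : ∀ l, l = la ∨ l = lb → Tendsto G l (𝓝 0) := by
    intro l hl
    obtain ⟨p1, p2⟩ := hψ0 l hl
    obtain ⟨e1, e2⟩ := hη0 l hl
    have hu0 : Tendsto u l (𝓝 0) := by
      simpa using (p1.const_mul k₁).add (e1.const_mul k₂)
    have t1 : Tendsto (fun r => u r * u₁ r) l (𝓝 0) := by
      have := ((hu0.zero_mul_isBoundedUnder_le p2).const_mul k₁).add
        ((hu0.zero_mul_isBoundedUnder_le e2).const_mul k₂)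
      rw [mul_zero, mul_zero, add_zero] at this
      refine this.congr fun r => ?_
      simp only [hu₁]
      ring
    have t2 : Tendsto (fun r => u r * (u r * (g₁ r / g r))) l (𝓝 0) := by
      simpa using hu0.mul (hu0.zero_mul_isBoundedUnder_le (hgb l hl))
    have t3 : Tendsto (fun r => A * (ψ' r * η r - ψ r * η' r)) l (𝓝 0) := by
      have := ((e1.zero_mul_isBoundedUnder_le p2).sub
        (p1.zero_mul_isBoundedUnder_le e2)).const_mul A
      rw [sub_zero, mul_zero] at this
      refine this.congr fun r => ?_
      ring
    simpa using (t1.sub t2).add t3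
  have hG0 := eq_zero_of_monotoneOn_of_tendsto hla hlb hmono (hlim la (Or.inl rfl))
    (hlim lb (Or.inr rfl))
  have hzero : ∀ x ∈ J, x ≠ c → k₁ * ψ x = 0 ∧ k₂ * η x = 0 := by
    intro x hx hxc
    have hev : G =ᶠ[𝓝 x] fun _ => 0 := by
      filter_upwards [hJo.mem_nhds hx] with y hy using hG0 y hy
    have h0 : G' x = 0 := (hGd x hx hxc).unique ((hasDerivAt_const x (0 : ℝ)).congr_of_eventuallyEq hev)
    simp only [hG'] at h0
    have h1 := mul_nonneg (neg_nonneg.2 hμ.le) (sq_nonneg (k₁ * ψ x))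
    have h2 := mul_nonneg (neg_nonneg.2 hν.le) (sq_nonneg (k₂ * η x))
    have h3 := sq_nonneg (u₁ x - u x * g₁ x / g x)
    constructor
    · have : (-μ) * (k₁ * ψ x) ^ 2 = 0 := by linarith
      exact pow_eq_zero_iff two_ne_zero |>.1
        ((mul_eq_zero.1 this).resolve_left (neg_ne_zero.2 hμ.ne))
    · have : (-ν) * (k₂ * η x) ^ 2 = 0 := by linarith
      exact pow_eq_zero_iff two_ne_zero |>.1
        ((mul_eq_zero.1 this).resolve_left (neg_ne_zero.2 hν.ne))
  have hall : ∀ f : ℝ → ℝ, ContinuousOn f J → (∃ x ∈ J, f x ≠ 0) → ∃ x ∈ J, x ≠ c ∧ f x ≠ 0 := by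
    rintro f hf ⟨x, hx, hfx⟩
    have h1 : ∀ᶠ y in 𝓝[≠] x, y ∈ J ∧ f y ≠ 0 :=
      ((hJo.eventually_mem hx).and ((hf.continuousAt (hJo.mem_nhds hx)).eventually_ne hfx)).filter_mono
        nhdsWithin_le_nhds
    rcases eq_or_ne x c with rfl | hne
    · obtain ⟨y, hy, hyx⟩ := (h1.and self_mem_nhdsWithin).exists
      exact ⟨y, hy.1, hyx, hy.2⟩
    · exact ⟨x, hx, hne, hfx⟩
  rcases hk with hk | hk
  · obtain ⟨x, hx, hxc, h⟩ := hall ψ hψ.continuousOn hψne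
    exact (mul_ne_zero hk h) (hzero x hx hxc).1
  · obtain ⟨x, hx, hxc, h⟩ := hall η hη.continuousOn hηne
    exact (mul_ne_zero hk h) (hzero x hx hxc).2

/-- `Q'' + (2 / r) Q' + Q ^ (2 m + 1) = 0` on `(0, ∞)`, with `Q' = Q₁`. -/
def SolvesLaneEmden (m : ℕ) (Q Q₁ : ℝ → ℝ) : Prop :=
  ∀ r, 0 < r → HasDerivAt Q (Q₁ r) r ∧
    HasDerivAt Q₁ (-(2 / r) * Q₁ r - Q r ^ (2 * m + 1)) r

namespace SolvesLaneEmden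

variable {m : ℕ} {Q Q₁ : ℝ → ℝ}

lemma neg (h : SolvesLaneEmden m Q Q₁) : SolvesLaneEmden m (fun r => -Q r) (fun r => -Q₁ r) := by
  intro r hr
  refine ⟨(h r hr).1.neg, (h r hr).2.neg.congr_deriv ?_⟩
  rw [Odd.neg_pow ⟨m, rfl⟩]
  ring

lemma continuousOn (h : SolvesLaneEmden m Q Q₁) : ContinuousOn Q (Ioi 0) :=
  fun r hr => (h r hr).1.continuousAt.continuousWithinAt

lemma continuousOn' (h : SolvesLaneEmden m Q Q₁) : ContinuousOn Q₁ (Ioi 0) :=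
  fun r hr => (h r hr).2.continuousAt.continuousWithinAt

lemma solvesOn_mul (h : SolvesLaneEmden m Q Q₁) :
    SolvesOn (fun r => -Q r ^ (2 * m)) (fun r => r * Q r) (fun r => Q r + r * Q₁ r) (Ioi 0) := by
  intro r hr
  obtain ⟨h1, h2⟩ := h r hr
  have hr0 : r ≠ 0 := ne_of_gt hr
  refine ⟨((hasDerivAt_id r).mul h1).congr_deriv (by simp),
    (h1.add ((hasDerivAt_id r).mul h2)).congr_deriv ?_⟩
  simp only [id]
  field_simp
  ring

/-- The generator of the scaling symmetry, multiplied by `r`. -/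
noncomputable def gen (m : ℕ) (Q Q₁ : ℝ → ℝ) (r : ℝ) : ℝ := r * Q r / m + r ^ 2 * Q₁ r

/-- The derivative of `gen`. -/
noncomputable def gen' (m : ℕ) (Q Q₁ : ℝ → ℝ) (r : ℝ) : ℝ :=
  Q r / m + r * Q₁ r / m - r ^ 2 * Q r ^ (2 * m + 1)

lemma solvesOn_gen (h : SolvesLaneEmden m Q Q₁) (hm : 0 < m) :
    SolvesOn (fun r => -((2 * m + 1) * Q r ^ (2 * m))) (gen m Q Q₁) (gen' m Q Q₁) (Ioi 0) := by
  intro r hr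
  obtain ⟨h1, h2⟩ := h r hr
  have hr0 : r ≠ 0 := ne_of_gt hr
  have hm0 : (m : ℝ) ≠ 0 := by positivity
  constructor
  · refine ((((hasDerivAt_id r).mul h1).div_const (m : ℝ)).add
      (((hasDerivAt_id r).pow 2).mul h2)).congr_deriv ?_
    simp only [id, gen', Pi.pow_apply]
    field_simp
    ring
  · refine (((h1.div_const (m : ℝ)).add (((hasDerivAt_id r).mul h2).div_const (m : ℝ))).sub
      (((hasDerivAt_id r).pow 2).mul (h1.pow (2 * m + 1)))).congr_deriv ?_
    simp only [id, gen, Pi.pow_apply, Nat.add_sub_cancel]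
    push_cast
    field_simp
    ring

/-- The energy of the Emden-Fowler transform `r ^ (1 / m) Q`, up to a power of `r`. -/
noncomputable def energy (m : ℕ) (Q Q₁ : ℝ → ℝ) (r : ℝ) : ℝ :=
  (Q r / m + r * Q₁ r) ^ 2 / 2 - (1 / m) * (1 - 1 / m) * Q r ^ 2 / 2
    + r ^ 2 * Q r ^ (2 * m + 2) / (2 * m + 2)

lemma hasDerivAt_energy (h : SolvesLaneEmden m Q Q₁) (hm : 0 < m) {r : ℝ} (hr : 0 < r) :
    HasDerivAt (fun r => r ^ (2 / m : ℝ) * energy m Q Q₁ r)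
      (-(r ^ (2 / m : ℝ) / r * ((1 - 2 / m) * (Q r / m + r * Q₁ r) ^ 2))) r := by
  obtain ⟨h1, h2⟩ := h r hr
  have hm0 : (m : ℝ) ≠ 0 := by positivity
  have hm1 : (m : ℝ) + 1 ≠ 0 := by positivity
  have hm2 : 2 * (m : ℝ) + 2 ≠ 0 := by positivity
  have hp : HasDerivAt (fun r : ℝ => r ^ (2 / m : ℝ)) (2 / m * (r ^ (2 / m : ℝ) / r)) r := by
    have := Real.hasDerivAt_rpow_const (x := r) (p := 2 / m) (Or.inl hr.ne')
    rwa [Real.rpow_sub_one hr.ne'] at this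
  have hE := (((((h1.div_const (m : ℝ)).add ((hasDerivAt_id r).mul h2)).pow 2).div_const 2).sub
    (((h1.pow 2).const_mul ((1 / m : ℝ) * (1 - 1 / m))).div_const 2)).add
    ((((hasDerivAt_id r).pow 2).mul (h1.pow (2 * m + 2))).div_const (2 * m + 2 : ℝ))
  refine (hp.mul hE).congr_deriv ?_
  simp only [id, Pi.pow_apply, Pi.add_apply, Pi.sub_apply, Pi.mul_apply,
    show 2 * m + 2 - 1 = 2 * m + 1 by omega]
  have hpow : Q r ^ (2 * m + 2) = Q r ^ (2 * m + 1) * Q r := pow_succ _ _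
  rw [hpow]
  generalize r ^ (2 / m : ℝ) = P
  generalize Q r ^ (2 * m + 1) = S
  have hr0 := hr.ne'
  push_cast
  field_simp
  ring

lemma antitoneOn_energy (h : SolvesLaneEmden m Q Q₁) (hm : 2 ≤ m) :
    AntitoneOn (fun r => r ^ (2 / m : ℝ) * energy m Q Q₁ r) (Ioi 0) := by
  have hd := fun r (hr : r ∈ Ioi (0 : ℝ)) => h.hasDerivAt_energy (by omega) (mem_Ioi.1 hr)
  refine antitoneOn_of_hasDerivWithinAt_nonpos (convex_Ioi 0)
    (fun r hr => (hd r hr).continuousAt.continuousWithinAt)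
    (fun r hr => (hd r (interior_subset hr)).hasDerivWithinAt) fun r hr => ?_
  have hr' : 0 < r := interior_subset hr
  have hm' : (2 : ℝ) ≤ m := by exact_mod_cast hm
  have : (0 : ℝ) ≤ 1 - 2 / m := sub_nonneg.2 ((div_le_one (by linarith)).2 hm')
  have : 0 ≤ r ^ (2 / m : ℝ) / r * ((1 - 2 / m) * (Q r / m + r * Q₁ r) ^ 2) := by positivity
  linarith

lemma gen'_neg (hm : 2 ≤ m) {r : ℝ} (hr : 0 < r) (hQ : 0 < Q r) (hE : 0 ≤ energy m Q Q₁ r)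
    (hg : gen m Q Q₁ r = 0) : gen' m Q Q₁ r < 0 := by
  have hm' : (2 : ℝ) ≤ m := by exact_mod_cast hm
  have hm0 : (0 : ℝ) < m := by linarith
  have h1 : Q r / m + r * Q₁ r = 0 := by
    have : r * (Q r / m + r * Q₁ r) = 0 := by
      rw [← hg, gen]; ring
    exact (mul_eq_zero.1 this).resolve_left hr.ne'
  have h2 : r * Q₁ r = -(Q r / m) := by linarith
  rw [energy, h1] at hE
  rw [gen', h2]
  have hpow : Q r ^ (2 * m + 2) = Q r ^ (2 * m) * Q r ^ 2 := pow_add _ _ _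
  have hpow' : Q r ^ (2 * m + 1) = Q r ^ (2 * m) * Q r := pow_succ _ _
  rw [hpow] at hE
  rw [hpow']
  set S := Q r ^ (2 * m)
  set α : ℝ := 1 / m with hα
  have hα0 : 0 < α := by positivity
  have hα1 : 0 < α * (1 - α) := by
    have : α ≤ 1 / 2 := one_div_le_one_div_of_le (by norm_num) hm'
    have : 0 < 1 - α := by linarith
    positivity
  have hk : α * (1 - α) ≤ r ^ 2 * S / (m + 1) := by
    have e : 0 ^ 2 / 2 - α * (1 - α) * Q r ^ 2 / 2 + r ^ 2 * (S * Q r ^ 2) / (2 * m + 2)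
        = (r ^ 2 * S / (m + 1) - α * (1 - α)) * (Q r ^ 2 / 2) := by
      field_simp
      ring
    rw [e] at hE
    have := nonneg_of_mul_nonneg_left hE (by positivity)
    linarith
  rw [le_div_iff₀ (by positivity)] at hk
  have e2 : Q r / m + -(Q r / m) / m - r ^ 2 * (S * Q r) = Q r * (α * (1 - α) - r ^ 2 * S) := by
    rw [hα]
    field_simp
    ring
  rw [e2]
  exact mul_neg_of_pos_of_neg hQ (by nlinarith)

end SolvesLaneEmden

lemma exists_unique_zero_of_deriv_neg_at_zeros {g g₁ : ℝ → ℝ} {J : Set ℝ} (hJ : Convex ℝ J)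
    (hd : ∀ x ∈ J, HasDerivAt g (g₁ x) x) (hz : ∀ x ∈ J, g x = 0 → g₁ x < 0)
    (hpos : ∃ x ∈ J, 0 < g x) (hneg : ∃ x ∈ J, g x < 0) :
    ∃ c ∈ J, g c = 0 ∧ ∀ x ∈ J, x ≠ c → g x ≠ 0 := by
  have hc : ContinuousOn g J := fun x hx => (hd x hx).continuousAt.continuousWithinAt
  have key : ∀ x ∈ J, ∀ y ∈ J, x < y → g x = 0 → g y ≠ 0 := by
    intro x hx y hy hxy hx0 hy0
    have hsub : Icc x y ⊆ J := hJ.ordConnected.out hx hy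
    have := pos_of_deriv_pos_at_zeros (h := fun t => -g t) (h₁ := fun t => -g₁ t)
      (fun t ht => (hd t (hsub ht)).neg) (by simp [hx0])
      (fun t ht h0 => neg_pos.2 (hz t (hsub ht) (neg_eq_zero.1 h0))) y ⟨hxy, le_rfl⟩
    simp [hy0] at this
  obtain ⟨x, hx, hgx⟩ := hpos
  obtain ⟨y, hy, hgy⟩ := hneg
  obtain ⟨c, hcJ, hc0⟩ := hJ.isPreconnected.intermediate_value hy hx hc ⟨hgy.le, hgx.le⟩
  refine ⟨c, hcJ, hc0, fun z hz' hne => ?_⟩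
  rcases lt_or_gt_of_ne hne with hlt | hlt
  · exact fun h0 => key z hz' c hcJ hlt h0 hc0
  · exact key c hcJ z hz' hlt hc0

namespace SolvesLaneEmden

variable {m : ℕ} {Q Q₁ : ℝ → ℝ}

lemma solvesOn_mul_eq_zero_iff (h : SolvesLaneEmden m Q Q₁) {s t : ℝ} (hs : 0 < s) (hst : s ≤ t) :
    (Q s = 0 ∧ Q₁ s = 0) ↔ (Q t = 0 ∧ Q₁ t = 0) := by
  have hsub : Icc s t ⊆ Ioi 0 := fun x hx => hs.trans_le hx.1
  obtain ⟨M, hM⟩ := isCompact_Icc.exists_bound_of_continuousOn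
    (f := fun r => -Q r ^ (2 * m)) ((h.continuousOn.mono hsub).pow (2 * m)).neg
  have key := (h.solvesOn_mul.mono hsub).eq_zero_iff hM hst
  have aux : ∀ x : ℝ, 0 < x → ((x * Q x = 0 ∧ Q x + x * Q₁ x = 0) ↔ (Q x = 0 ∧ Q₁ x = 0)) := by
    intro x hx
    constructor
    · rintro ⟨h1, h2⟩
      have h3 := (mul_eq_zero.1 h1).resolve_left hx.ne'
      rw [h3, zero_add] at h2
      exact ⟨h3, (mul_eq_zero.1 h2).resolve_left hx.ne'⟩
    · rintro ⟨h1, h2⟩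
      simp [h1, h2]
  rw [← aux s hs, ← aux t (hs.trans_le hst)]
  exact key

lemma deriv_pos_of_pos_right (h : SolvesLaneEmden m Q Q₁) {a b : ℝ} (ha : 0 < a) (hab : a < b)
    (hQa : Q a = 0) (hQ : ∀ r ∈ Ioo a b, 0 < Q r) : 0 < Q₁ a := by
  refine lt_of_le_of_ne ?_ fun h0 => ?_
  · by_contra! hneg
    have h1 := eventually_pos_right_of_deriv_pos (h a ha).1.neg (by simp [hQa]) (neg_pos.2 hneg)
    obtain ⟨y, hy1, hy2⟩ := (h1.and (Ioo_mem_nhdsGT hab)).exists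
    have := hQ y hy2
    simp only [Pi.neg_apply] at hy1
    linarith
  · have hmid : (a + b) / 2 ∈ Ioo a b := ⟨by linarith, by linarith⟩
    exact (hQ _ hmid).ne' ((h.solvesOn_mul_eq_zero_iff ha hmid.1.le).1 ⟨hQa, h0.symm⟩).1

lemma deriv_neg_of_pos_left (h : SolvesLaneEmden m Q Q₁) {a b : ℝ} (ha : 0 < a) (hab : a < b)
    (hQb : Q b = 0) (hQ : ∀ r ∈ Ioo a b, 0 < Q r) : Q₁ b < 0 := by
  have hb : 0 < b := ha.trans hab
  refine lt_of_le_of_ne ?_ fun h0 => ?_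
  · by_contra! hpos
    have h1 := eventually_neg_left_of_deriv_pos (h b hb).1 hQb hpos
    obtain ⟨y, hy1, hy2⟩ := (h1.and (Ioo_mem_nhdsLT hab)).exists
    have := hQ y hy2
    linarith
  · have hmid : (a + b) / 2 ∈ Ioo a b := ⟨by linarith, by linarith⟩
    exact (hQ _ hmid).ne'
      ((h.solvesOn_mul_eq_zero_iff (ha.trans hmid.1) hmid.2.le).2 ⟨hQb, h0⟩).1

lemma energy_nonneg_of_zero (h : SolvesLaneEmden m Q Q₁) (hm : 2 ≤ m) {r b : ℝ} (hr : 0 < r)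
    (hrb : r ≤ b) (hQb : Q b = 0) : 0 ≤ energy m Q Q₁ r := by
  have hb : 0 < b := hr.trans_le hrb
  have h1 := h.antitoneOn_energy hm hr hb hrb
  have h2 : 0 ≤ energy m Q Q₁ b := by
    have : energy m Q Q₁ b = (b * Q₁ b) ^ 2 / 2 := by
      simp [energy, hQb]
    rw [this]
    positivity
  have h3 : 0 ≤ r ^ (2 / m : ℝ) * energy m Q Q₁ r :=
    (mul_nonneg (Real.rpow_pos_of_pos hb _).le h2).trans h1
  exact nonneg_of_mul_nonneg_right h3 (Real.rpow_pos_of_pos hr _)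

lemma tendsto_zero {κ : ℝ} (hκ : Tendsto (fun r => r * Q r) atTop (𝓝 κ)) :
    Tendsto Q atTop (𝓝 0) := by
  have := hκ.mul tendsto_inv_atTop_zero
  rw [mul_zero] at this
  refine this.congr' ?_
  filter_upwards [eventually_gt_atTop 0] with r hr
  field_simp

lemma tendsto_mul_deriv_zero {κ : ℝ} (hκ : Tendsto (fun r => r ^ 2 * Q₁ r) atTop (𝓝 κ)) :
    Tendsto (fun r => r * Q₁ r) atTop (𝓝 0) := by
  refine tendsto_zero (hκ.congr fun r => ?_)
  ring

lemma energy_nonneg_of_tendsto (h : SolvesLaneEmden m Q Q₁) (hm : 2 ≤ m) {κ : ℝ}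
    (hκ : Tendsto (fun r => r * Q r) atTop (𝓝 κ))
    (hκ' : Tendsto (fun r => r ^ 2 * Q₁ r) atTop (𝓝 (-κ))) {r : ℝ} (hr : 0 < r) :
    0 ≤ energy m Q Q₁ r := by
  have hQ0 := tendsto_zero hκ
  have hm' : (2 : ℝ) ≤ m := by exact_mod_cast hm
  have h1 : ∃ l, Tendsto (fun r => r ^ 2 * energy m Q Q₁ r) atTop (𝓝 l) := by
    refine ⟨_, ((((((hκ.div_const (m : ℝ)).add hκ').pow 2).div_const 2).sub
      (((hκ.pow 2).const_mul ((1 / m : ℝ) * (1 - 1 / m))).div_const 2)).add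
      (((hκ.pow 4).mul (hQ0.pow (2 * m - 2))).div_const (2 * m + 2 : ℝ))).congr fun r => ?_⟩
    have : Q r ^ (2 * m + 2) = Q r ^ 4 * Q r ^ (2 * m - 2) := by
      rw [← pow_add]; congr 1; omega
    simp only [energy, this]
    ring
  obtain ⟨l, hl⟩ := h1
  have hexp : 0 < 2 - 2 / (m : ℝ) := by
    have : 2 / (m : ℝ) ≤ 1 := (div_le_one (by linarith)).2 hm'
    linarith
  have h2 := (tendsto_rpow_neg_atTop hexp).mul hl
  rw [zero_mul] at h2
  have h3 : Tendsto (fun r => r ^ (2 / m : ℝ) * energy m Q Q₁ r) atTop (𝓝 0) := by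
    refine h2.congr' ?_
    filter_upwards [eventually_gt_atTop 0] with s hs
    rw [← mul_assoc]
    congr 1
    rw [← Real.rpow_natCast, ← Real.rpow_add hs]
    congr 1
    push_cast
    ring
  have h4 : 0 ≤ r ^ (2 / m : ℝ) * energy m Q Q₁ r := by
    refine le_of_tendsto h3 ?_
    filter_upwards [eventually_ge_atTop r] with s hs
    exact h.antitoneOn_energy hm hr (hr.trans_le hs) hs
  exact nonneg_of_mul_nonneg_right h4 (Real.rpow_pos_of_pos hr _)

lemma gen_pos_of_pos_right (h : SolvesLaneEmden m Q Q₁) {a b : ℝ} (ha : 0 < a) (hab : a < b)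
    (hQa : Q a = 0) (hQ : ∀ r ∈ Ioo a b, 0 < Q r) : 0 < gen m Q Q₁ a := by
  have := h.deriv_pos_of_pos_right ha hab hQa hQ
  simp only [gen, hQa, mul_zero, zero_div, zero_add]
  positivity

lemma gen_neg_of_pos_left (h : SolvesLaneEmden m Q Q₁) {a b : ℝ} (ha : 0 < a) (hab : a < b)
    (hQb : Q b = 0) (hQ : ∀ r ∈ Ioo a b, 0 < Q r) : gen m Q Q₁ b < 0 := by
  have := h.deriv_neg_of_pos_left ha hab hQb hQ
  simp only [gen, hQb, mul_zero, zero_div, zero_add]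
  exact mul_neg_of_pos_of_neg (by have := ha.trans hab; positivity) this

lemma tendsto_gen {κ : ℝ} (hκ : Tendsto (fun r => r * Q r) atTop (𝓝 κ))
    (hκ' : Tendsto (fun r => r ^ 2 * Q₁ r) atTop (𝓝 (-κ))) :
    Tendsto (gen m Q Q₁) atTop (𝓝 (κ / m - κ)) :=
  (hκ.div_const (m : ℝ)).add hκ'

lemma tendsto_gen' (hm : 0 < m) {κ : ℝ} (hκ : Tendsto (fun r => r * Q r) atTop (𝓝 κ))
    (hκ' : Tendsto (fun r => r ^ 2 * Q₁ r) atTop (𝓝 (-κ))) :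
    Tendsto (gen' m Q Q₁) atTop (𝓝 0) := by
  have hQ0 := tendsto_zero hκ
  have := ((hQ0.div_const (m : ℝ)).add ((tendsto_mul_deriv_zero hκ').div_const (m : ℝ))).sub
    ((hκ.pow 2).mul (hQ0.pow (2 * m - 1)))
  rw [zero_pow (by omega)] at this
  simp only [zero_div, mul_zero, add_zero, sub_zero] at this
  refine this.congr fun r => ?_
  have : Q r ^ (2 * m + 1) = Q r ^ 2 * Q r ^ (2 * m - 1) := by
    rw [← pow_add]; congr 1; omega
  simp only [gen', this]
  ring

/-- Negative Dirichlet eigenvalues of the linearisation on a bounded nodal interval are unique. -/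
theorem eigenvalue_unique_Icc (h : SolvesLaneEmden m Q Q₁) (hm : 2 ≤ m) {a b : ℝ} (ha : 0 < a)
    (hab : a < b) (hQa : Q a = 0) (hQb : Q b = 0) (hQ : ∀ r ∈ Ioo a b, 0 < Q r) {μ ν : ℝ}
    (hμ : μ < 0) (hν : ν < 0) {ψ ψ' η η' : ℝ → ℝ}
    (hψ : SolvesOn (fun r => -((2 * m + 1) * Q r ^ (2 * m) + μ)) ψ ψ' (Ioo a b))
    (hη : SolvesOn (fun r => -((2 * m + 1) * Q r ^ (2 * m) + ν)) η η' (Ioo a b))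
    (hψc : ContinuousOn ψ (Icc a b)) (hψc' : ContinuousOn ψ' (Icc a b))
    (hηc : ContinuousOn η (Icc a b)) (hηc' : ContinuousOn η' (Icc a b))
    (hψa : ψ a = 0) (hψb : ψ b = 0) (hηa : η a = 0) (hηb : η b = 0)
    (hψne : ∃ x ∈ Ioo a b, ψ x ≠ 0) (hηne : ∃ x ∈ Ioo a b, η x ≠ 0) : μ = ν := by
  by_contra hne
  have hb : 0 < b := ha.trans hab
  have hsub : Ioo a b ⊆ Ioi 0 := fun x hx => ha.trans hx.1
  have hg := h.solvesOn_gen (by omega)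
  have hga := h.gen_pos_of_pos_right ha hab hQa hQ
  have hgb := h.gen_neg_of_pos_left ha hab hQb hQ
  have hz : ∀ x ∈ Ioo a b, gen m Q Q₁ x = 0 → gen' m Q Q₁ x < 0 := fun x hx h0 =>
    gen'_neg hm (hsub hx) (hQ x hx) (h.energy_nonneg_of_zero hm (hsub hx) hx.2.le hQb) h0
  obtain ⟨c, hc, hc0, hcu⟩ := exists_unique_zero_of_deriv_neg_at_zeros (convex_Ioo a b)
    (fun x hx => (hg x (hsub hx)).1) hz
    (by
      have h1 : ∀ᶠ y in 𝓝[>] a, 0 < gen m Q Q₁ y :=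
        ((hg a ha).1.continuousAt.eventually (lt_mem_nhds hga)).filter_mono nhdsWithin_le_nhds
      obtain ⟨y, hy1, hy2⟩ := (h1.and (Ioo_mem_nhdsGT hab)).exists
      exact ⟨y, hy2, hy1⟩)
    (by
      have h1 : ∀ᶠ y in 𝓝[<] b, gen m Q Q₁ y < 0 :=
        ((hg b hb).1.continuousAt.eventually (gt_mem_nhds hgb)).filter_mono nhdsWithin_le_nhds
      obtain ⟨y, hy1, hy2⟩ := (h1.and (Ioo_mem_nhdsLT hab)).exists
      exact ⟨y, hy2, hy1⟩)
  have hwa : 𝓝[>] a ≤ 𝓝[Icc a b] a := by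
    rw [← nhdsWithin_Ioc_eq_nhdsGT hab]
    exact nhdsWithin_mono _ Ioc_subset_Icc_self
  have hwb : 𝓝[<] b ≤ 𝓝[Icc a b] b := by
    rw [← nhdsWithin_Ico_eq_nhdsLT hab]
    exact nhdsWithin_mono _ Ico_subset_Icc_self
  have hlim : ∀ f : ℝ → ℝ, ContinuousOn f (Icc a b) →
      Tendsto f (𝓝[>] a) (𝓝 (f a)) ∧ Tendsto f (𝓝[<] b) (𝓝 (f b)) := fun f hf =>
    ⟨(hf a (left_mem_Icc.2 hab.le)).mono_left hwa, (hf b (right_mem_Icc.2 hab.le)).mono_left hwb⟩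
  refine false_of_two_negative_eigenvalues (la := 𝓝[>] a) (lb := 𝓝[<] b) (convex_Ioo a b)
    isOpen_Ioo ?_ ?_ (hg.mono hsub) hc hc0 (hz c hc hc0).ne hcu ?_ hμ hν hne hψ hη ?_ ?_ hψne hηne
  · intro x hx
    filter_upwards [Ioo_mem_nhdsGT hx.1] with y hy
    exact ⟨⟨hy.1, hy.2.trans hx.2⟩, hy.2.le⟩
  · intro x hx
    filter_upwards [Ioo_mem_nhdsLT hx.2] with y hy
    exact ⟨⟨hx.1.trans hy.1, hy.2⟩, hy.1.le⟩
  · have hq : ∀ x, 0 < x → gen m Q Q₁ x ≠ 0 →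
        ContinuousAt (fun r => gen' m Q Q₁ r / gen m Q Q₁ r) x := fun x hx hx0 =>
      (hg x hx).2.continuousAt.div (hg x hx).1.continuousAt hx0
    rintro l (rfl | rfl)
    · exact ((hq a ha hga.ne').mono_left nhdsWithin_le_nhds).norm.isBoundedUnder_le
    · exact ((hq b hb hgb.ne).mono_left nhdsWithin_le_nhds).norm.isBoundedUnder_le
  · rintro l (rfl | rfl)
    · exact ⟨by simpa [hψa] using (hlim ψ hψc).1, (hlim ψ' hψc').1.norm.isBoundedUnder_le⟩
    · exact ⟨by simpa [hψb] using (hlim ψ hψc).2, (hlim ψ' hψc').2.norm.isBoundedUnder_le⟩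
  · rintro l (rfl | rfl)
    · exact ⟨by simpa [hηa] using (hlim η hηc).1, (hlim η' hηc').1.norm.isBoundedUnder_le⟩
    · exact ⟨by simpa [hηb] using (hlim η hηc).2, (hlim η' hηc').2.norm.isBoundedUnder_le⟩

end SolvesLaneEmden

lemma not_integrableOn_Ioi_of_le {f : ℝ → ℝ} {c R : ℝ} (hc : 0 < c) (hf : ∀ r ∈ Ioi R, c ≤ f r) :
    ¬ IntegrableOn f (Ioi R) := by
  intro h
  have h1 : IntegrableOn (fun _ : ℝ => c) (Ioi R) := by
    refine Integrable.mono' h aestronglyMeasurable_const ?_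
    filter_upwards [ae_restrict_mem measurableSet_Ioi] with r hr
    rw [Real.norm_of_nonneg hc.le]
    exact hf r hr
  rw [integrableOn_const_iff] at h1
  rcases h1 with h1 | h1
  · exact hc.ne' (by simpa using h1)
  · simp at h1

/-- Square integrable solutions of `ψ'' = q ψ` with `q ≥ 0` near infinity decay. -/
lemma SolvesOn.decay {q ψ ψ' : ℝ → ℝ} {R : ℝ} (h : SolvesOn q ψ ψ' (Ioi R))
    (hq : ∀ r ∈ Ioi R, 0 ≤ q r) (hint : IntegrableOn (fun r => ψ r ^ 2) (Ioi R)) :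
    Tendsto ψ atTop (𝓝 0) ∧ IsBoundedUnder (· ≤ ·) atTop ((fun x => ‖x‖) ∘ ψ') := by
  have hd : ∀ r ∈ Ioi R, HasDerivAt (fun r => ψ r * ψ' r) (ψ' r ^ 2 + q r * ψ r ^ 2) r := by
    intro r hr
    refine ((h r hr).1.mul (h r hr).2).congr_deriv ?_
    ring
  have hd2 : ∀ r ∈ Ioi R, HasDerivAt (fun r => ψ r ^ 2) (2 * (ψ r * ψ' r)) r := by
    intro r hr
    refine ((h r hr).1.pow 2).congr_deriv ?_
    simp only [Nat.cast_ofNat, Nat.add_one_sub_one, pow_one]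
    ring
  have hd3 : ∀ r ∈ Ioi R, HasDerivAt (fun r => ψ' r ^ 2) (2 * (q r * (ψ r * ψ' r))) r := by
    intro r hr
    refine ((h r hr).2.pow 2).congr_deriv ?_
    simp only [Nat.cast_ofNat, Nat.add_one_sub_one, pow_one]
    ring
  have hmono : MonotoneOn (fun r => ψ r * ψ' r) (Ioi R) :=
    monotoneOn_of_hasDerivWithinAt_nonneg (convex_Ioi R)
      (fun r hr => (hd r hr).continuousAt.continuousWithinAt)
      (fun r hr => (hd r (interior_subset hr)).hasDerivWithinAt)
      fun r hr => add_nonneg (sq_nonneg _)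
        (mul_nonneg (hq r (interior_subset hr)) (sq_nonneg _))
  have hnonpos : ∀ r ∈ Ioi R, ψ r * ψ' r ≤ 0 := by
    intro s hs
    by_contra! hpos
    have hsub : Ici s ⊆ Ioi R := Ici_subset_Ioi.2 hs
    have hm2 : MonotoneOn (fun r => ψ r ^ 2) (Ici s) := by
      refine monotoneOn_of_hasDerivWithinAt_nonneg (convex_Ici s)
        (fun r hr => (hd2 r (hsub hr)).continuousAt.continuousWithinAt)
        (fun r hr => (hd2 r (hsub (interior_subset hr))).hasDerivWithinAt) fun r hr => ?_
      have := hmono hs (hsub (interior_subset hr)) (interior_subset hr)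
      simp only at this
      linarith
    have hψs : 0 < ψ s ^ 2 := by
      have : ψ s ≠ 0 := fun h0 => by simp [h0] at hpos
      positivity
    refine not_integrableOn_Ioi_of_le hψs
      (fun r hr => hm2 self_mem_Ici (le_of_lt hr : s ≤ r) (le_of_lt hr))
      (hint.mono_set ?_)
    exact Ioi_subset_Ici_self.trans hsub
  have hanti : AntitoneOn (fun r => ψ r ^ 2) (Ioi R) := by
    refine antitoneOn_of_hasDerivWithinAt_nonpos (convex_Ioi R)
      (fun r hr => (hd2 r hr).continuousAt.continuousWithinAt)
      (fun r hr => (hd2 r (interior_subset hr)).hasDerivWithinAt) fun r hr => ?_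
    linarith [hnonpos r (interior_subset hr)]
  have hanti' : AntitoneOn (fun r => ψ' r ^ 2) (Ioi R) := by
    refine antitoneOn_of_hasDerivWithinAt_nonpos (convex_Ioi R)
      (fun r hr => (hd3 r hr).continuousAt.continuousWithinAt)
      (fun r hr => (hd3 r (interior_subset hr)).hasDerivWithinAt) fun r hr => ?_
    linarith [mul_nonpos_of_nonneg_of_nonpos (hq r (interior_subset hr))
      (hnonpos r (interior_subset hr))]
  constructor
  · rw [Metric.tendsto_atTop]
    intro ε hε
    obtain ⟨s, hs, hsε⟩ : ∃ s ∈ Ioi R, ψ s ^ 2 < ε ^ 2 := by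
      by_contra! hcon
      exact not_integrableOn_Ioi_of_le (by positivity) hcon hint
    refine ⟨s, fun r hr => ?_⟩
    rw [Real.dist_eq, sub_zero]
    refine abs_lt_of_sq_lt_sq ?_ hε.le
    exact (hanti hs (lt_of_lt_of_le hs hr) hr).trans_lt hsε
  · refine ⟨|ψ' (R + 1)|, eventually_map.2 ?_⟩
    filter_upwards [eventually_ge_atTop (R + 1)] with r hr
    refine sq_le_sq.1 (hanti' (show R < R + 1 by linarith) (show R < r by linarith) hr)

namespace SolvesLaneEmden

variable {m : ℕ} {Q Q₁ : ℝ → ℝ}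

/-- Negative Dirichlet eigenvalues of the linearisation on the unbounded nodal interval are
unique. -/
theorem eigenvalue_unique_Ici (h : SolvesLaneEmden m Q Q₁) (hm : 2 ≤ m) {a κ : ℝ} (ha : 0 < a)
    (hκ0 : 0 < κ) (hκ : Tendsto (fun r => r * Q r) atTop (𝓝 κ))
    (hκ' : Tendsto (fun r => r ^ 2 * Q₁ r) atTop (𝓝 (-κ)))
    (hQa : Q a = 0) (hQ : ∀ r ∈ Ioi a, 0 < Q r) {μ ν : ℝ}
    (hμ : μ < 0) (hν : ν < 0) {ψ ψ' η η' : ℝ → ℝ}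
    (hψ : SolvesOn (fun r => -((2 * m + 1) * Q r ^ (2 * m) + μ)) ψ ψ' (Ioi a))
    (hη : SolvesOn (fun r => -((2 * m + 1) * Q r ^ (2 * m) + ν)) η η' (Ioi a))
    (hψc : ContinuousOn ψ (Ici a)) (hψc' : ContinuousOn ψ' (Ici a))
    (hηc : ContinuousOn η (Ici a)) (hηc' : ContinuousOn η' (Ici a))
    (hψa : ψ a = 0) (hηa : η a = 0)
    (hψi : IntegrableOn (fun r => ψ r ^ 2) (Ioi a)) (hηi : IntegrableOn (fun r => η r ^ 2) (Ioi a))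
    (hψne : ∃ x ∈ Ioi a, ψ x ≠ 0) (hηne : ∃ x ∈ Ioi a, η x ≠ 0) : μ = ν := by
  by_contra hne
  have hsub : Ioi a ⊆ Ioi 0 := fun x hx => ha.trans hx
  have hg := h.solvesOn_gen (by omega)
  have hga := h.gen_pos_of_pos_right ha (lt_add_one a) hQa (fun r hr => hQ r hr.1)
  have hz : ∀ x ∈ Ioi a, gen m Q Q₁ x = 0 → gen' m Q Q₁ x < 0 := fun x hx h0 =>
    gen'_neg hm (hsub hx) (hQ x hx) (h.energy_nonneg_of_tendsto hm hκ hκ' (hsub hx)) h0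
  have hm' : (2 : ℝ) ≤ m := by exact_mod_cast hm
  have hlneg : κ / m - κ < 0 := sub_neg.2 (div_lt_self hκ0 (by linarith))
  have hlim := tendsto_gen (m := m) hκ hκ'
  obtain ⟨c, hc, hc0, hcu⟩ := exists_unique_zero_of_deriv_neg_at_zeros (convex_Ioi a)
    (fun x hx => (hg x (hsub hx)).1) hz
    (by
      have h1 : ∀ᶠ y in 𝓝[>] a, 0 < gen m Q Q₁ y :=
        ((hg a ha).1.continuousAt.eventually (lt_mem_nhds hga)).filter_mono nhdsWithin_le_nhds
      obtain ⟨y, hy1, hy2⟩ := (h1.and self_mem_nhdsWithin).exists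
      exact ⟨y, hy2, hy1⟩)
    (by
      obtain ⟨y, hy1, hy2⟩ := ((hlim.eventually (gt_mem_nhds hlneg)).and
        (eventually_gt_atTop a)).exists
      exact ⟨y, hy2, hy1⟩)
  have hwa : 𝓝[>] a ≤ 𝓝[Ici a] a := nhdsWithin_mono _ Ioi_subset_Ici_self
  have hlima : ∀ f : ℝ → ℝ, ContinuousOn f (Ici a) → Tendsto f (𝓝[>] a) (𝓝 (f a)) := fun f hf =>
    (hf a self_mem_Ici).mono_left hwa
  have hV0 : Tendsto (fun r => (2 * m + 1) * Q r ^ (2 * m)) atTop (𝓝 0) := by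
    have := ((tendsto_zero hκ).pow (2 * m)).const_mul (2 * m + 1 : ℝ)
    rwa [zero_pow (by omega), mul_zero] at this
  have hdecay : ∀ (ρ : ℝ) (f f' : ℝ → ℝ), ρ < 0 →
      SolvesOn (fun r => -((2 * m + 1) * Q r ^ (2 * m) + ρ)) f f' (Ioi a) →
      IntegrableOn (fun r => f r ^ 2) (Ioi a) →
      Tendsto f atTop (𝓝 0) ∧ IsBoundedUnder (· ≤ ·) atTop ((fun x => ‖x‖) ∘ f') := by
    intro ρ f f' hρ hf hi
    obtain ⟨R, hR⟩ := eventually_atTop.1 (hV0.eventually (gt_mem_nhds (neg_pos.2 hρ)))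
    have hs : Ioi (max R a) ⊆ Ioi a := Ioi_subset_Ioi (le_max_right _ _)
    refine (hf.mono hs).decay (fun r hr => ?_) (hi.mono_set hs)
    have := hR r ((le_max_left R a).trans (le_of_lt hr))
    linarith
  refine false_of_two_negative_eigenvalues (la := 𝓝[>] a) (lb := atTop) (convex_Ioi a)
    isOpen_Ioi ?_ ?_ (hg.mono hsub) hc hc0 (hz c hc hc0).ne hcu ?_ hμ hν hne hψ hη ?_ ?_ hψne hηne
  · intro x hx
    filter_upwards [Ioo_mem_nhdsGT (mem_Ioi.1 hx)] with y hy
    exact ⟨hy.1, hy.2.le⟩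
  · intro x hx
    filter_upwards [eventually_ge_atTop x] with y hy
    exact ⟨lt_of_lt_of_le hx hy, hy⟩
  · rintro l (rfl | rfl)
    · have hq : ContinuousAt (fun r => gen' m Q Q₁ r / gen m Q Q₁ r) a :=
        (hg a ha).2.continuousAt.div (hg a ha).1.continuousAt hga.ne'
      exact (hq.mono_left nhdsWithin_le_nhds).norm.isBoundedUnder_le
    · exact ((tendsto_gen' (by omega) hκ hκ').div hlim hlneg.ne).norm.isBoundedUnder_le
  · rintro l (rfl | rfl)
    · exact ⟨by simpa [hψa] using hlima ψ hψc, (hlima ψ' hψc').norm.isBoundedUnder_le⟩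
    · exact hdecay μ ψ ψ' hμ hψ hψi
  · rintro l (rfl | rfl)
    · exact ⟨by simpa [hηa] using hlima η hηc, (hlima η' hηc').norm.isBoundedUnder_le⟩
    · exact hdecay ν η η' hν hη hηi

end SolvesLaneEmden

/-- Solutions of `ψ'' + (V + x) ψ = 0`, `ψ a = 0`, `ψ' a = 1`, depending continuously on `x`. -/
lemma exists_shooting_family {V : ℝ → ℝ} {a B : ℝ} (hV : ContinuousOn V (Ici a))
    (hV0 : ∀ r ∈ Ici a, 0 ≤ V r) (hVB : ∀ r ∈ Ici a, V r ≤ B) :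
    ∃ ψ ψ₁ : ℝ → ℝ → ℝ, Continuous (Function.uncurry ψ) ∧ Continuous (Function.uncurry ψ₁) ∧
      ∀ x ∈ Icc (-(B + 1)) 0, ContDiff ℝ 2 (ψ x) ∧ ψ x a = 0 ∧ ψ₁ x a = 1 ∧
        SolvesOn (fun r => -(V r + x)) (ψ x) (ψ₁ x) (Ici a) := by
  have hB : 0 ≤ B := (hV0 a self_mem_Ici).trans (hVB a self_mem_Ici)
  have hVc : Continuous fun r => V (max r a) :=
    hV.comp_continuous (by fun_prop) fun r => le_max_right r a
  obtain ⟨ψ, ψ₁, hψ, hψ₁, h⟩ := exists_linear_ivp_family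
    (q := fun x r => -(V (max r a) + max (-(B + 1)) (min x 0))) (M := B + 1)
    (by
      unfold Function.uncurry
      exact ((hVc.comp continuous_snd).add
        (continuous_const.max (continuous_fst.min continuous_const))).neg)
    (by
      intro x r
      have h1 := hV0 (max r a) (le_max_right r a)
      have h2 := hVB (max r a) (le_max_right r a)
      have h3 : -(B + 1) ≤ max (-(B + 1)) (min x 0) := le_max_left _ _
      have h4 : max (-(B + 1)) (min x 0) ≤ 0 := max_le (by linarith) (min_le_right _ _)
      rw [abs_le]
      constructor <;> linarith) a
  refine ⟨ψ, ψ₁, hψ, hψ₁, fun x hx => ⟨(h x).1, (h x).2.1, (h x).2.2.1, fun r hr => ?_⟩⟩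
  have := (h x).2.2.2 r hr
  rwa [max_eq_left (mem_Ici.1 hr), min_eq_left hx.2, max_eq_right hx.1] at this

lemma isOpen_setOf_forall_Icc_pos_or {ψ ψ₁ : ℝ → ℝ → ℝ} (hψ : Continuous (Function.uncurry ψ))
    (hψ₁ : Continuous (Function.uncurry ψ₁)) (a T : ℝ) :
    IsOpen {x | ∀ r ∈ Icc a T, 0 < ψ x r ∨ 0 < ψ₁ x r} := by
  rw [isOpen_iff_mem_nhds]
  intro x hx
  refine isCompact_Icc.eventually_forall_of_forall_eventually fun r hr => ?_
  rcases hx r hr with h | h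
  · exact ((hψ.continuousAt (x := (x, r))).eventually (lt_mem_nhds h)).mono fun _ => Or.inl
  · exact ((hψ₁.continuousAt (x := (x, r))).eventually (lt_mem_nhds h)).mono fun _ => Or.inr

lemma SolvesOn.pos_of_pos_or {q ψ ψ₁ : ℝ → ℝ} {a T : ℝ} (h : SolvesOn q ψ ψ₁ (Icc a T))
    (ha : 0 ≤ ψ a) (hpos : ∀ r ∈ Icc a T, 0 < ψ r ∨ 0 < ψ₁ r) : ∀ r ∈ Ioc a T, 0 < ψ r :=
  pos_of_deriv_pos_at_zeros (fun r hr => (h r hr).1) ha fun r hr h0 =>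
    (hpos r hr).resolve_left h0.not_gt

lemma isOpen_setOf_exists_neg {ψ : ℝ → ℝ → ℝ} (hψ : Continuous (Function.uncurry ψ)) (J : Set ℝ) :
    IsOpen {x | ∃ r ∈ J, ψ x r < 0} := by
  have : {x | ∃ r ∈ J, ψ x r < 0} = ⋃ r ∈ J, {x | ψ x r < 0} := by
    ext
    simp
  rw [this]
  refine isOpen_biUnion fun r _ => isOpen_lt ?_ continuous_const
  exact hψ.comp (continuous_id.prodMk continuous_const)

/-- Two disjoint relatively open conditions on an interval, each satisfied at one end, cannot
exhaust the interval. -/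
lemma exists_mem_Ioo_of_isOpen {c d : ℝ} (hcd : c ≤ d) {S T : Set ℝ} (hS : IsOpen S)
    (hT : IsOpen T) (hc : c ∈ S) (hd : d ∈ T) (hST : ∀ x ∈ Icc c d, x ∈ S → x ∉ T) :
    ∃ x ∈ Ioo c d, x ∉ S ∧ x ∉ T := by
  by_contra! hcon
  obtain ⟨x, hx, hxS, hxT⟩ := isPreconnected_Icc S T hS hT
    (fun x hx => by
      by_contra hx'
      rw [mem_union, not_or] at hx'
      rcases hx.1.eq_or_lt with rfl | h1
      · exact hx'.1 hc
      rcases hx.2.eq_or_lt with rfl | h2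
      · exact hx'.2 hd
      exact hx'.2 (hcon x ⟨h1, h2⟩ hx'.1))
    ⟨c, left_mem_Icc.2 hcd, hc⟩ ⟨d, right_mem_Icc.2 hcd, hd⟩
  exact hST x hx hxS hxT

section Shooting

variable {V : ℝ → ℝ} {a B : ℝ} {ψ ψ₁ : ℝ → ℝ → ℝ}

/-- The shooting method on a bounded interval. -/
lemma exists_dirichlet_of_shooting {b : ℝ} (hab : a < b)
    (hV0 : ∀ r ∈ Ici a, 0 ≤ V r) (hVB : ∀ r ∈ Ici a, V r ≤ B)
    (hψ : Continuous (Function.uncurry ψ)) (hψ₁ : Continuous (Function.uncurry ψ₁))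
    (h : ∀ x ∈ Icc (-(B + 1)) 0, ψ x a = 0 ∧ ψ₁ x a = 1 ∧
        SolvesOn (fun r => -(V r + x)) (ψ x) (ψ₁ x) (Ici a))
    (hneg : ∃ r ∈ Ioo a b, ψ 0 r < 0) :
    ∃ μ ∈ Ioo (-(B + 1)) 0, (∀ r ∈ Ioo a b, 0 < ψ μ r) ∧ ψ μ b = 0 := by
  have hB : 0 ≤ B := (hV0 a self_mem_Ici).trans (hVB a self_mem_Ici)
  have hqM : ∀ x ∈ Icc (-(B + 1)) 0, ∀ r ∈ Ici a, |-(V r + x)| ≤ B + 1 := by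
    intro x hx r hr
    have h1 := hV0 r hr
    have h2 := hVB r hr
    rw [abs_le]
    constructor <;> linarith [hx.1, hx.2]
  have hpos : ∀ x ∈ Icc (-(B + 1)) 0, (∀ r ∈ Icc a b, 0 < ψ x r ∨ 0 < ψ₁ x r) →
      ∀ r ∈ Ioc a b, 0 < ψ x r := fun x hx =>
    ((h x hx).2.2.mono Icc_subset_Ici_self).pos_of_pos_or (h x hx).1.ge
  obtain ⟨μ, hμ, hμ1, hμ2⟩ := exists_mem_Ioo_of_isOpen (c := -(B + 1)) (d := 0) (by linarith)
    (isOpen_setOf_forall_Icc_pos_or hψ hψ₁ a b) (isOpen_setOf_exists_neg hψ (Ioo a b))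
    (by
      have hx : -(B + 1) ∈ Icc (-(B + 1)) 0 := ⟨le_rfl, by linarith⟩
      obtain ⟨h1, h2, h3⟩ := h _ hx
      intro r hr
      rcases hr.1.eq_or_lt with rfl | hlt
      · exact Or.inr (by linarith)
      · refine Or.inl ((h3.mono Icc_subset_Ici_self).growth (fun s hs => hqM _ hx s hs.1)
          (fun s hs => ?_) h1.ge (by linarith) r ⟨hlt, hr.2⟩).1
        linarith [hVB s hs.1])
    hneg
    (by
      rintro x hx hx1 ⟨r, hr, hr'⟩
      exact (hpos x hx hx1 r ⟨hr.1, hr.2.le⟩).not_gt hr')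
  have hμ' := Ioo_subset_Icc_self hμ
  obtain ⟨h1, h2, h3⟩ := h μ hμ'
  simp only [mem_ofPred_eq, not_exists, not_and, not_lt] at hμ2
  have hμpos := (h3.mono Ico_subset_Ici_self).pos_of_nonneg
    (fun r hr => hqM μ hμ' r hr.1) (by rw [h2]; exact one_ne_zero) hμ2
  refine ⟨μ, hμ, hμpos, ?_⟩
  simp only [mem_ofPred_eq, not_forall, not_or, not_lt] at hμ1
  obtain ⟨r, hr, hr1, hr2⟩ := hμ1
  rcases hr.1.eq_or_lt with rfl | hlt
  · linarith
  rcases hr.2.eq_or_lt with rfl | hlt'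
  · refine hr1.antisymm ?_
    refine ge_of_tendsto (((h3 r hr.1).1.continuousAt).mono_left
      (nhdsWithin_le_nhds (s := Iio r))) ?_
    filter_upwards [Ioo_mem_nhdsLT hab] with s hs
    exact hμ2 s hs
  · exact absurd (hμpos r ⟨hlt, hlt'⟩) hr1.not_gt

/-- The shooting method on a half-line, for a potential vanishing at infinity. -/
lemma exists_dirichlet_Ici_of_shooting
    (hV0 : ∀ r ∈ Ici a, 0 ≤ V r) (hVB : ∀ r ∈ Ici a, V r ≤ B) (hVlim : Tendsto V atTop (𝓝 0))
    (hψ : Continuous (Function.uncurry ψ)) (hψ₁ : Continuous (Function.uncurry ψ₁))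
    (h : ∀ x ∈ Icc (-(B + 1)) 0, ψ x a = 0 ∧ ψ₁ x a = 1 ∧
        SolvesOn (fun r => -(V r + x)) (ψ x) (ψ₁ x) (Ici a))
    (hneg : ∃ r ∈ Ioi a, ψ 0 r < 0) :
    ∃ μ ∈ Ioo (-(B + 1)) 0, (∀ r ∈ Ioi a, 0 < ψ μ r) ∧
      IntegrableOn (fun r => ψ μ r ^ 2) (Ioi a) := by
  have hB : 0 ≤ B := (hV0 a self_mem_Ici).trans (hVB a self_mem_Ici)
  have hqM : ∀ x ∈ Icc (-(B + 1)) 0, ∀ r ∈ Ici a, |-(V r + x)| ≤ B + 1 := by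
    intro x hx r hr
    have h1 := hV0 r hr
    have h2 := hVB r hr
    rw [abs_le]
    constructor <;> linarith [hx.1, hx.2]
  have hpos : ∀ x ∈ Icc (-(B + 1)) 0, ∀ T, (∀ r ∈ Icc a T, 0 < ψ x r ∨ 0 < ψ₁ x r) →
      ∀ r ∈ Ioc a T, 0 < ψ x r := fun x hx T =>
    ((h x hx).2.2.mono Icc_subset_Ici_self).pos_of_pos_or (h x hx).1.ge
  obtain ⟨T₀, hT₀, hT₀'⟩ := hneg
  obtain ⟨d, hd, hdneg⟩ : ∃ d ∈ Ioo (-(B + 1)) 0, ψ d T₀ < 0 := by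
    have hc : ContinuousAt (fun x => ψ x T₀) 0 :=
      (hψ.comp (continuous_id.prodMk continuous_const)).continuousAt
    have h1 := (hc.eventually (gt_mem_nhds hT₀')).filter_mono (nhdsWithin_le_nhds (s := Iio 0))
    obtain ⟨d, hd1, hd2⟩ :=
      (h1.and (Ioo_mem_nhdsLT (show -(B + 1) < 0 by linarith))).exists
    exact ⟨d, hd2, hd1⟩
  have hd0 : 0 < -d / 2 := by linarith [hd.2]
  obtain ⟨R, haR, hR⟩ : ∃ R, a < R ∧ ∀ r, R ≤ r → V r < -d / 2 := by
    obtain ⟨R, hR⟩ := eventually_atTop.1 (hVlim.eventually (gt_mem_nhds hd0))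
    exact ⟨max R (a + 1), (lt_add_one a).trans_le (le_max_right _ _),
      fun r hr => hR r ((le_max_left _ _).trans hr)⟩
  have hIcc : Icc (-(B + 1)) d ⊆ Icc (-(B + 1)) 0 := Icc_subset_Icc_right hd.2.le
  have hqpos : ∀ x ∈ Icc (-(B + 1)) d, ∀ r, R ≤ r → -d / 2 ≤ -(V r + x) := by
    intro x hx r hr
    linarith [hR r hr, hx.2]
  have hopen : IsOpen {x | ∃ T, R ≤ T ∧ (∀ r ∈ Icc a T, 0 < ψ x r ∨ 0 < ψ₁ x r) ∧ 0 < ψ₁ x T} := by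
    have : {x | ∃ T, R ≤ T ∧ (∀ r ∈ Icc a T, 0 < ψ x r ∨ 0 < ψ₁ x r) ∧ 0 < ψ₁ x T} =
        ⋃ T ∈ Ici R, {x | ∀ r ∈ Icc a T, 0 < ψ x r ∨ 0 < ψ₁ x r} ∩ {x | 0 < ψ₁ x T} := by
      ext
      simp only [mem_ofPred_eq, mem_iUnion, mem_inter_iff, mem_Ici, exists_prop]
    rw [this]
    refine isOpen_biUnion fun T _ => (isOpen_setOf_forall_Icc_pos_or hψ hψ₁ a T).inter
      (isOpen_lt continuous_const (hψ₁.comp (continuous_id.prodMk continuous_const)))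
  obtain ⟨μ, hμ, hμ1, hμ2⟩ := exists_mem_Ioo_of_isOpen (c := -(B + 1)) (d := d) hd.1.le
    hopen (isOpen_setOf_exists_neg hψ (Ioi a))
    (by
      have hx : -(B + 1) ∈ Icc (-(B + 1)) 0 := ⟨le_rfl, by linarith⟩
      obtain ⟨h1, h2, h3⟩ := h _ hx
      have hgr := (h3.mono (Icc_subset_Ici_self : Icc a R ⊆ Ici a)).growth (fun s hs => hqM _ hx s hs.1)
        (fun s hs => by
          have := hVB s hs.1
          linarith) h1.ge (by linarith)
      refine ⟨R, le_rfl, fun r hr => ?_, (hgr R ⟨haR, le_rfl⟩).2⟩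
      rcases hr.1.eq_or_lt with rfl | hlt
      · exact Or.inr (by linarith)
      · exact Or.inl (hgr r ⟨hlt, hr.2⟩).1)
    ⟨T₀, hT₀, hdneg⟩
    (by
      rintro x hx ⟨T, hRT, hT, hT'⟩ ⟨r, hr, hr'⟩
      obtain ⟨h1, h2, h3⟩ := h _ (hIcc hx)
      have hposT := hpos x (hIcc hx) T hT
      rcases le_or_gt r T with hrT | hrT
      · exact (hposT r ⟨hr, hrT⟩).not_gt hr'
      · have haT : a < T := haR.trans_le hRT
        refine ((h3.mono fun s hs => haT.le.trans hs.1).growth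
          (fun s hs => hqM _ (hIcc hx) s (haT.le.trans hs.1))
          (fun s hs => hd0.trans_le (hqpos x hx s (hRT.trans hs.1)))
          (hposT T ⟨haT, le_rfl⟩).le hT' r ⟨hrT, le_rfl⟩).1.not_gt hr')
  have hμd := Ioo_subset_Icc_self hμ
  have hμ' := hIcc hμd
  obtain ⟨h1, h2, h3⟩ := h μ hμ'
  simp only [mem_ofPred_eq, not_exists, not_and, not_lt] at hμ2
  have hμpos : ∀ r ∈ Ioi a, 0 < ψ μ r := fun r hr =>
    (h3.mono Ico_subset_Ici_self).pos_of_nonneg (b := r + 1)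
      (fun r hr => hqM μ hμ' r hr.1) (by rw [h2]; exact one_ne_zero)
      (fun s hs => hμ2 s hs.1) r ⟨hr, lt_add_one r⟩
  refine ⟨μ, ⟨hμ.1, hμ.2.trans hd.2⟩, hμpos, ?_⟩
  have hdecr : ∀ r, R ≤ r → ψ₁ μ r ≤ 0 := by
    intro T hT
    by_contra! hT'
    refine hμ1 ⟨T, hT, fun r hr => ?_, hT'⟩
    rcases hr.1.eq_or_lt with rfl | hlt
    · exact Or.inr (by linarith)
    · exact Or.inl (hμpos r hlt)
  have hRa : ∀ r ∈ Ici R, r ∈ Ici a := fun r hr => haR.le.trans hr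
  have hder : ∀ r ∈ Ici R, HasDerivAt (fun r => ψ μ r * ψ₁ μ r)
      (ψ₁ μ r ^ 2 + -(V r + μ) * ψ μ r ^ 2) r := by
    intro r hr
    refine ((h3 r (hRa r hr)).1.mul (h3 r (hRa r hr)).2).congr_deriv ?_
    ring
  have hder0 : ∀ r ∈ Ioi R, 0 ≤ ψ₁ μ r ^ 2 + -(V r + μ) * ψ μ r ^ 2 := fun r hr =>
    add_nonneg (sq_nonneg _)
      (mul_nonneg (hd0.le.trans (hqpos μ hμd r (le_of_lt hr))) (sq_nonneg _))
  have hmono : MonotoneOn (fun r => ψ μ r * ψ₁ μ r) (Ici R) :=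
    monotoneOn_of_hasDerivWithinAt_nonneg (convex_Ici R)
      (fun r hr => (hder r hr).continuousAt.continuousWithinAt)
      (fun r hr => (hder r (interior_subset hr)).hasDerivWithinAt)
      fun r hr => hder0 r (by rwa [interior_Ici] at hr)
  obtain ⟨l, hl⟩ : ∃ l, Tendsto (fun r => ψ μ r * ψ₁ μ r) atTop (𝓝 l) := by
    have hm : Monotone fun r => ψ μ (max R r) * ψ₁ μ (max R r) := fun x y hxy =>
      hmono (le_max_left R x) (le_max_left R y) (max_le_max le_rfl hxy)
    have hbdd : BddAbove (range fun r => ψ μ (max R r) * ψ₁ μ (max R r)) := by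
      refine ⟨0, ?_⟩
      rintro _ ⟨r, rfl⟩
      exact mul_nonpos_of_nonneg_of_nonpos (hμpos _ (haR.trans_le (le_max_left R r))).le
        (hdecr _ (le_max_left R r))
    refine ⟨_, (tendsto_atTop_ciSup hm hbdd).congr' ?_⟩
    filter_upwards [eventually_ge_atTop R] with r hr
    rw [max_eq_right hr]
  have hint := integrableOn_Ioi_deriv_of_nonneg' hder hder0 hl
  have hcont : Continuous fun r => ψ μ r ^ 2 :=
    (hψ.comp (continuous_const.prodMk continuous_id)).pow 2
  rw [← Ioc_union_Ioi_eq_Ioi haR.le]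
  refine ((hcont.integrableOn_Icc).mono_set Ioc_subset_Icc_self).union ?_
  refine Integrable.mono' (hint.const_mul (-d / 2)⁻¹) hcont.aestronglyMeasurable ?_
  filter_upwards [ae_restrict_mem measurableSet_Ioi] with r hr
  rw [Real.norm_of_nonneg (sq_nonneg _), inv_mul_eq_div, le_div_iff₀ hd0]
  have := mul_le_mul_of_nonneg_right (hqpos μ hμd r (le_of_lt hr)) (sq_nonneg (ψ μ r))
  nlinarith [sq_nonneg (ψ₁ μ r)]

end Shooting

namespace SolvesLaneEmden

variable {m : ℕ} {Q Q₁ : ℝ → ℝ}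

/-- Sturm comparison with `r Q`: the Wronskian of a positive solution of the linearisation at
`0` and `r Q` is strictly decreasing. -/
lemma strictAntiOn_wronskian (h : SolvesLaneEmden m Q Q₁) (hm : 0 < m) {D : Set ℝ}
    (hD : Convex ℝ D) (hD0 : D ⊆ Ioi 0) {u u₁ : ℝ → ℝ}
    (hu : SolvesOn (fun r => -((2 * m + 1) * Q r ^ (2 * m) + 0)) u u₁ D)
    (hupos : ∀ r ∈ interior D, 0 < u r) (hQ : ∀ r ∈ interior D, 0 < Q r) :
    StrictAntiOn (fun r => u₁ r * (r * Q r) - u r * (Q r + r * Q₁ r)) D := by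
  have hv := h.solvesOn_mul.mono hD0
  have hd : ∀ r ∈ D, HasDerivAt (fun r => u₁ r * (r * Q r) - u r * (Q r + r * Q₁ r))
      (-(2 * m * Q r ^ (2 * m) * u r * (r * Q r))) r := by
    intro r hr
    refine (((hu r hr).2.mul (hv r hr).1).sub ((hu r hr).1.mul (hv r hr).2)).congr_deriv ?_
    ring
  refine strictAntiOn_of_hasDerivWithinAt_neg hD
    (fun r hr => (hd r hr).continuousAt.continuousWithinAt)
    (fun r hr => (hd r (interior_subset hr)).hasDerivWithinAt) fun r hr => ?_
  have h1 := hupos r hr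
  have h2 := hQ r hr
  have h3 : 0 < r := hD0 (interior_subset hr)
  have h4 : (0 : ℝ) < m := by exact_mod_cast hm
  exact neg_neg_of_pos (by positivity)

lemma exists_neg_Ioo (h : SolvesLaneEmden m Q Q₁) (hm : 0 < m) {a b : ℝ} (ha : 0 < a)
    (hab : a < b) (hQa : Q a = 0) (hQb : Q b = 0) (hQ : ∀ r ∈ Ioo a b, 0 < Q r) {u u₁ : ℝ → ℝ}
    (hu : SolvesOn (fun r => -((2 * m + 1) * Q r ^ (2 * m) + 0)) u u₁ (Icc a b))
    (hua : u a = 0) (hu₁a : u₁ a = 1) : ∃ r ∈ Ioo a b, u r < 0 := by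
  by_contra! hnn
  have hsub : Icc a b ⊆ Ioi 0 := fun x hx => ha.trans_le hx.1
  obtain ⟨M, hM⟩ := isCompact_Icc.exists_bound_of_continuousOn
    (f := fun r => -((2 * m + 1) * Q r ^ (2 * m) + 0))
    (((((h.continuousOn.mono hsub).pow (2 * m)).const_smul (2 * m + 1 : ℝ)).add
      continuousOn_const).neg)
  have hpos := (hu.mono Ico_subset_Icc_self).pos_of_nonneg
    (fun r hr => hM r (Ico_subset_Icc_self hr)) (by rw [hu₁a]; exact one_ne_zero) hnn
  have hW := h.strictAntiOn_wronskian hm (convex_Icc a b) hsub hu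
    (by rwa [interior_Icc]) (by rwa [interior_Icc])
  have hlt := hW (left_mem_Icc.2 hab.le) (right_mem_Icc.2 hab.le) hab
  simp only [hua, hQa, hQb, mul_zero, zero_mul, sub_zero, zero_sub, zero_add] at hlt
  have hub : 0 ≤ u b := by
    refine ge_of_tendsto (((hu b (right_mem_Icc.2 hab.le)).1.continuousAt).mono_left
      (nhdsWithin_le_nhds (s := Iio b))) ?_
    filter_upwards [Ioo_mem_nhdsLT hab] with s hs
    exact hnn s hs
  have hQ₁b := h.deriv_neg_of_pos_left ha hab hQb hQ
  have := mul_nonpos_of_nonneg_of_nonpos hub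
    (mul_nonpos_of_nonneg_of_nonpos (ha.trans hab).le hQ₁b.le)
  linarith

lemma exists_neg_Ioi (h : SolvesLaneEmden m Q Q₁) (hm : 0 < m) {a κ : ℝ} (ha : 0 < a)
    (hκ0 : 0 < κ) (hκ : Tendsto (fun r => r * Q r) atTop (𝓝 κ))
    (hQa : Q a = 0) (hQ : ∀ r ∈ Ioi a, 0 < Q r) {u u₁ : ℝ → ℝ}
    (hu : SolvesOn (fun r => -((2 * m + 1) * Q r ^ (2 * m) + 0)) u u₁ (Ici a))
    (hua : u a = 0) (hu₁a : u₁ a = 1) : ∃ r ∈ Ioi a, u r < 0 := by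
  by_contra! hnn
  have hsub : Ici a ⊆ Ioi 0 := Ici_subset_Ioi.2 ha
  have hpos : ∀ r ∈ Ioi a, 0 < u r := by
    intro r hr
    obtain ⟨M, hM⟩ := (isCompact_Icc (a := a) (b := r + 1)).exists_bound_of_continuousOn
      (f := fun r => -((2 * m + 1) * Q r ^ (2 * m) + 0))
      (((((h.continuousOn.mono (Icc_subset_Ici_self.trans hsub)).pow (2 * m)).const_smul
        (2 * m + 1 : ℝ)).add continuousOn_const).neg)
    exact (hu.mono Ico_subset_Ici_self).pos_of_nonneg
      (fun r hr => hM r (Ico_subset_Icc_self hr)) (by rw [hu₁a]; exact one_ne_zero)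
      (fun s hs => hnn s hs.1) r ⟨hr, lt_add_one r⟩
  have hW := h.strictAntiOn_wronskian hm (convex_Ici a) hsub hu
    (by rwa [interior_Ici]) (by rwa [interior_Ici])
  have haa : a < a + 1 := lt_add_one a
  have hlt := hW self_mem_Ici (mem_Ici.2 haa.le) haa
  simp only [hua, hQa, mul_zero, zero_mul, sub_zero] at hlt
  set w : ℝ → ℝ := fun r => u₁ r * (r * Q r) - u r * (Q r + r * Q₁ r) with hw
  obtain ⟨R, hR⟩ := eventually_atTop.1
    ((hκ.eventually (gt_mem_nhds (lt_add_one κ))).and (eventually_ge_atTop (a + 1)))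
  have hRa : a < R := haa.trans_le (hR R le_rfl).2
  have hκ1 : 0 < κ + 1 := by linarith
  have hwa : w (a + 1) < 0 := hlt
  set δ : ℝ := -w (a + 1) / (κ + 1) ^ 2 with hδ
  have hδ0 : 0 < δ := div_pos (neg_pos.2 hwa) (by positivity)
  have hvpos : ∀ r ∈ Ici R, 0 < r * Q r := fun r hr =>
    mul_pos (ha.trans (hRa.trans_le hr)) (hQ r (hRa.trans_le hr))
  have hd : ∀ r ∈ Ici R, HasDerivAt (fun r => u r / (r * Q r) + δ * r)
      (w r / (r * Q r) ^ 2 + δ) r := by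
    intro r hr
    have hra : a ≤ r := hRa.le.trans hr
    refine (((hu r hra).1.div (h.solvesOn_mul r (hsub hra)).1 (hvpos r hr).ne').add
      ((hasDerivAt_id r).const_mul δ)).congr_deriv ?_
    rw [mul_one]
  have hanti : AntitoneOn (fun r => u r / (r * Q r) + δ * r) (Ici R) := by
    refine antitoneOn_of_hasDerivWithinAt_nonpos (convex_Ici R)
      (fun r hr => (hd r hr).continuousAt.continuousWithinAt)
      (fun r hr => (hd r (interior_subset hr)).hasDerivWithinAt) fun r hr => ?_
    have hr' := interior_subset hr
    have h1 : w r ≤ w (a + 1) :=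
      hW.antitoneOn (mem_Ici.2 haa.le) (hRa.le.trans hr') (hR r hr').2
    have h2 := hvpos r hr'
    have h3 := (hR r hr').1
    have h4 : (r * Q r) ^ 2 ≤ (κ + 1) ^ 2 := pow_le_pow_left₀ h2.le h3.le 2
    have h5 : δ ≤ -w r / (r * Q r) ^ 2 :=
      div_le_div₀ (by linarith) (by linarith) (by positivity) h4
    rw [neg_div] at h5
    linarith
  set c := u R / (R * Q R) + δ * R with hc
  have hev : ∀ᶠ r in atTop, c < δ * r := (tendsto_id.const_mul_atTop hδ0).eventually_gt_atTop c
  obtain ⟨r, hr1, hr2⟩ := (hev.and (eventually_ge_atTop R)).exists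
  have h1 := hanti self_mem_Ici hr2 hr2
  simp only [← hc] at h1
  have h2 : 0 < u r / (r * Q r) := div_pos (hpos r (hRa.trans_le hr2)) (hvpos r hr2)
  linarith

/-- A negative Dirichlet eigenvalue of the linearisation on a bounded nodal interval. -/
theorem exists_eigenvalue_Icc (h : SolvesLaneEmden m Q Q₁) (hm : 0 < m) {a b : ℝ} (ha : 0 < a)
    (hab : a < b) (hQa : Q a = 0) (hQb : Q b = 0) (hQ : ∀ r ∈ Ioo a b, 0 < Q r) {B : ℝ}
    (hB : ∀ r ∈ Ici a, (2 * m + 1) * Q r ^ (2 * m) ≤ B) :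
    ∃ μ < 0, ∃ ψ ψ₁ : ℝ → ℝ, ContDiff ℝ 2 ψ ∧
      SolvesOn (fun r => -((2 * m + 1) * Q r ^ (2 * m) + μ)) ψ ψ₁ (Ici a) ∧
      ψ a = 0 ∧ ψ b = 0 ∧ ∀ r ∈ Ioo a b, 0 < ψ r := by
  have hV0 : ∀ r ∈ Ici a, 0 ≤ (2 * m + 1) * Q r ^ (2 * m) := fun r _ =>
    mul_nonneg (by positivity) ((even_two_mul m).pow_nonneg _)
  obtain ⟨ψ, ψ₁, hψ, hψ₁, hs⟩ := exists_shooting_family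
    (((h.continuousOn.mono (Ici_subset_Ioi.2 ha)).pow (2 * m)).const_smul (2 * m + 1 : ℝ)) hV0 hB
  have h0 : (0 : ℝ) ∈ Icc (-(B + 1)) 0 :=
    ⟨by linarith [(hV0 a self_mem_Ici).trans (hB a self_mem_Ici)], le_rfl⟩
  obtain ⟨-, h1, h2, h3⟩ := hs 0 h0
  obtain ⟨μ, hμ, hpos, hb⟩ := exists_dirichlet_of_shooting hab hV0 hB hψ hψ₁
    (fun x hx => (hs x hx).2)
    (h.exists_neg_Ioo hm ha hab hQa hQb hQ (h3.mono Icc_subset_Ici_self) h1 h2)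
  obtain ⟨h4, h5, -, h6⟩ := hs μ (Ioo_subset_Icc_self hμ)
  exact ⟨μ, hμ.2, ψ μ, ψ₁ μ, h4, h6, h5, hb, hpos⟩

/-- A negative Dirichlet eigenvalue of the linearisation on the unbounded nodal interval. -/
theorem exists_eigenvalue_Ici (h : SolvesLaneEmden m Q Q₁) (hm : 0 < m) {a κ : ℝ} (ha : 0 < a)
    (hκ0 : 0 < κ) (hκ : Tendsto (fun r => r * Q r) atTop (𝓝 κ))
    (hQa : Q a = 0) (hQ : ∀ r ∈ Ioi a, 0 < Q r) {B : ℝ}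
    (hB : ∀ r ∈ Ici a, (2 * m + 1) * Q r ^ (2 * m) ≤ B) :
    ∃ μ < 0, ∃ ψ ψ₁ : ℝ → ℝ, ContDiff ℝ 2 ψ ∧
      SolvesOn (fun r => -((2 * m + 1) * Q r ^ (2 * m) + μ)) ψ ψ₁ (Ici a) ∧
      ψ a = 0 ∧ IntegrableOn (fun r => ψ r ^ 2) (Ioi a) ∧ ∀ r ∈ Ioi a, 0 < ψ r := by
  have hV0 : ∀ r ∈ Ici a, 0 ≤ (2 * m + 1) * Q r ^ (2 * m) := fun r _ =>
    mul_nonneg (by positivity) ((even_two_mul m).pow_nonneg _)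
  obtain ⟨ψ, ψ₁, hψ, hψ₁, hs⟩ := exists_shooting_family
    (((h.continuousOn.mono (Ici_subset_Ioi.2 ha)).pow (2 * m)).const_smul (2 * m + 1 : ℝ)) hV0 hB
  have h0 : (0 : ℝ) ∈ Icc (-(B + 1)) 0 :=
    ⟨by linarith [(hV0 a self_mem_Ici).trans (hB a self_mem_Ici)], le_rfl⟩
  obtain ⟨-, h1, h2, h3⟩ := hs 0 h0
  have hlim : Tendsto (fun r => (2 * m + 1) * Q r ^ (2 * m)) atTop (𝓝 0) := by
    have := ((tendsto_zero hκ).pow (2 * m)).const_mul (2 * m + 1 : ℝ)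
    rwa [zero_pow (by omega), mul_zero] at this
  obtain ⟨μ, hμ, hpos, hi⟩ := exists_dirichlet_Ici_of_shooting hV0 hB hlim hψ hψ₁
    (fun x hx => (hs x hx).2) (h.exists_neg_Ioi hm ha hκ0 hκ hQa hQ h3 h1 h2)
  obtain ⟨h4, h5, -, h6⟩ := hs μ (Ioo_subset_Icc_self hμ)
  exact ⟨μ, hμ.2, ψ μ, ψ₁ μ, h4, h6, h5, hi, hpos⟩

lemma exists_bound_Ici (h : SolvesLaneEmden m Q Q₁) {a κ : ℝ} (ha : 0 < a)
    (hκ : Tendsto (fun r => r * Q r) atTop (𝓝 κ)) :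
    ∃ B, ∀ r ∈ Ici a, (2 * m + 1) * Q r ^ (2 * m) ≤ B := by
  have hlim := ((tendsto_zero hκ).pow (2 * m)).const_mul (2 * m + 1 : ℝ)
  obtain ⟨R, hR⟩ := eventually_atTop.1 (hlim.eventually (gt_mem_nhds (lt_add_one _)))
  obtain ⟨M, hM⟩ := (isCompact_Icc (a := a) (b := R)).exists_bound_of_continuousOn
    (((h.continuousOn.mono (Icc_subset_Ici_self.trans (Ici_subset_Ioi.2 ha))).pow
      (2 * m)).const_smul (2 * m + 1 : ℝ))
  refine ⟨max M ((2 * m + 1) * 0 ^ (2 * m) + 1), fun r hr => ?_⟩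
  rcases le_total r R with hrR | hrR
  · exact (le_abs_self _).trans ((hM r ⟨hr, hrR⟩).trans (le_max_left _ _))
  · exact (hR r hrR).le.trans (le_max_right _ _)

end SolvesLaneEmden

/-- Passing from a radial function `φ` to `r φ`. -/
lemma solvesOn_of_radial {V φ : ℝ → ℝ} {S : Set ℝ} {μ : ℝ} (hS : UniqueDiffOn ℝ S)
    (hS0 : S ⊆ Ioi 0) (hφ : ContDiffOn ℝ 2 φ S)
    (hode : ∀ r ∈ interior S,
      deriv (deriv φ) r + (2 / r) * deriv φ r + V r * φ r + μ * φ r = 0) :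
    ContinuousOn (fun r => r * φ r) S ∧ ContinuousOn (fun r => φ r + r * derivWithin φ S r) S ∧
      SolvesOn (fun r => -(V r + μ)) (fun r => r * φ r) (fun r => φ r + r * derivWithin φ S r)
        (interior S) := by
  refine ⟨continuousOn_id.mul hφ.continuousOn, hφ.continuousOn.add (continuousOn_id.mul
    (hφ.continuousOn_derivWithin hS (by norm_num))), fun r hr => ?_⟩
  have hr0 : r ≠ 0 := (hS0 (interior_subset hr)).ne'
  have hφ' := (contDiffOn_succ_iff_deriv_of_isOpen (n := 1) isOpen_interior).1
    (show ContDiffOn ℝ (1 + 1) φ (interior S) by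
      rw [one_add_one_eq_two]
      exact hφ.mono interior_subset)
  have hd : ∀ s ∈ interior S, derivWithin φ S s = deriv φ s := fun s hs =>
    derivWithin_of_mem_nhds (mem_interior_iff_mem_nhds.1 hs)
  have hnhds := isOpen_interior.mem_nhds hr
  have h1 : HasDerivAt φ (deriv φ r) r := (hφ'.1.differentiableAt hnhds).hasDerivAt
  have h2 : HasDerivAt (deriv φ) (deriv (deriv φ) r) r :=
    ((hφ'.2.2.differentiableOn (by norm_num)).differentiableAt hnhds).hasDerivAt
  have h3 : HasDerivAt (derivWithin φ S) (deriv (deriv φ) r) r :=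
    h2.congr_of_eventuallyEq (by filter_upwards [hnhds] with s hs using hd s hs)
  refine ⟨((hasDerivAt_id r).mul h1).congr_deriv ?_,
    (h1.add ((hasDerivAt_id r).mul h3)).congr_deriv ?_⟩
  · simp [hd r hr]
  · have := hode r hr
    rw [hd r hr]
    simp only [id]
    field_simp at this
    linarith

/-- Passing from a solution `ψ` to the radial function `ψ / r`. -/
lemma SolvesOn.radial {V ψ ψ₁ : ℝ → ℝ} {U : Set ℝ} {μ : ℝ} (hU : IsOpen U) (hU0 : U ⊆ Ioi 0)
    (h : SolvesOn (fun r => -(V r + μ)) ψ ψ₁ U) {r : ℝ} (hr : r ∈ U) :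
    deriv (deriv fun r => ψ r / r) r + (2 / r) * deriv (fun r => ψ r / r) r
      + V r * (ψ r / r) + μ * (ψ r / r) = 0 := by
  have hd : ∀ s ∈ U, HasDerivAt (fun r => ψ r / r) ((ψ₁ s * s - ψ s) / s ^ 2) s := by
    intro s hs
    refine ((h s hs).1.div (hasDerivAt_id s) (hU0 hs).ne').congr_deriv ?_
    simp
  have hr0 : r ≠ 0 := (hU0 hr).ne'
  have hev : deriv (fun r => ψ r / r) =ᶠ[𝓝 r] fun s => (ψ₁ s * s - ψ s) / s ^ 2 := by
    filter_upwards [hU.mem_nhds hr] with s hs using (hd s hs).deriv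
  have hd2 := ((((h r hr).2.mul (hasDerivAt_id r)).sub (h r hr).1).div
    ((hasDerivAt_id r).pow 2) (pow_ne_zero 2 hr0)).congr_of_eventuallyEq hev
  rw [hd2.deriv, (hd r hr).deriv]
  simp only [id, Pi.mul_apply, Pi.sub_apply, Pi.pow_apply]
  field_simp
  ring

namespace SolvesLaneEmden

variable {m : ℕ} {Q Q₁ : ℝ → ℝ}

theorem existsUnique_eigenvalue_Icc (h : SolvesLaneEmden m Q Q₁) (hm : 2 ≤ m) {a b κ : ℝ}
    (ha : 0 < a) (hab : a < b) (hQa : Q a = 0) (hQb : Q b = 0) (hQ : ∀ r ∈ Ioo a b, 0 < Q r)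
    (hκ : Tendsto (fun r => r * Q r) atTop (𝓝 κ)) :
    ∃! μ : ℝ, μ < 0 ∧ ∃ φ : ℝ → ℝ, (∃ r ∈ Icc a b, φ r ≠ 0) ∧ ContDiffOn ℝ 2 φ (Icc a b) ∧
      φ a = 0 ∧ φ b = 0 ∧ ∀ r ∈ Ioo a b, deriv (deriv φ) r + (2 / r) * deriv φ r
        + (2 * m + 1) * Q r ^ (2 * m) * φ r + μ * φ r = 0 := by
  have hsub : Icc a b ⊆ Ioi 0 := fun x hx => ha.trans_le hx.1
  refine existsUnique_of_exists_of_unique ?_ ?_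
  · obtain ⟨B, hB⟩ := h.exists_bound_Ici (m := m) ha hκ
    obtain ⟨μ, hμ, ψ, ψ₁, hψ, hs, hψa, hψb, hpos⟩ :=
      h.exists_eigenvalue_Icc (by omega) ha hab hQa hQb hQ hB
    obtain ⟨r, hr⟩ := nonempty_Ioo.2 hab
    refine ⟨μ, hμ, fun r => ψ r / r, ⟨r, Ioo_subset_Icc_self hr,
      div_ne_zero (hpos r hr).ne' (ha.trans hr.1).ne'⟩,
      hψ.contDiffOn.div contDiffOn_id fun s hs => (hsub hs).ne', by simp [hψa], by simp [hψb],
      fun s hs' => ?_⟩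
    exact (hs.mono (Ioo_subset_Icc_self.trans Icc_subset_Ici_self)).radial
      (V := fun r => (2 * m + 1) * Q r ^ (2 * m)) isOpen_Ioo
      (Ioo_subset_Icc_self.trans hsub) hs'
  · have key : ∀ (φ : ℝ → ℝ), (∃ r ∈ Icc a b, φ r ≠ 0) → φ a = 0 → φ b = 0 →
        ∃ r ∈ Ioo a b, r * φ r ≠ 0 := by
      rintro φ ⟨r, hr, hr0⟩ hφa hφb
      refine ⟨r, ⟨hr.1.lt_of_ne ?_, hr.2.lt_of_ne ?_⟩, mul_ne_zero (hsub hr).ne' hr0⟩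
      · rintro rfl
        exact hr0 hφa
      · rintro rfl
        exact hr0 hφb
    rintro μ ν ⟨hμ, φ, hφne, hφ, hφa, hφb, hφode⟩ ⟨hν, χ, hχne, hχ, hχa, hχb, hχode⟩
    rw [← interior_Icc] at hφode hχode
    obtain ⟨h1, h2, h3⟩ := solvesOn_of_radial (V := fun r => (2 * m + 1) * Q r ^ (2 * m))
      (uniqueDiffOn_Icc hab) hsub hφ hφode
    obtain ⟨h4, h5, h6⟩ := solvesOn_of_radial (V := fun r => (2 * m + 1) * Q r ^ (2 * m))
      (uniqueDiffOn_Icc hab) hsub hχ hχode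
    rw [interior_Icc] at h3 h6
    exact h.eigenvalue_unique_Icc hm ha hab hQa hQb hQ hμ hν h3 h6 h1 h2 h4 h5 (by simp [hφa])
      (by simp [hφb]) (by simp [hχa]) (by simp [hχb]) (key φ hφne hφa hφb) (key χ hχne hχa hχb)

theorem existsUnique_eigenvalue_Ici (h : SolvesLaneEmden m Q Q₁) (hm : 2 ≤ m) {a κ : ℝ}
    (ha : 0 < a) (hκ0 : 0 < κ) (hκ : Tendsto (fun r => r * Q r) atTop (𝓝 κ))
    (hκ' : Tendsto (fun r => r ^ 2 * Q₁ r) atTop (𝓝 (-κ)))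
    (hQa : Q a = 0) (hQ : ∀ r ∈ Ioi a, 0 < Q r) :
    ∃! μ : ℝ, μ < 0 ∧ ∃ φ : ℝ → ℝ, (∃ r ∈ Ici a, φ r ≠ 0) ∧ ContDiffOn ℝ 2 φ (Ici a) ∧
      φ a = 0 ∧ IntegrableOn (fun r => φ r ^ 2 * r ^ 2) (Ioi a) ∧
      ∀ r ∈ Ioi a, deriv (deriv φ) r + (2 / r) * deriv φ r
        + (2 * m + 1) * Q r ^ (2 * m) * φ r + μ * φ r = 0 := by
  have hsub : Ici a ⊆ Ioi 0 := Ici_subset_Ioi.2 ha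
  refine existsUnique_of_exists_of_unique ?_ ?_
  · obtain ⟨B, hB⟩ := h.exists_bound_Ici (m := m) ha hκ
    obtain ⟨μ, hμ, ψ, ψ₁, hψ, hs, hψa, hi, hpos⟩ :=
      h.exists_eigenvalue_Ici (by omega) ha hκ0 hκ hQa hQ hB
    have ha1 : a < a + 1 := lt_add_one a
    refine ⟨μ, hμ, fun r => ψ r / r, ⟨a + 1, mem_Ici.2 ha1.le,
      div_ne_zero (hpos _ ha1).ne' (ha.trans ha1).ne'⟩,
      hψ.contDiffOn.div contDiffOn_id fun s hs => (hsub hs).ne', by simp [hψa],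
      hi.congr_fun (fun r hr => ?_) measurableSet_Ioi, fun s hs' => ?_⟩
    · have hr0 : r ≠ 0 := (ha.trans hr).ne'
      field_simp
    · exact (hs.mono Ioi_subset_Ici_self).radial
        (V := fun r => (2 * m + 1) * Q r ^ (2 * m)) isOpen_Ioi
        (Ioi_subset_Ici_self.trans hsub) hs'
  · have key : ∀ (φ : ℝ → ℝ), (∃ r ∈ Ici a, φ r ≠ 0) → φ a = 0 →
        ∃ r ∈ Ioi a, r * φ r ≠ 0 := by
      rintro φ ⟨r, hr, hr0⟩ hφa
      refine ⟨r, (mem_Ici.1 hr).lt_of_ne ?_, mul_ne_zero (hsub hr).ne' hr0⟩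
      rintro rfl
      exact hr0 hφa
    have hsq : ∀ φ : ℝ → ℝ, IntegrableOn (fun r => φ r ^ 2 * r ^ 2) (Ioi a) →
        IntegrableOn (fun r => (r * φ r) ^ 2) (Ioi a) := by
      intro φ hφ
      simpa only [mul_pow, mul_comm] using hφ
    rintro μ ν ⟨hμ, φ, hφne, hφ, hφa, hφi, hφode⟩ ⟨hν, χ, hχne, hχ, hχa, hχi, hχode⟩
    rw [← interior_Ici] at hφode hχode
    obtain ⟨h1, h2, h3⟩ := solvesOn_of_radial (V := fun r => (2 * m + 1) * Q r ^ (2 * m))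
      (uniqueDiffOn_Ici a) hsub hφ hφode
    obtain ⟨h4, h5, h6⟩ := solvesOn_of_radial (V := fun r => (2 * m + 1) * Q r ^ (2 * m))
      (uniqueDiffOn_Ici a) hsub hχ hχode
    rw [interior_Ici] at h3 h6
    exact h.eigenvalue_unique_Ici hm ha hκ0 hκ hκ' hQa hQ hμ hν h3 h6 h1 h2 h4 h5 (by simp [hφa])
      (by simp [hχa]) (hsq φ hφi) (hsq χ hχi) (key φ hφne hφa) (key χ hχne hχa)

end SolvesLaneEmden

lemma forall_pos_or_forall_neg_of_ne_zero {f : ℝ → ℝ} {s : Set ℝ} (hs : IsPreconnected s)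
    (hf : ContinuousOn f s) (h0 : ∀ x ∈ s, f x ≠ 0) :
    (∀ x ∈ s, 0 < f x) ∨ ∀ x ∈ s, f x < 0 := by
  by_contra! hcon
  obtain ⟨⟨x, hx, hx'⟩, y, hy, hy'⟩ := hcon
  obtain ⟨z, hz, hz'⟩ := hs.intermediate_value hx hy hf ⟨hx', hy'⟩
  exact h0 z hz hz'

namespace SolvesLaneEmden

lemma of_contDiffOn {m : ℕ} {Z : ℝ → ℝ} (hZ : ContDiffOn ℝ 2 Z (Ioi 0))
    (hode : ∀ r > (0 : ℝ), deriv (deriv Z) r + (2 / r) * deriv Z r + Z r ^ (2 * m + 1) = 0) :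
    SolvesLaneEmden m Z (deriv Z) := by
  intro r hr
  have hZ' := (contDiffOn_succ_iff_deriv_of_isOpen (n := 1) isOpen_Ioi).1
    (show ContDiffOn ℝ (1 + 1) Z (Ioi 0) by rwa [one_add_one_eq_two])
  have hnhds := isOpen_Ioi.mem_nhds (mem_Ioi.2 hr)
  refine ⟨(hZ'.1.differentiableAt hnhds).hasDerivAt,
    ((hZ'.2.2.differentiableOn (by norm_num)).differentiableAt hnhds).hasDerivAt.congr_deriv ?_⟩
  linarith [hode r hr]

/-- The scaling symmetry of the equation. -/
lemma scale {m : ℕ} {Z Z₁ : ℝ → ℝ} (h : SolvesLaneEmden m Z Z₁) {c l : ℝ} (hl : 0 < l)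
    (hcl : c ^ (2 * m) = l ^ 2) :
    SolvesLaneEmden m (fun r => c * Z (l * r)) (fun r => c * l * Z₁ (l * r)) := by
  intro r hr
  obtain ⟨h1, h2⟩ := h (l * r) (mul_pos hl hr)
  have hlr : HasDerivAt (fun r => l * r) l r := by
    simpa using (hasDerivAt_id r).const_mul l
  refine ⟨((h1.comp r hlr).const_mul c).congr_deriv (by ring),
    ((h2.comp r hlr).const_mul (c * l)).congr_deriv ?_⟩
  rw [mul_pow, pow_succ c, hcl]
  field_simp

end SolvesLaneEmden

/-- on each nodal annulus of $Q_j$ (with Dirichlet boundary conditions)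
the linearized operator $L_j$ has exactly one negative eigenvalue. Here
$γ_{j,i} = r_{j-i}/r_j$. -/
theorem stmt_6
    (m : ℕ) (hm : 2 < m)
    (Z : ℝ → ℝ) (rs : ℕ → ℝ)
    (hZreg : ContDiffOn ℝ 2 Z (Set.Ioi 0))
    (hZode : ∀ r > (0:ℝ), deriv (deriv Z) r + (2 / r) * deriv Z r + Z r ^ (2 * m + 1) = 0)
    (hZdecay : ∃ C > (0:ℝ), ∀ r ≥ (1:ℝ), |r * Z r - 1| ≤ C / r ^ 2)
    (hZderiv : Filter.Tendsto (fun r => r ^ 2 * deriv Z r) Filter.atTop (nhds (-1)))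
    (hrs_pos : ∀ j, 0 < rs j)
    (hrs_anti : StrictAnti rs)
    (hrs_lim : Filter.Tendsto rs Filter.atTop (nhds 0))
    (hrs_zeros : {r : ℝ | 0 < r ∧ Z r = 0} = Set.range rs)
    (Q : ℕ → ℝ → ℝ)
    (hQ : ∀ j r, Q j r = rs j ^ ((1:ℝ) / (m:ℝ)) * Z (rs j * r))
    (j : ℕ) :
    (∀ i, i < j →
      ∃! μ : ℝ, μ < 0 ∧ ∃ φ : ℝ → ℝ,
        (∃ r ∈ Set.Icc (rs (j - i) / rs j) (rs (j - (i + 1)) / rs j), φ r ≠ 0) ∧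
        ContDiffOn ℝ 2 φ (Set.Icc (rs (j - i) / rs j) (rs (j - (i + 1)) / rs j)) ∧
        φ (rs (j - i) / rs j) = 0 ∧ φ (rs (j - (i + 1)) / rs j) = 0 ∧
        (∀ r ∈ Set.Ioo (rs (j - i) / rs j) (rs (j - (i + 1)) / rs j),
          deriv (deriv φ) r + (2 / r) * deriv φ r
            + (2 * m + 1) * Q j r ^ (2 * m) * φ r + μ * φ r = 0))
    ∧
    (∃! μ : ℝ, μ < 0 ∧ ∃ φ : ℝ → ℝ,
        (∃ r ∈ Set.Ici (rs 0 / rs j), φ r ≠ 0) ∧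
        ContDiffOn ℝ 2 φ (Set.Ici (rs 0 / rs j)) ∧
        φ (rs 0 / rs j) = 0 ∧
        MeasureTheory.IntegrableOn (fun r => φ r ^ 2 * r ^ 2) (Set.Ioi (rs 0 / rs j)) ∧
        (∀ r ∈ Set.Ioi (rs 0 / rs j),
          deriv (deriv φ) r + (2 / r) * deriv φ r
            + (2 * m + 1) * Q j r ^ (2 * m) * φ r + μ * φ r = 0)) := by
  have hm0 : m ≠ 0 := by omega
  set l := rs j with hl
  set c := l ^ ((1 : ℝ) / (m : ℝ)) with hc
  have hl0 : 0 < l := hrs_pos j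
  have hc0 : 0 < c := Real.rpow_pos_of_pos hl0 _
  have hcl : c ^ (2 * m) = l ^ 2 := by
    rw [mul_comm, pow_mul, hc, one_div, Real.rpow_inv_natCast_pow hl0.le hm0]
  have hQj : Q j = fun r => c * Z (l * r) := funext (hQ j)
  have hsol := (SolvesLaneEmden.of_contDiffOn hZreg hZode).scale hl0 hcl
  rw [← hQj] at hsol
  have hzero : ∀ r, 0 < r → (Q j r = 0 ↔ ∃ n, rs n / l = r) := by
    intro r hr
    have h1 : (0 < l * r ∧ Z (l * r) = 0) ↔ l * r ∈ range rs := by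
      rw [← hrs_zeros, mem_ofPred_eq]
    simp only [mul_pos hl0 hr, true_and, mem_range] at h1
    rw [hQj]
    simp only [mul_eq_zero, hc0.ne', false_or, h1, div_eq_iff hl0.ne', mul_comm _ l]
  have hzero' : ∀ n, Q j (rs n / l) = 0 := fun n =>
    (hzero _ (div_pos (hrs_pos n) hl0)).2 ⟨n, rfl⟩
  have hlim : Tendsto (fun r => l * r) atTop atTop := tendsto_id.const_mul_atTop hl0
  have hZlim : Tendsto (fun r => r * Z r) atTop (𝓝 1) := by
    obtain ⟨C, -, hC⟩ := hZdecay
    rw [tendsto_iff_dist_tendsto_zero]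
    refine squeeze_zero' (Eventually.of_forall fun _ => dist_nonneg) ?_
      ((tendsto_pow_atTop (two_ne_zero)).const_div_atTop C)
    filter_upwards [eventually_ge_atTop 1] with r hr using hC r hr
  have hκ : Tendsto (fun r => r * Q j r) atTop (𝓝 (c / l)) := by
    have := (hZlim.comp hlim).const_mul (c / l)
    rw [mul_one] at this
    refine this.congr fun r => ?_
    rw [hQj]
    simp only [Function.comp_apply]
    field_simp
  have hκ' : Tendsto (fun r => r ^ 2 * (c * l * deriv Z (l * r))) atTop (𝓝 (-(c / l))) := by
    have := (hZderiv.comp hlim).const_mul (c / l)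
    rw [mul_neg_one] at this
    refine this.congr fun r => ?_
    simp only [Function.comp_apply]
    field_simp
  constructor
  · intro i hi
    obtain ⟨k, hk, hk'⟩ : ∃ k, j - i = k + 1 ∧ j - (i + 1) = k := ⟨j - (i + 1), by omega, rfl⟩
    rw [hk, hk']
    have ha : 0 < rs (k + 1) / l := div_pos (hrs_pos _) hl0
    have hab : rs (k + 1) / l < rs k / l := div_lt_div_of_pos_right (hrs_anti k.lt_succ_self) hl0
    have hne : ∀ r ∈ Ioo (rs (k + 1) / l) (rs k / l), Q j r ≠ 0 := by
      intro r hr h0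
      obtain ⟨n, rfl⟩ := (hzero r (ha.trans hr.1)).1 h0
      have h1 := hrs_anti.lt_iff_gt.1 ((div_lt_div_iff_of_pos_right hl0).1 hr.1)
      have h2 := hrs_anti.lt_iff_gt.1 ((div_lt_div_iff_of_pos_right hl0).1 hr.2)
      omega
    rcases forall_pos_or_forall_neg_of_ne_zero isPreconnected_Ioo
      (hsol.continuousOn.mono fun r hr => ha.trans hr.1) hne with hpos | hneg
    · exact hsol.existsUnique_eigenvalue_Icc hm.le ha hab (hzero' _) (hzero' _) hpos hκ
    · have := hsol.neg.existsUnique_eigenvalue_Icc hm.le ha hab (by simp [hzero'])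
        (by simp [hzero']) (fun r hr => neg_pos.2 (hneg r hr)) (κ := -(c / l))
        (by simpa using hκ.neg)
      simpa only [(even_two_mul m).neg_pow] using this
  · have ha : 0 < rs 0 / l := div_pos (hrs_pos _) hl0
    have hκ0 : 0 < c / l := div_pos hc0 hl0
    have hne : ∀ r ∈ Ioi (rs 0 / l), Q j r ≠ 0 := by
      intro r hr h0
      obtain ⟨n, rfl⟩ := (hzero r (ha.trans hr)).1 h0
      have := hrs_anti.lt_iff_gt.1 ((div_lt_div_iff_of_pos_right hl0).1 hr)
      omega
    refine hsol.existsUnique_eigenvalue_Ici hm.le ha hκ0 hκ hκ' (hzero' 0) ?_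
    refine (forall_pos_or_forall_neg_of_ne_zero isPreconnected_Ioi
      (hsol.continuousOn.mono (Ioi_subset_Ioi ha.le)) hne).resolve_right fun hneg => ?_
    obtain ⟨r, hr1, hr2⟩ :=
      ((hκ.eventually (lt_mem_nhds hκ0)).and (eventually_gt_atTop (rs 0 / l))).exists
    exact (mul_neg_of_pos_of_neg (ha.trans hr2) (hneg r hr2)).not_gt hr1
end

section
/- Fix j ∈ ℕ, set γ_{j,i} = r_{j−i}/r_j for i = 0, 1, …, j, and let I_{j,i} = [γ_{j,i}, γ_{j,i+1}] for 0 ≤ i ≤ j − 1 and I_{j,j} = [γ_{j,j}, ∞). Then for every i ∈ {0, …, j} and every continuously differentiable function f : I_{j,i} → ℝ vanishing at the endpoints of I_{j,i} (and, in the case i = j, with compact support), one has (∫_{I_{j,i}} |f(r)|^{2(m+1)}·r² dr)^{1/(2(m+1))} · (∫_{I_{j,i}} Q_j'(r)²·r² dr)^{1/2} ≤ (∫_{I_{j,i}} |Q_j(r)|^{2(m+1)}·r² dr)^{1/(2(m+1))} · (∫_{I_{j,i}} f'(r)²·r² dr)^{1/2}. -/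
open Set Filter MeasureTheory

/-- The weighted arithmetic-geometric mean inequality with weights `1 / (m + 1)` and
`m / (m + 1)`, in a form free of roots. -/
lemma succ_mul_le_add_mul_of_pow_eq {m : ℕ} {x y z : ℝ} (hx : 0 ≤ x) (hy : 0 ≤ y) (hz : 0 ≤ z)
    (h : z ^ (m + 1) = x * y ^ m) : ((m : ℝ) + 1) * z ≤ x + m * y := by
  rcases hy.eq_or_lt with rfl | hy
  · rcases Nat.eq_zero_or_pos m with rfl | hm
    · simp at h ⊢
      exact h.le
    · have hz0 : z = 0 := by
        rw [zero_pow hm.ne', mul_zero] at h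
        exact pow_eq_zero_iff (Nat.succ_ne_zero m) |>.1 h
      simp [hz0, hx]
  · have hb := one_add_mul_le_pow (a := z / y - 1)
      (by have := div_nonneg hz hy.le; linarith) (m + 1)
    have hpow : (1 + (z / y - 1)) ^ (m + 1) = x / y := by
      rw [add_sub_cancel, div_pow, h, pow_succ]
      field_simp
    rw [hpow] at hb
    push_cast at hb
    have := mul_le_mul_of_nonneg_right hb hy.le
    field_simp at this
    linarith

lemma calibration_bound {m : ℕ} (hm : 2 < m) {κ ρ r q f : ℝ} (hκ : 0 < κ) (hρ : 0 < ρ)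
    (hr : 0 < r) (hq : q ≠ 0) (h : κ ^ m = (ρ / r) ^ (m - 2)) :
    ((m : ℝ) + 1) * (r ^ 2 * f ^ (2 * m + 2)) ≤
      f ^ 2 * (ρ ^ 2 * q ^ (2 * m) + m * (κ * r ^ 3 * f ^ (2 * m + 2) / (ρ * q ^ 2))) := by
  have hf : 0 ≤ f ^ (2 * m + 2) := Even.pow_nonneg ⟨m + 1, by ring⟩ f
  have hf' : 0 ≤ f ^ (2 * m) := Even.pow_nonneg ⟨m, by ring⟩ f
  have hq' : 0 ≤ q ^ (2 * m) := Even.pow_nonneg ⟨m, by ring⟩ q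
  have key := succ_mul_le_add_mul_of_pow_eq (m := m) (x := ρ ^ 2 * q ^ (2 * m))
    (y := κ * r ^ 3 * f ^ (2 * m + 2) / (ρ * q ^ 2)) (z := r ^ 2 * f ^ (2 * m))
    (by positivity) (by positivity) (by positivity) (by
      rw [div_pow, mul_pow, mul_pow, mul_pow κ, h]
      obtain ⟨k, rfl⟩ : ∃ k, m = k + 2 := ⟨m - 2, by omega⟩
      rw [Nat.add_sub_cancel, div_pow]
      field_simp
      ring)
  calc _ = f ^ 2 * (((m : ℝ) + 1) * (r ^ 2 * f ^ (2 * m))) := by ring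
    _ ≤ _ := mul_le_mul_of_nonneg_left key (sq_nonneg f)

/-- A function with positive derivative on `(a, b)` has a differentiable inverse. -/
lemma exists_inverse_of_deriv_pos {M M' : ℝ → ℝ} {a b : ℝ} (hab : a ≤ b)
    (hM : ∀ x ∈ Icc a b, HasDerivAt M (M' x) x) (hM' : ∀ x ∈ Icc a b, 0 < M' x) :
    ∃ g : ℝ → ℝ, ∀ y ∈ Ioo (M a) (M b),
      g y ∈ Ioo a b ∧ M (g y) = y ∧ HasDerivAt g (M' (g y))⁻¹ y := by
  have hcont : ContinuousOn M (Icc a b) := fun x hx => (hM x hx).continuousAt.continuousWithinAt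
  have hmono : StrictMonoOn M (Icc a b) := by
    refine strictMonoOn_of_deriv_pos (convex_Icc a b) hcont fun x hx => ?_
    have hx := interior_subset hx
    rw [(hM x hx).deriv]
    exact hM' x hx
  have hex : ∀ y ∈ Ioo (M a) (M b), ∃ x ∈ Ioo a b, M x = y := fun y hy =>
    intermediate_value_Ioo hab hcont hy
  choose! g hg hMg using hex
  have hgmono : StrictMonoOn g (Ioo (M a) (M b)) := by
    intro y hy z hz hyz
    rw [← hMg y hy, ← hMg z hz] at hyz
    exact (hmono.lt_iff_lt (Ioo_subset_Icc_self (hg y hy)) (Ioo_subset_Icc_self (hg z hz))).1 hyz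
  have himage : g '' Ioo (M a) (M b) = Ioo a b := by
    refine Subset.antisymm (image_subset_iff.2 hg) fun x hx => ?_
    have hx' := Ioo_subset_Icc_self hx
    have hy : M x ∈ Ioo (M a) (M b) :=
      ⟨hmono (left_mem_Icc.2 hab) hx' hx.1, hmono hx' (right_mem_Icc.2 hab) hx.2⟩
    exact ⟨M x, hy, hmono.injOn (Ioo_subset_Icc_self (hg _ hy)) hx' (hMg _ hy)⟩
  refine ⟨g, fun y hy => ⟨hg y hy, hMg y hy, ?_⟩⟩
  have hgy := Ioo_subset_Icc_self (hg y hy)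
  have hgc : ContinuousAt g y := hgmono.continuousAt_of_image_mem_nhds (Ioo_mem_nhds hy.1 hy.2)
    (himage ▸ Ioo_mem_nhds (hg y hy).1 (hg y hy).2)
  exact HasDerivAt.of_local_left_inverse hgc (hM _ hgy) (hM' _ hgy).ne'
    (by filter_upwards [Ioo_mem_nhds hy.1 hy.2] with z hz using hMg z hz)

/-- The Pohozaev functional; along a solution of `q'' + (2 / r) q' + q ^ (2 m + 1) = 0` it is a
primitive of `-r² q ^ (2 m + 2)`. -/
noncomputable def pohozaev (m : ℕ) (q q' : ℝ → ℝ) (r : ℝ) : ℝ :=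
  ((m : ℝ) + 1) / (m - 2) *
    (r ^ 2 * q r * q' r + r ^ 3 * q' r ^ 2 + r ^ 3 * q r ^ (2 * m + 2) / (m + 1))

lemma hasDerivAt_pohozaev {m : ℕ} (hm : 2 < m) {q q' : ℝ → ℝ} {r : ℝ} (hr : 0 < r)
    (hq : HasDerivAt q (q' r) r)
    (hq' : HasDerivAt q' (-(2 / r) * q' r - q r ^ (2 * m + 1)) r) :
    HasDerivAt (pohozaev m q q') (-(r ^ 2 * q r ^ (2 * m + 2))) r := by
  have hm' : (m : ℝ) - 2 ≠ 0 := by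
    have : (2 : ℝ) < m := by exact_mod_cast hm
    linarith
  have h := (((((hasDerivAt_id r).pow 2).mul hq).mul hq').add
    (((hasDerivAt_id r).pow 3).mul (hq'.pow 2))).add
    ((((hasDerivAt_id r).pow 3).mul (hq.pow (2 * m + 2))).div_const ((m : ℝ) + 1))
  refine ((h.const_mul (((m : ℝ) + 1) / (m - 2))).congr_deriv ?_)
  simp
  field_simp
  ring

lemma hasDerivAt_mul_deriv_div {m : ℕ} (hm : 2 < m) {q q' : ℝ → ℝ} {r : ℝ} (hr : 0 < r)
    (hq0 : q r ≠ 0) (hq : HasDerivAt q (q' r) r)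
    (hq' : HasDerivAt q' (-(2 / r) * q' r - q r ^ (2 * m + 1)) r) :
    HasDerivAt (fun s => s * q' s / q s)
      (-((m * r ^ 3 * q r ^ (2 * m + 2) + (m - 2) * pohozaev m q q' r) /
        ((m + 1) * (r ^ 2 * q r ^ 2)))) r := by
  have hm' : (m : ℝ) - 2 ≠ 0 := by
    have : (2 : ℝ) < m := by exact_mod_cast hm
    linarith
  refine (((hasDerivAt_id r).mul hq').div hq hq0).congr_deriv ?_
  simp only [pohozaev, Pi.mul_apply, id]
  field_simp
  ring

/-- The Dirichlet energy dominates the potential energy of every function whose potential energy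
fits strictly between the values of the Pohozaev functional at the endpoints. -/
theorem potential_le_dirichlet {m : ℕ} (hm : 2 < m) {q q' : ℝ → ℝ} {a b : ℝ} (ha : 0 < a)
    (hab : a < b)
    (hq : ∀ r > 0, HasDerivAt q (q' r) r)
    (hq' : ∀ r > 0, HasDerivAt q' (-(2 / r) * q' r - q r ^ (2 * m + 1)) r)
    (hq0 : ∀ r ∈ Ioo a b, q r ≠ 0) (hpos : ∀ r > 0, 0 < pohozaev m q q' r)
    {f g : ℝ → ℝ} (hf : ∀ r, HasDerivAt f (g r) r) (hg : Continuous g)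
    (hfa : f a = 0) (hfb : f b = 0)
    (hN : ∫ r in a..b, r ^ 2 * f r ^ (2 * m + 2) <
      pohozaev m q q' a - pohozaev m q q' b) :
    ∫ r in a..b, r ^ 2 * f r ^ (2 * m + 2) ≤ ∫ r in a..b, r ^ 2 * g r ^ 2 := by
  have hm2 : (2 : ℝ) < m := by exact_mod_cast hm
  have hm' : (0 : ℝ) < m - 2 := by linarith
  have hfc : Continuous f := continuous_iff_continuousAt.2 fun r => (hf r).continuousAt
  have hFc : Continuous fun r => r ^ 2 * f r ^ (2 * m + 2) := by fun_prop
  have hF0 : ∀ r, 0 ≤ r ^ 2 * f r ^ (2 * m + 2) := fun r =>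
    mul_nonneg (sq_nonneg r) (Even.pow_nonneg ⟨m + 1, by ring⟩ _)
  obtain ⟨n₁, hn₁, hn₁'⟩ : ∃ n₁, (∫ r in a..b, r ^ 2 * f r ^ (2 * m + 2)) +
      pohozaev m q q' b < n₁ ∧ n₁ < pohozaev m q q' a := exists_between (by linarith)
  set n : ℝ → ℝ := fun r => n₁ - ∫ s in a..r, s ^ 2 * f s ^ (2 * m + 2) with hn
  have hnd : ∀ r, HasDerivAt n (-(r ^ 2 * f r ^ (2 * m + 2))) r := fun r =>
    ((hFc.integral_hasStrictDerivAt a r).hasDerivAt).const_sub n₁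
  have hna : n a = n₁ := by simp [hn]
  have hnanti : Antitone n := antitone_of_deriv_nonpos (fun r => (hnd r).differentiableAt)
    fun r => by rw [(hnd r).deriv]; linarith [hF0 r]
  have hnb : pohozaev m q q' b < n b := by simp only [hn]; linarith
  have hnpos : ∀ r ≤ b, 0 < n r := fun r hr =>
    (hpos b (ha.trans hab)).trans (hnb.trans_le (hnanti hr))
  have hpol : ∀ (N N' : ℝ → ℝ) (r : ℝ), 0 < r → 0 < N r → HasDerivAt N (-(N' r)) r →
      HasDerivAt (fun s => ((m : ℝ) - 2) * Real.log s - m * Real.log (N s))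
        ((m * r * N' r + (m - 2) * N r) / (r * N r)) r := by
    intro N N' r hr hNr hN'
    refine (((Real.hasDerivAt_log hr.ne').const_mul ((m : ℝ) - 2)).sub
      ((hN'.log hNr.ne').const_mul (m : ℝ))).congr_deriv ?_
    field_simp
    ring
  set M : ℝ → ℝ := fun s => ((m : ℝ) - 2) * Real.log s - m * Real.log (pohozaev m q q' s) with hM
  set Λ : ℝ → ℝ := fun s => ((m : ℝ) - 2) * Real.log s - m * Real.log (n s) with hΛ
  set M' : ℝ → ℝ := fun r => (m * r * (r ^ 2 * q r ^ (2 * m + 2)) +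
    (m - 2) * pohozaev m q q' r) / (r * pohozaev m q q' r) with hM'
  set Λ' : ℝ → ℝ := fun r => (m * r * (r ^ 2 * f r ^ (2 * m + 2)) +
    (m - 2) * n r) / (r * n r) with hΛ'
  have hMd : ∀ r > 0, HasDerivAt M (M' r) r := fun r hr =>
    hpol _ (fun s => s ^ 2 * q s ^ (2 * m + 2)) r hr (hpos r hr) (hasDerivAt_pohozaev hm hr (hq r hr) (hq' r hr))
  have hMpos : ∀ r > 0, 0 < M' r := fun r hr => by
    have := hpos r hr
    have hq2 : 0 ≤ q r ^ (2 * m + 2) := Even.pow_nonneg ⟨m + 1, by ring⟩ _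
    positivity
  have hΛd : ∀ r ∈ Icc a b, HasDerivAt Λ (Λ' r) r := fun r hr =>
    hpol _ (fun s => s ^ 2 * f s ^ (2 * m + 2)) r (ha.trans_le hr.1) (hnpos r hr.2) (hnd r)
  have hΛpos : ∀ r ∈ Icc a b, 0 < Λ' r := fun r hr => by
    have := hnpos r hr.2
    have := hF0 r
    have hr0 := ha.trans_le hr.1
    positivity
  obtain ⟨inv, hinv⟩ := exists_inverse_of_deriv_pos hab.le
    (fun r hr => hMd r (ha.trans_le hr.1)) (fun r hr => hMpos r (ha.trans_le hr.1))
  have hΛmem : ∀ r ∈ Icc a b, Λ r ∈ Ioo (M a) (M b) := by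
    have hmono : MonotoneOn Λ (Icc a b) := by
      refine monotoneOn_of_deriv_nonneg (convex_Icc a b)
        (fun r hr => (hΛd r hr).continuousAt.continuousWithinAt)
        (fun r hr => (hΛd r (interior_subset hr)).differentiableAt.differentiableWithinAt)
        fun r hr => ?_
      rw [(hΛd r (interior_subset hr)).deriv]
      exact (hΛpos r (interior_subset hr)).le
    have hma : M a < Λ a := by
      have := Real.log_lt_log (hnpos a hab.le) (hna.trans_lt hn₁')
      simp only [hM, hΛ]
      gcongr
    have hmb : Λ b < M b := by
      have := Real.log_lt_log (hpos b (ha.trans hab)) hnb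
      simp only [hM, hΛ]
      gcongr
    exact fun r hr => ⟨hma.trans_le (hmono (left_mem_Icc.2 hab.le) hr hr.1),
      (hmono hr (right_mem_Icc.2 hab.le) hr.2).trans_lt hmb⟩
  set ρ : ℝ → ℝ := fun r => inv (Λ r) with hρ
  have hρd : ∀ r ∈ Icc a b, HasDerivAt ρ ((M' (ρ r))⁻¹ * Λ' r) r := fun r hr =>
    (hinv _ (hΛmem r hr)).2.2.comp r (hΛd r hr)
  have hρmem : ∀ r ∈ Icc a b, ρ r ∈ Ioo a b := fun r hr => (hinv _ (hΛmem r hr)).1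
  have hρeq : ∀ r ∈ Icc a b,
      (n r)⁻¹ ^ m * pohozaev m q q' (ρ r) ^ m = (ρ r / r) ^ (m - 2) := by
    intro r hr
    have h := (hinv _ (hΛmem r hr)).2.1
    change M (ρ r) = Λ r at h
    have hr0 := ha.trans_le hr.1
    have hρ0 := ha.trans (hρmem r hr).1
    have hn0 := hnpos r hr.2
    have hp0 := hpos _ hρ0
    rw [← mul_pow]
    refine Real.log_injOn_pos (mem_Ioi.2 (by positivity)) (mem_Ioi.2 (by positivity)) ?_
    rw [Real.log_pow, Real.log_pow, Real.log_mul (by positivity) (by positivity), Real.log_inv,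
      Real.log_div hρ0.ne' hr0.ne', Nat.cast_sub hm.le]
    simp only [hM, hΛ] at h
    push_cast
    linarith
  set Ψ : ℝ → ℝ := fun r => (∫ s in a..r, (s ^ 2 * g s ^ 2 - s ^ 2 * f s ^ (2 * m + 2))) -
    r * (ρ r * q' (ρ r) / q (ρ r)) * f r ^ 2 with hΨ
  have hΨd : ∀ r ∈ Icc a b, ∃ d, 0 ≤ d ∧ HasDerivAt Ψ d r := by
    intro r hr
    have hr0 := ha.trans_le hr.1
    have hρ0 := ha.trans (hρmem r hr).1
    have hn0 := hnpos r hr.2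
    have hp0 := hpos _ hρ0
    have hqρ := hq0 _ (hρmem r hr)
    have hH := (hasDerivAt_mul_deriv_div hm hρ0 hqρ (hq _ hρ0) (hq' _ hρ0)).comp r (hρd r hr)
    have hI := ((show Continuous fun s => s ^ 2 * g s ^ 2 - s ^ 2 * f s ^ (2 * m + 2) by
      fun_prop).integral_hasStrictDerivAt a r).hasDerivAt
    refine ⟨_, ?_, hI.sub (((hasDerivAt_id r).mul hH).mul ((hf r).pow 2))⟩
    have hD : 0 < m * ρ r * (ρ r ^ 2 * q (ρ r) ^ (2 * m + 2)) +
        (m - 2) * pohozaev m q q' (ρ r) := by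
      have hq2 : 0 ≤ q (ρ r) ^ (2 * m + 2) := Even.pow_nonneg ⟨m + 1, by ring⟩ _
      positivity
    have hbound := calibration_bound hm (f := f r) (κ := (n r)⁻¹ * pohozaev m q q' (ρ r))
      (by positivity) hρ0 hr0 hqρ (by rw [mul_pow]; exact hρeq r hr)
    have hHρ : (-((m * ρ r ^ 3 * q (ρ r) ^ (2 * m + 2) + (m - 2) * pohozaev m q q' (ρ r)) /
        ((m + 1) * (ρ r ^ 2 * q (ρ r) ^ 2)))) * ((M' (ρ r))⁻¹ * Λ' r) * r =
        -((m * r ^ 3 * f r ^ (2 * m + 2) + (m - 2) * n r) *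
          ((n r)⁻¹ * pohozaev m q q' (ρ r)) / ((m + 1) * (ρ r * q (ρ r) ^ 2))) := by
      simp only [hM', hΛ']
      have e : m * ρ r ^ 3 * q (ρ r) ^ (2 * m + 2) + (m - 2) * pohozaev m q q' (ρ r) =
        m * ρ r * (ρ r ^ 2 * q (ρ r) ^ (2 * m + 2)) + (m - 2) * pohozaev m q q' (ρ r) := by ring
      rw [e]
      set D := m * ρ r * (ρ r ^ 2 * q (ρ r) ^ (2 * m + 2)) + (m - 2) * pohozaev m q q' (ρ r)
      field_simp
    set H := ρ r * q' (ρ r) / q (ρ r) with hHdef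
    have hHH : H + H ^ 2 = (m - 2) * pohozaev m q q' (ρ r) / ((m + 1) * (ρ r * q (ρ r) ^ 2)) -
        ρ r ^ 2 * q (ρ r) ^ (2 * m) / (m + 1) := by
      simp only [hHdef, pohozaev]
      field_simp
      ring
    have hS : (m * r ^ 3 * f r ^ (2 * m + 2) + (m - 2) * n r) *
          ((n r)⁻¹ * pohozaev m q q' (ρ r)) / ((m + 1) * (ρ r * q (ρ r) ^ 2)) - (H + H ^ 2) =
        (ρ r ^ 2 * q (ρ r) ^ (2 * m) + m * ((n r)⁻¹ * pohozaev m q q' (ρ r) * r ^ 3 *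
          f r ^ (2 * m + 2) / (ρ r * q (ρ r) ^ 2))) / (m + 1) := by
      rw [hHH]
      field_simp
      ring
    have hbound' : r ^ 2 * f r ^ (2 * m + 2) ≤ f r ^ 2 *
        ((m * r ^ 3 * f r ^ (2 * m + 2) + (m - 2) * n r) *
          ((n r)⁻¹ * pohozaev m q q' (ρ r)) / ((m + 1) * (ρ r * q (ρ r) ^ 2)) -
            (H + H ^ 2)) := by
      rw [hS, ← mul_div_assoc, le_div_iff₀ (by positivity)]
      linarith
    simp only [Pi.mul_apply, Function.comp_apply, id, ← hHdef]
    have hsq := sq_nonneg (r * g r - H * f r)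
    linear_combination hsq + hbound' + f r ^ 2 * hHρ
  have hmono : MonotoneOn Ψ (Icc a b) := by
    refine monotoneOn_of_deriv_nonneg (convex_Icc a b) (fun r hr => ?_) (fun r hr => ?_)
      fun r hr => ?_
    · obtain ⟨d, -, hd⟩ := hΨd r hr
      exact hd.continuousAt.continuousWithinAt
    · obtain ⟨d, -, hd⟩ := hΨd r (interior_subset hr)
      exact hd.differentiableAt.differentiableWithinAt
    · obtain ⟨d, hd0, hd⟩ := hΨd r (interior_subset hr)
      rwa [hd.deriv]
  have hle := hmono (left_mem_Icc.2 hab.le) (right_mem_Icc.2 hab.le) hab.le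
  simp only [hΨ, hfa, hfb, intervalIntegral.integral_same] at hle
  rw [intervalIntegral.integral_sub (Continuous.intervalIntegrable (by fun_prop) _ _)
    (hFc.intervalIntegrable _ _)] at hle
  linarith

/-- A function that is `C¹` on a compact interval agrees there with a globally `C¹` function. -/
lemma exists_extension_of_contDiffOn_Icc {f : ℝ → ℝ} {a b : ℝ} (hab : a < b)
    (hf : ContDiffOn ℝ 1 f (Icc a b)) :
    ∃ F g : ℝ → ℝ, (∀ r, HasDerivAt F (g r) r) ∧ Continuous g ∧ EqOn F f (Icc a b) ∧
      EqOn g (deriv f) (Ioo a b) := by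
  have hc := hf.continuousOn_derivWithin (uniqueDiffOn_Icc hab) le_rfl
  set g := IccExtend hab.le ((Icc a b).domRestrict (derivWithin f (Icc a b))) with hg
  have hgc : Continuous g := (continuousOn_iff_continuous_domRestrict.1 hc).Icc_extend'
  have hge : EqOn g (deriv f) (Ioo a b) := fun r hr => by
    rw [hg, IccExtend_of_mem _ _ (Ioo_subset_Icc_self hr), domRestrict_apply]
    exact derivWithin_of_mem_nhds (Icc_mem_nhds hr.1 hr.2)
  refine ⟨fun r => f a + ∫ s in a..r, g s, g,
    fun r => (hgc.integral_hasStrictDerivAt a r).hasDerivAt.const_add _, hgc, fun r hr => ?_, hge⟩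
  have hsub : Icc a r ⊆ Icc a b := Icc_subset_Icc_right hr.2
  have := intervalIntegral.integral_eq_sub_of_hasDerivAt_of_le hr.1
    (hf.continuousOn.mono hsub) (f' := g) (fun x hx => ?_) (hgc.intervalIntegrable _ _)
  · simp only [this]
    ring
  · have hx' : x ∈ Ioo a b := ⟨hx.1, hx.2.trans_le hr.2⟩
    rw [hge hx']
    exact ((hf.differentiableOn one_ne_zero).differentiableAt
      (Icc_mem_nhds hx'.1 hx'.2)).hasDerivAt

theorem potential_le_dirichlet_of_contDiffOn {m : ℕ} (hm : 2 < m) {q q' : ℝ → ℝ} {a b : ℝ}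
    (ha : 0 < a) (hab : a < b)
    (hq : ∀ r > 0, HasDerivAt q (q' r) r)
    (hq' : ∀ r > 0, HasDerivAt q' (-(2 / r) * q' r - q r ^ (2 * m + 1)) r)
    (hq0 : ∀ r ∈ Ioo a b, q r ≠ 0) (hpos : ∀ r > 0, 0 < pohozaev m q q' r)
    {f : ℝ → ℝ} (hf : ContDiffOn ℝ 1 f (Icc a b)) (hfa : f a = 0) (hfb : f b = 0)
    (hN : ∫ r in a..b, |f r| ^ (2 * (m + 1)) * r ^ 2 <
      pohozaev m q q' a - pohozaev m q q' b) :
    ∫ r in a..b, |f r| ^ (2 * (m + 1)) * r ^ 2 ≤ ∫ r in a..b, deriv f r ^ 2 * r ^ 2 := by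
  obtain ⟨F, g, hF, hg, hFf, hgf⟩ := exists_extension_of_contDiffOn_Icc hab hf
  have e₁ : ∫ r in a..b, |f r| ^ (2 * (m + 1)) * r ^ 2 =
      ∫ r in a..b, r ^ 2 * F r ^ (2 * m + 2) := by
    refine intervalIntegral.integral_congr fun r hr => ?_
    rw [uIcc_of_le hab.le] at hr
    simp only [hFf hr]
    rw [Even.pow_abs ⟨m + 1, by ring⟩, mul_comm, mul_add_one]
  have e₂ : ∫ r in a..b, deriv f r ^ 2 * r ^ 2 = ∫ r in a..b, r ^ 2 * g r ^ 2 := by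
    rw [intervalIntegral.integral_of_le hab.le, intervalIntegral.integral_of_le hab.le,
      integral_Ioc_eq_integral_Ioo, integral_Ioc_eq_integral_Ioo]
    refine setIntegral_congr_fun measurableSet_Ioo fun r hr => ?_
    simp only [hgf hr, mul_comm]
  rw [e₁] at hN ⊢
  rw [e₂]
  exact potential_le_dirichlet hm ha hab hq hq' hq0 hpos hF hg
    ((hFf (left_mem_Icc.2 hab.le)).trans hfa) ((hFf (right_mem_Icc.2 hab.le)).trans hfb) hN

/-- Passage from a normalised inequality to its homogeneous form. -/
lemma rpow_mul_sqrt_le_of_forall_scaling {m : ℕ} {N M E : ℝ} (hN : 0 ≤ N) (hM : 0 ≤ M)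
    (h : ∀ t > 0, t ^ (2 * (m + 1)) * N < M → t ^ (2 * (m + 1)) * N ≤ t ^ 2 * E) :
    N ^ ((1 : ℝ) / (2 * ((m : ℝ) + 1))) * √M ≤ M ^ ((1 : ℝ) / (2 * ((m : ℝ) + 1))) * √E := by
  have hα : (0 : ℝ) < 1 / (2 * ((m : ℝ) + 1)) := by positivity
  rcases hN.eq_or_lt with rfl | hN
  · rw [Real.zero_rpow hα.ne', zero_mul]
    positivity
  rcases hM.eq_or_lt with rfl | hM
  · rw [Real.zero_rpow hα.ne']
    simp
  set T := (M / N) ^ ((1 : ℝ) / (2 * ((m : ℝ) + 1))) with hT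
  have hT0 : 0 < T := by positivity
  have hTpow : T ^ (2 * (m + 1)) = M / N := by
    rw [hT, one_div]
    have := Real.rpow_inv_natCast_pow (x := M / N) (n := 2 * (m + 1)) (by positivity) (by omega)
    push_cast at this
    exact this
  have hMT : M = (T ^ (m + 1)) ^ 2 * N := by
    rw [← pow_mul, mul_comm (m + 1), hTpow]
    field_simp
  have hTE : (T ^ m) ^ 2 * N ≤ E := by
    have hlim : Tendsto (fun t : ℝ => (t ^ m) ^ 2 * N) (nhdsWithin T (Iio T))
        (nhds ((T ^ m) ^ 2 * N)) :=
      (by fun_prop : Continuous fun t : ℝ => (t ^ m) ^ 2 * N).continuousAt.mono_left inf_le_left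
    refine le_of_tendsto hlim ?_
    filter_upwards [Ioo_mem_nhdsLT hT0] with t ht
    have hlt : t ^ (2 * (m + 1)) * N < M := by
      rw [← lt_div_iff₀ hN, ← hTpow]
      exact pow_lt_pow_left₀ ht.2 ht.1.le (by omega)
    have := h t ht.1 hlt
    have ht2 : 0 < t ^ 2 := pow_pos ht.1 2
    refine le_of_mul_le_mul_left (le_trans (le_of_eq ?_) this) ht2
    ring
  have hMα : M ^ ((1 : ℝ) / (2 * ((m : ℝ) + 1))) = T * N ^ ((1 : ℝ) / (2 * ((m : ℝ) + 1))) := by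
    rw [hT, ← Real.mul_rpow (by positivity) hN.le, div_mul_cancel₀ _ hN.ne']
  have hsE : T ^ m * √N ≤ √E := by
    refine le_trans (le_of_eq ?_) (Real.sqrt_le_sqrt hTE)
    rw [Real.sqrt_mul (by positivity), Real.sqrt_sq (by positivity)]
  have hsM : √M = T ^ (m + 1) * √N := by
    rw [hMT, Real.sqrt_mul (by positivity), Real.sqrt_sq (by positivity)]
  rw [hMα, hsM]
  calc _ = T * N ^ ((1 : ℝ) / (2 * ((m : ℝ) + 1))) * (T ^ m * √N) := by ring
    _ ≤ _ := by gcongr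

lemma tendsto_pohozaev_atTop {m : ℕ} (hm : 2 < m) {q q' : ℝ → ℝ} {A B : ℝ}
    (hq : Tendsto (fun r => r * q r) atTop (nhds A))
    (hq' : Tendsto (fun r => r ^ 2 * q' r) atTop (nhds B)) :
    Tendsto (pohozaev m q q') atTop (nhds 0) := by
  have hinv : Tendsto (fun r : ℝ => r⁻¹) atTop (nhds 0) := tendsto_inv_atTop_zero
  have h := ((((hq.mul hq').mul hinv).add ((hq'.pow 2).mul hinv)).add
    (((hq.pow (2 * m + 2)).mul (hinv.pow (2 * m - 1))).div_const ((m : ℝ) + 1))).const_mul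
      (((m : ℝ) + 1) / (m - 2))
  rw [zero_pow (by omega)] at h
  simp only [mul_zero, add_zero, zero_div] at h
  refine h.congr' ?_
  filter_upwards [eventually_gt_atTop 0] with r hr
  have e : 2 * m + 2 = (2 * m - 1) + 3 := by omega
  have e' : (r * q r) ^ (2 * m + 2) * r⁻¹ ^ (2 * m - 1) = r ^ 3 * q r ^ (2 * m + 2) := by
    rw [mul_pow, e, pow_add r, inv_pow]
    field_simp
  rw [e', pohozaev]
  field_simp

lemma antitoneOn_pohozaev {m : ℕ} (hm : 2 < m) {q q' : ℝ → ℝ}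
    (hq : ∀ r > 0, HasDerivAt q (q' r) r)
    (hq' : ∀ r > 0, HasDerivAt q' (-(2 / r) * q' r - q r ^ (2 * m + 1)) r) :
    AntitoneOn (pohozaev m q q') (Ioi 0) := by
  have hd : ∀ r > 0, HasDerivAt (pohozaev m q q') (-(r ^ 2 * q r ^ (2 * m + 2))) r :=
    fun r hr => hasDerivAt_pohozaev hm hr (hq r hr) (hq' r hr)
  refine antitoneOn_of_deriv_nonpos (convex_Ioi 0)
    (fun r hr => (hd r hr).continuousAt.continuousWithinAt)
    (fun r hr => (hd r (interior_subset hr)).differentiableAt.differentiableWithinAt)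
    fun r hr => ?_
  rw [(hd r (interior_subset hr)).deriv, neg_nonpos]
  exact mul_nonneg (sq_nonneg r) (Even.pow_nonneg ⟨m + 1, by ring⟩ _)

lemma pohozaev_pos {m : ℕ} (hm : 2 < m) {q q' : ℝ → ℝ} {R : ℝ} (hR : 0 < R)
    (hq : ∀ r > 0, HasDerivAt q (q' r) r)
    (hq' : ∀ r > 0, HasDerivAt q' (-(2 / r) * q' r - q r ^ (2 * m + 1)) r)
    (hq0 : ∀ r > R, q r ≠ 0) (hlim : Tendsto (pohozaev m q q') atTop (nhds 0)) :
    ∀ r > 0, 0 < pohozaev m q q' r := by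
  have hanti := antitoneOn_pohozaev hm hq hq'
  have hnonneg : ∀ r > 0, 0 ≤ pohozaev m q q' r := fun r hr => by
    refine le_of_tendsto hlim ?_
    filter_upwards [eventually_ge_atTop r] with s hs
    exact hanti hr (hr.trans_le hs : 0 < s) hs
  have hstrict : StrictAntiOn (pohozaev m q q') (Ici R) := by
    have hd : ∀ r ∈ Ici R,
        HasDerivAt (pohozaev m q q') (-(r ^ 2 * q r ^ (2 * m + 2))) r := fun r hr =>
      hasDerivAt_pohozaev hm (hR.trans_le hr) (hq r (hR.trans_le hr)) (hq' r (hR.trans_le hr))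
    refine strictAntiOn_of_deriv_neg (convex_Ici R)
      (fun r hr => (hd r hr).continuousAt.continuousWithinAt) fun r hr => ?_
    rw [interior_Ici] at hr
    rw [(hd r (Ioi_subset_Ici_self hr)).deriv, neg_lt_zero]
    have := hq0 r hr
    have hr0 : 0 < r := hR.trans hr
    have : 0 < q r ^ (2 * m + 2) := Even.pow_pos ⟨m + 1, by ring⟩ this
    positivity
  intro r hr
  have h₁ : max r R + 1 > max r R := lt_add_one _
  exact (hnonneg _ (by positivity)).trans_lt ((hstrict (le_max_right r R)
    ((le_max_right r R).trans h₁.le) h₁).trans_le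
      (hanti hr (lt_max_of_lt_left hr) (le_max_left _ _)))

/-- A primitive of the Dirichlet energy density along a solution. -/
lemma hasDerivAt_sq_mul_mul_sub_pohozaev {m : ℕ} (hm : 2 < m) {q q' : ℝ → ℝ} {r : ℝ}
    (hr : 0 < r) (hq : HasDerivAt q (q' r) r)
    (hq' : HasDerivAt q' (-(2 / r) * q' r - q r ^ (2 * m + 1)) r) :
    HasDerivAt (fun s => s ^ 2 * q s * q' s - pohozaev m q q' s) (q' r ^ 2 * r ^ 2) r := by
  refine (((((hasDerivAt_id r).pow 2).mul hq).mul hq').sub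
    (hasDerivAt_pohozaev hm hr hq hq')).congr_deriv ?_
  simp
  field_simp
  ring

/-- The quotient inequality on a bounded nodal annulus. -/
theorem gagliardoNirenberg_Icc {m : ℕ} (hm : 2 < m) {q q' : ℝ → ℝ} {a b : ℝ} (ha : 0 < a)
    (hab : a < b)
    (hq : ∀ r > 0, HasDerivAt q (q' r) r)
    (hq' : ∀ r > 0, HasDerivAt q' (-(2 / r) * q' r - q r ^ (2 * m + 1)) r)
    (hq0 : ∀ r ∈ Ioo a b, q r ≠ 0) (hpos : ∀ r > 0, 0 < pohozaev m q q' r)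
    (hqa : q a = 0) (hqb : q b = 0)
    {f : ℝ → ℝ} (hf : ContDiffOn ℝ 1 f (Icc a b)) (hfa : f a = 0) (hfb : f b = 0) :
    (∫ r in a..b, |f r| ^ (2 * (m + 1)) * r ^ 2) ^ ((1 : ℝ) / (2 * ((m : ℝ) + 1))) *
        √(∫ r in a..b, q' r ^ 2 * r ^ 2) ≤
      (∫ r in a..b, |q r| ^ (2 * (m + 1)) * r ^ 2) ^ ((1 : ℝ) / (2 * ((m : ℝ) + 1))) *
        √(∫ r in a..b, deriv f r ^ 2 * r ^ 2) := by
  have hr0 : ∀ r ∈ uIcc a b, 0 < r := fun r hr => by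
    rw [uIcc_of_le hab.le] at hr
    exact ha.trans_le hr.1
  have hqc : ContinuousOn q (uIcc a b) := fun r hr =>
    (hq r (hr0 r hr)).continuousAt.continuousWithinAt
  have hqc' : ContinuousOn q' (uIcc a b) := fun r hr =>
    (hq' r (hr0 r hr)).continuousAt.continuousWithinAt
  have hNq : ∫ r in a..b, |q r| ^ (2 * (m + 1)) * r ^ 2 =
      pohozaev m q q' a - pohozaev m q q' b := by
    have := intervalIntegral.integral_eq_sub_of_hasDerivAt (a := a) (b := b) (fun r hr =>
      (hasDerivAt_pohozaev hm (hr0 r hr) (hq r (hr0 r hr)) (hq' r (hr0 r hr))).fun_neg)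
      (ContinuousOn.intervalIntegrable (by fun_prop))
    rw [← neg_sub_neg, ← this]
    refine intervalIntegral.integral_congr fun r _ => ?_
    simp only [neg_neg]
    rw [Even.pow_abs ⟨m + 1, by ring⟩, mul_comm, mul_add_one]
  have hEq : ∫ r in a..b, q' r ^ 2 * r ^ 2 = pohozaev m q q' a - pohozaev m q q' b := by
    rw [intervalIntegral.integral_eq_sub_of_hasDerivAt (fun r hr =>
      hasDerivAt_sq_mul_mul_sub_pohozaev hm (hr0 r hr) (hq r (hr0 r hr)) (hq' r (hr0 r hr)))
      (ContinuousOn.intervalIntegrable (by fun_prop))]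
    simp only [hqa, hqb]
    ring
  have hN0 : ∀ h : ℝ → ℝ, 0 ≤ ∫ r in a..b, |h r| ^ (2 * (m + 1)) * r ^ 2 := fun h =>
    intervalIntegral.integral_nonneg hab.le fun r _ => by positivity
  rw [hEq, ← hNq]
  refine rpow_mul_sqrt_le_of_forall_scaling (hN0 f) (hN0 q) fun t ht hlt => ?_
  have e₁ : ∫ r in a..b, |t * f r| ^ (2 * (m + 1)) * r ^ 2 =
      t ^ (2 * (m + 1)) * ∫ r in a..b, |f r| ^ (2 * (m + 1)) * r ^ 2 := by
    rw [← intervalIntegral.integral_const_mul]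
    simp only [abs_mul, mul_pow, abs_of_pos ht, mul_assoc]
  have e₂ : ∫ r in a..b, deriv (fun s => t * f s) r ^ 2 * r ^ 2 =
      t ^ 2 * ∫ r in a..b, deriv f r ^ 2 * r ^ 2 := by
    rw [← intervalIntegral.integral_const_mul]
    simp only [deriv_const_mul_field, mul_pow, mul_assoc]
  rw [← e₁, ← e₂]
  refine potential_le_dirichlet_of_contDiffOn hm ha hab hq hq' hq0 hpos
    (contDiffOn_const.mul hf) (by simp [hfa]) (by simp [hfb]) ?_
  rwa [e₁, ← hNq]

/-- The quotient inequality on the unbounded nodal annulus. -/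
theorem gagliardoNirenberg_Ici {m : ℕ} (hm : 2 < m) {q q' : ℝ → ℝ} {a A B : ℝ} (ha : 0 < a)
    (hq : ∀ r > 0, HasDerivAt q (q' r) r)
    (hq' : ∀ r > 0, HasDerivAt q' (-(2 / r) * q' r - q r ^ (2 * m + 1)) r)
    (hq0 : ∀ r > a, q r ≠ 0) (hpos : ∀ r > 0, 0 < pohozaev m q q' r)
    (hqA : Tendsto (fun r => r * q r) atTop (nhds A))
    (hqB : Tendsto (fun r => r ^ 2 * q' r) atTop (nhds B))
    (hqa : q a = 0)
    {f : ℝ → ℝ} (hf : ContDiffOn ℝ 1 f (Ici a)) (hfa : f a = 0) (hfs : HasCompactSupport f) :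
    (∫ r in Ioi a, |f r| ^ (2 * (m + 1)) * r ^ 2) ^ ((1 : ℝ) / (2 * ((m : ℝ) + 1))) *
        √(∫ r in Ioi a, q' r ^ 2 * r ^ 2) ≤
      (∫ r in Ioi a, |q r| ^ (2 * (m + 1)) * r ^ 2) ^ ((1 : ℝ) / (2 * ((m : ℝ) + 1))) *
        √(∫ r in Ioi a, deriv f r ^ 2 * r ^ 2) := by
  have hlim := tendsto_pohozaev_atTop hm hqA hqB
  have hNq : ∫ r in Ioi a, |q r| ^ (2 * (m + 1)) * r ^ 2 = pohozaev m q q' a := by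
    have := integral_Ioi_of_hasDerivAt_of_nonneg (a := a) (l := -0)
      (hasDerivAt_pohozaev hm ha (hq a ha) (hq' a ha)).fun_neg.continuousAt.continuousWithinAt
      (fun r hr => (hasDerivAt_pohozaev hm (ha.trans hr) (hq r (ha.trans hr))
        (hq' r (ha.trans hr))).fun_neg)
      (fun r _ => by
        rw [neg_neg]
        exact mul_nonneg (sq_nonneg r) (Even.pow_nonneg ⟨m + 1, by ring⟩ _)) hlim.neg
    rw [neg_zero, zero_sub, neg_neg] at this
    rw [← this]
    refine setIntegral_congr_fun measurableSet_Ioi fun r _ => ?_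
    simp only [neg_neg]
    rw [Even.pow_abs ⟨m + 1, by ring⟩, mul_comm, mul_add_one]
  have hEq : ∫ r in Ioi a, q' r ^ 2 * r ^ 2 = pohozaev m q q' a := by
    have hlim' : Tendsto (fun r => r ^ 2 * q r * q' r - pohozaev m q q' r) atTop (nhds 0) := by
      have h := ((hqA.mul hqB).mul tendsto_inv_atTop_zero).sub hlim
      rw [mul_zero, sub_zero] at h
      refine h.congr' ?_
      filter_upwards [eventually_gt_atTop 0] with r hr
      field_simp
    rw [integral_Ioi_of_hasDerivAt_of_nonneg
      (hasDerivAt_sq_mul_mul_sub_pohozaev hm ha (hq a ha)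
        (hq' a ha)).continuousAt.continuousWithinAt
      (fun r hr => hasDerivAt_sq_mul_mul_sub_pohozaev hm (ha.trans hr) (hq r (ha.trans hr))
        (hq' r (ha.trans hr))) (fun r _ => by positivity) hlim']
    simp [hqa]
  have hN0 : ∀ h : ℝ → ℝ, 0 ≤ ∫ r in Ioi a, |h r| ^ (2 * (m + 1)) * r ^ 2 := fun h =>
    setIntegral_nonneg measurableSet_Ioi fun r _ => by positivity
  rw [hEq, ← hNq]
  refine rpow_mul_sqrt_le_of_forall_scaling (hN0 f) (hN0 q) fun t ht hlt => ?_
  obtain ⟨R₀, hR₀⟩ : ∃ R₀, ∀ r ≥ R₀, f r = 0 := by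
    obtain ⟨S, hS⟩ := hfs.isCompact.bddAbove
    refine ⟨S + 1, fun r hr => ?_⟩
    by_contra hne
    have := hS (subset_tsupport f hne)
    linarith
  have hev : ∀ᶠ R in atTop, pohozaev m q q' R <
      pohozaev m q q' a - t ^ (2 * (m + 1)) * ∫ r in Ioi a, |f r| ^ (2 * (m + 1)) * r ^ 2 :=
    hlim.eventually_lt_const (by linarith)
  obtain ⟨b, hb, hab, hRb⟩ :=
    (hev.and ((eventually_gt_atTop a).and (eventually_ge_atTop R₀))).exists
  have hrestrict : ∀ h : ℝ → ℝ, (∀ r > b, h r = 0) →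
      ∫ r in Ioi a, h r = ∫ r in a..b, h r := fun h hh => by
    rw [intervalIntegral.integral_of_le hab.le]
    refine setIntegral_eq_of_subset_of_forall_sdiff_eq_zero measurableSet_Ioi
      Ioc_subset_Ioi_self fun r hr => hh r ?_
    by_contra hle
    exact hr.2 ⟨hr.1, not_lt.1 hle⟩
  have hfb : ∀ r > b, f r = 0 := fun r hr => hR₀ r (hRb.trans hr.le)
  have hdfb : ∀ r > b, deriv f r = 0 := fun r hr => by
    have : f =ᶠ[nhds r] fun _ => 0 := by
      filter_upwards [Ioi_mem_nhds hr] with s hs using hfb s hs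
    rw [this.deriv_eq, deriv_const]
  have e₁ : ∫ r in a..b, |t * f r| ^ (2 * (m + 1)) * r ^ 2 =
      t ^ (2 * (m + 1)) * ∫ r in Ioi a, |f r| ^ (2 * (m + 1)) * r ^ 2 := by
    rw [hrestrict _ fun r hr => by simp [hfb r hr], ← intervalIntegral.integral_const_mul]
    simp only [abs_mul, mul_pow, abs_of_pos ht, mul_assoc]
  have e₂ : ∫ r in a..b, deriv (fun s => t * f s) r ^ 2 * r ^ 2 =
      t ^ 2 * ∫ r in Ioi a, deriv f r ^ 2 * r ^ 2 := by
    rw [hrestrict _ fun r hr => by simp [hdfb r hr], ← intervalIntegral.integral_const_mul]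
    simp only [deriv_const_mul_field, mul_pow, mul_assoc]
  rw [← e₁, ← e₂]
  refine potential_le_dirichlet_of_contDiffOn hm ha hab hq hq' (fun r hr => hq0 r hr.1) hpos
    (contDiffOn_const.mul (hf.mono Icc_subset_Ici_self)) (by simp [hfa])
    (by simp [hR₀ b hRb]) ?_
  rw [e₁]
  linarith

/-- $Q_j$ maximizes the Gagliardo–Nirenberg-type quotient on each of
its nodal annuli $I_{j,i}$, $γ_{j,i} = r_{j-i}/r_j$. -/
theorem stmt_7
    (m : ℕ) (hm : 2 < m)
    (Z : ℝ → ℝ) (rs : ℕ → ℝ)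
    (hZreg : ContDiffOn ℝ 2 Z (Set.Ioi 0))
    (hZode : ∀ r > (0:ℝ), deriv (deriv Z) r + (2 / r) * deriv Z r + Z r ^ (2 * m + 1) = 0)
    (hZdecay : ∃ C > (0:ℝ), ∀ r ≥ (1:ℝ), |r * Z r - 1| ≤ C / r ^ 2)
    (hZderiv : Filter.Tendsto (fun r => r ^ 2 * deriv Z r) Filter.atTop (nhds (-1)))
    (hrs_pos : ∀ j, 0 < rs j)
    (hrs_anti : StrictAnti rs)
    (hrs_lim : Filter.Tendsto rs Filter.atTop (nhds 0))
    (hrs_zeros : {r : ℝ | 0 < r ∧ Z r = 0} = Set.range rs)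
    (Q : ℕ → ℝ → ℝ)
    (hQ : ∀ j r, Q j r = rs j ^ ((1:ℝ) / (m:ℝ)) * Z (rs j * r))
    (j : ℕ) :
    (∀ i, i < j → ∀ f : ℝ → ℝ,
      ContDiffOn ℝ 1 f (Set.Icc (rs (j - i) / rs j) (rs (j - (i + 1)) / rs j)) →
      f (rs (j - i) / rs j) = 0 → f (rs (j - (i + 1)) / rs j) = 0 →
      (∫ r in (rs (j - i) / rs j)..(rs (j - (i + 1)) / rs j),
          |f r| ^ (2 * (m + 1)) * r ^ 2) ^ ((1:ℝ) / (2 * ((m:ℝ) + 1)))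
        * Real.sqrt (∫ r in (rs (j - i) / rs j)..(rs (j - (i + 1)) / rs j),
            (deriv (Q j) r) ^ 2 * r ^ 2)
      ≤ (∫ r in (rs (j - i) / rs j)..(rs (j - (i + 1)) / rs j),
          |Q j r| ^ (2 * (m + 1)) * r ^ 2) ^ ((1:ℝ) / (2 * ((m:ℝ) + 1)))
        * Real.sqrt (∫ r in (rs (j - i) / rs j)..(rs (j - (i + 1)) / rs j),
            (deriv f r) ^ 2 * r ^ 2))
    ∧
    (∀ f : ℝ → ℝ,
      ContDiffOn ℝ 1 f (Set.Ici (rs 0 / rs j)) →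
      f (rs 0 / rs j) = 0 → HasCompactSupport f →
      (∫ r in Set.Ioi (rs 0 / rs j),
          |f r| ^ (2 * (m + 1)) * r ^ 2) ^ ((1:ℝ) / (2 * ((m:ℝ) + 1)))
        * Real.sqrt (∫ r in Set.Ioi (rs 0 / rs j), (deriv (Q j) r) ^ 2 * r ^ 2)
      ≤ (∫ r in Set.Ioi (rs 0 / rs j),
          |Q j r| ^ (2 * (m + 1)) * r ^ 2) ^ ((1:ℝ) / (2 * ((m:ℝ) + 1)))
        * Real.sqrt (∫ r in Set.Ioi (rs 0 / rs j), (deriv f r) ^ 2 * r ^ 2)) := by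
  set σ := rs j
  have hσ : 0 < σ := hrs_pos j
  set μ := σ ^ ((1 : ℝ) / (m : ℝ)) with hμdef
  have hμ : 0 < μ := Real.rpow_pos_of_pos hσ _
  have hμσ : μ ^ (2 * m) = σ ^ 2 := by
    rw [mul_comm, pow_mul, hμdef, one_div, Real.rpow_inv_natCast_pow hσ.le (by omega)]
  have hQr : ∀ r, Q j r = μ * Z (σ * r) := hQ j
  have hQj : Q j = fun r => μ * Z (σ * r) := funext hQr
  have hZ : ∀ r > 0, HasDerivAt Z (deriv Z r) r := fun r hr =>
    ((hZreg.differentiableOn two_ne_zero).differentiableAt (Ioi_mem_nhds hr)).hasDerivAt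
  have hZ' : ∀ r > 0, HasDerivAt (deriv Z) (deriv (deriv Z) r) r := fun r hr =>
    ((((contDiffOn_succ_iff_deriv_of_isOpen (n := 1) isOpen_Ioi).1
      (by simpa [one_add_one_eq_two] using hZreg)).2.2.differentiableOn
        one_ne_zero).differentiableAt (Ioi_mem_nhds hr)).hasDerivAt
  have hmul : ∀ r, HasDerivAt (fun s => σ * s) σ r := fun r => by
    simpa using (hasDerivAt_id r).const_mul σ
  have hqd : ∀ r > 0, HasDerivAt (Q j) (μ * (deriv Z (σ * r) * σ)) r := fun r hr => by
    rw [hQj]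
    exact ((hZ _ (mul_pos hσ hr)).comp r (hmul r)).const_mul μ
  have hq : ∀ r > 0, HasDerivAt (Q j) (deriv (Q j) r) r := fun r hr =>
    (hqd r hr).differentiableAt.hasDerivAt
  have hq' : ∀ r > 0,
      HasDerivAt (deriv (Q j)) (-(2 / r) * deriv (Q j) r - Q j r ^ (2 * m + 1)) r := by
    intro r hr
    have h := (((hZ' _ (mul_pos hσ hr)).comp r (hmul r)).mul_const σ).const_mul μ
    refine (h.congr_of_eventuallyEq ?_).congr_deriv ?_
    · filter_upwards [Ioi_mem_nhds hr] with s hs using (hqd s hs).deriv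
    · have hode := hZode (σ * r) (mul_pos hσ hr)
      have hZ2 : deriv (deriv Z) (σ * r) =
          -(2 / (σ * r)) * deriv Z (σ * r) - Z (σ * r) ^ (2 * m + 1) := by linarith
      rw [(hqd r hr).deriv, hQr r, mul_pow, pow_succ μ, hμσ, hZ2]
      field_simp
  have hzero : ∀ r > 0, (Q j r = 0 ↔ ∃ k, rs k = σ * r) := fun r hr => by
    have : σ * r ∈ {r : ℝ | 0 < r ∧ Z r = 0} ↔ σ * r ∈ range rs := by rw [hrs_zeros]
    rw [hQr r, mul_eq_zero_iff_left hμ.ne']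
    simpa [mul_pos hσ hr] using this
  have hroot : ∀ k, Q j (rs k / σ) = 0 := fun k =>
    (hzero _ (div_pos (hrs_pos k) hσ)).2 ⟨k, by field_simp⟩
  have houter : ∀ r > rs 0 / σ, Q j r ≠ 0 := fun r hr h => by
    obtain ⟨k, hk⟩ := (hzero r ((div_pos (hrs_pos 0) hσ).trans hr)).1 h
    rw [gt_iff_lt, div_lt_iff₀' hσ, ← hk] at hr
    exact (hrs_anti.antitone (Nat.zero_le k)).not_gt hr
  have hσlim : Tendsto (fun r => σ * r) atTop atTop := tendsto_id.const_mul_atTop hσ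
  have hZlim : Tendsto (fun r => r * Z r) atTop (nhds 1) := by
    obtain ⟨C, -, hC⟩ := hZdecay
    rw [tendsto_iff_norm_sub_tendsto_zero]
    refine squeeze_zero' (Eventually.of_forall fun _ => norm_nonneg _)
      ((eventually_ge_atTop 1).mono hC) ?_
    exact tendsto_const_nhds.div_atTop (tendsto_pow_atTop two_ne_zero)
  have hqA : Tendsto (fun r => r * Q j r) atTop (nhds (μ / σ * 1)) := by
    refine ((hZlim.comp hσlim).const_mul (μ / σ)).congr fun r => ?_
    rw [hQr r, Function.comp_apply]
    field_simp
  have hqB : Tendsto (fun r => r ^ 2 * deriv (Q j) r) atTop (nhds (μ / σ * -1)) := by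
    refine ((hZderiv.comp hσlim).const_mul (μ / σ)).congr' ?_
    filter_upwards [eventually_gt_atTop 0] with r hr
    rw [(hqd r hr).deriv, Function.comp_apply]
    field_simp
  have hpos := pohozaev_pos hm (div_pos (hrs_pos 0) hσ) hq hq' houter
    (tendsto_pohozaev_atTop hm hqA hqB)
  refine ⟨fun i hi f hf hfa hfb => ?_, fun f hf hfa hfs => ?_⟩
  · refine gagliardoNirenberg_Icc hm (div_pos (hrs_pos _) hσ)
      (div_lt_div_of_pos_right (hrs_anti (by omega)) hσ) hq hq' (fun r hr h => ?_) hpos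
      (hroot _) (hroot _) hf hfa hfb
    obtain ⟨k, hk⟩ := (hzero r ((div_pos (hrs_pos _) hσ).trans hr.1)).1 h
    rw [mem_Ioo, div_lt_iff₀' hσ, lt_div_iff₀' hσ, ← hk, hrs_anti.lt_iff_gt,
      hrs_anti.lt_iff_gt] at hr
    omega
  · exact gagliardoNirenberg_Ici hm (div_pos (hrs_pos 0) hσ) hq hq' houter hpos hqA hqB
      (hroot 0) hf hfa hfs
end
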